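/- arXiv:1808.09021 — 3 statements merged into one kernel-verified Lean document; each statement's English description precedes it below -/
import Mathlib

section
/- Let ℓ be a prime, F a field, and D a central division algebra over F of degree ℓ², i.e., dim_F D = ℓ⁴. Let M be a maximal subfield of D (so [M:F] = ℓ²), let Y be a subfield of M containing F with [Y:F] = ℓ such that Y/F is a cyclic Galois extension, and let z ∈ M satisfy N_{M/F}(z) = 1; set a := N_{M/Y}(z). Suppose there exist elements a₁, a₂ ∈ Y and subfields E₁, E₂ of D containing F such that for each i = 1, 2: (1) a₁·a₂ = a; (2) [E_i : F] = ℓ; (3) every element of E_i commutes with every element of Y, and the algebra D ⊗_F E_i ⊗_F Y is split, i.e., isomorphic as an (E_i ⊗_F Y)-algebra to a matrix algebra over E_i ⊗_F Y; (4) there exists θ_i in the F-subalgebra YE_i of D generated by Y and E_i (which is automatically a field of degree ℓ over Y) with N_{YE_i/Y}(θ_i) = a_i; and (5) θ_i lies in the commutator subgroup [Dˣ, Dˣ]. Then z ∈ [Dˣ, Dˣ]. -/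
open scoped TensorProduct

universe u

section Dieudonne

open Function (update update_self update_of_ne update_idem)

variable {C H : Type*} [DivisionRing C] [CommGroup H]

/-- A function on `n`-tuples of row vectors which transforms under elementary row operations
like a determinant with values in a commutative group `H`, up to sign. -/
structure IsRowDet (φ : Cˣ →* H) {n : ℕ} {V : Type*} [AddCommGroup V] [Module C V]
    (δ : (Fin n → V) → H) : Prop where
  smul : ∀ v, LinearIndependent C v → ∀ i (c : Cˣ),
    δ (update v i ((c : C) • v i)) = φ c * δ v
  add : ∀ v, LinearIndependent C v → ∀ i j (c : C), i ≠ j →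
    δ (update v i (v i + c • v j)) = δ v

variable {V : Type*} [AddCommGroup V] [Module C V] {n : ℕ}

theorem linearIndependent_update_smul_add {v : Fin n → V} (hv : LinearIndependent C v)
    (i : Fin n) (c : Cˣ) {w : V} (hw : w ∈ Submodule.span C (v '' {i}ᶜ)) :
    LinearIndependent C (update v i ((c : C) • v i + w)) := by
  classical
  rw [linearIndependent_iff_notMem_span] at hv
  have key : LinearIndepOn C (update v i ((c : C) • v i + w)) (insert i {i}ᶜ) := by
    have h1 : LinearIndepOn C v ({i}ᶜ : Set (Fin n)) :=
      ((linearIndependent_iff_notMem_span.2 hv).linearIndepOn _)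
    have he : Set.EqOn (update v i ((c : C) • v i + w)) v ({i}ᶜ : Set (Fin n)) :=
      fun x hx => update_of_ne hx _ _
    rw [linearIndepOn_insert (by simp), linearIndepOn_congr he, he.image_eq]
    refine ⟨h1, fun h => hv i ?_⟩
    simp only [update_self] at h
    have h2 := (Submodule.add_mem_iff_left _ hw).1 h
    have h3 := Submodule.smul_mem _ ((c⁻¹ : Cˣ) : C) h2
    rw [smul_smul, Units.inv_mul, one_smul] at h3
    rwa [← Set.compl_eq_univ_sdiff]
  rw [← linearIndepOn_univ_iff]
  convert key
  ext x; simp [Classical.em]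

theorem linearIndependent_update_add {v : Fin n → V} (hv : LinearIndependent C v)
    {i j : Fin n} (hij : i ≠ j) (c : C) :
    LinearIndependent C (update v i (v i + c • v j)) := by
  simpa using linearIndependent_update_smul_add hv i 1 (w := c • v j)
    (Submodule.smul_mem _ _ (Submodule.subset_span ⟨j, by simpa using hij.symm, rfl⟩))

theorem linearIndependent_update_smul {v : Fin n → V} (hv : LinearIndependent C v)
    (i : Fin n) (c : Cˣ) :
    LinearIndependent C (update v i ((c : C) • v i)) := by
  simpa using linearIndependent_update_smul_add hv i c (w := 0) (zero_mem _)

theorem rowOp_add_induction {P : (Fin n → V) → Prop}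
    (add : ∀ v, LinearIndependent C v → ∀ i j (c : C), i ≠ j →
      P (update v i (v i + c • v j)) → P v) {v : Fin n → V} (hv : LinearIndependent C v)
    (i : Fin n) {w : V} (hw : w ∈ Submodule.span C (v '' {i}ᶜ))
    (h : P (update v i (v i + w))) : P v := by
  suffices hs : ∀ u : Fin n → V, LinearIndependent C u → (∀ j, j ≠ i → u j = v j) →
      P (update u i (u i + w)) → P u from hs v hv (fun _ _ => rfl) h
  clear h
  induction hw using Submodule.closure_induction with
  | zero => intro u hu huv h; simpa using h
  | add x y hx hy ihx ihy =>
    intro u hu huv h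
    have hxu : x ∈ Submodule.span C (u '' {i}ᶜ) := by
      convert hx using 2
      exact Set.image_congr fun a ha => huv a ha
    have hL := linearIndependent_update_smul_add hu i 1 hxu
    rw [Units.val_one, one_smul] at hL
    refine ihx u hu huv (ihy _ hL (fun j hj => by simp [update_of_ne hj, huv j hj]) ?_)
    rwa [update_idem, update_self, add_assoc]
  | smul_mem c x hx =>
    obtain ⟨j, hj, rfl⟩ := hx
    intro u hu huv h
    exact add u hu i j c (Ne.symm hj) (by rwa [huv j hj])

/-- Induction along elementary row operations. -/
theorem rowOp_induction {e : Fin n → V} (he : LinearIndependent C e)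
    (hspan : ⊤ ≤ Submodule.span C (Set.range e)) {P : (Fin n → V) → Prop}
    (one : P e)
    (smul : ∀ v, LinearIndependent C v → ∀ i (c : Cˣ), P (update v i ((c : C) • v i)) → P v)
    (add : ∀ v, LinearIndependent C v → ∀ i j (c : C), i ≠ j →
      P (update v i (v i + c • v j)) → P v) (v : Fin n → V) (hv : LinearIndependent C v) : P v := by
  classical
  suffices hs : ∀ N, ∀ v : Fin n → V, LinearIndependent C v →
      (Finset.univ.filter fun k => v k ≠ e k).card ≤ N → P v from hs _ v hv le_rfl
  have hfr : n = Module.finrank C V := by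
    rw [Module.finrank_eq_card_basis (Module.Basis.mk he hspan), Fintype.card_fin]
  intro N
  induction N with
  | zero =>
    intro v hv hN
    have : v = e := by
      ext k
      by_contra hk
      have := Finset.card_eq_zero.1 (Nat.le_zero.1 hN)
      exact Finset.notMem_empty k (this ▸ by simpa using hk)
    rwa [this]
  | succ N ih =>
    intro v hv hN
    by_cases hall : ∀ k, v k = e k
    · rwa [show v = e from funext hall]
    push Not at hall
    obtain ⟨k, hk⟩ := hall
    -- if `e k` has a nonzero coefficient at `v k` then `v k` can be replaced by `e k`
    have main : ∀ v : Fin n → V, LinearIndependent C v → v k ≠ e k →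
        (Finset.univ.filter fun k => v k ≠ e k).card ≤ N + 1 →
        ∀ l : Fin n → C, ∑ i, l i • v i = e k → l k ≠ 0 → P v := by
      intro v hv hk hN l hl hlk
      have hw : ∑ i ∈ Finset.univ.erase k, l i • v i ∈ Submodule.span C (v '' {k}ᶜ) :=
        Submodule.sum_mem _ fun i hi => Submodule.smul_mem _ _
          (Submodule.subset_span ⟨i, by simpa using hi, rfl⟩)
      have hek : l k • v k + ∑ i ∈ Finset.univ.erase k, l i • v i = e k := by
        rw [← hl, Finset.add_sum_erase _ (fun i => l i • v i) (Finset.mem_univ k)]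
      refine smul v hv k (Units.mk0 _ hlk) (rowOp_add_induction add
        (linearIndependent_update_smul hv _ _) k
        (w := ∑ i ∈ Finset.univ.erase k, l i • v i) ?_ ?_)
      · convert hw using 2
        exact Set.image_congr fun a ha => update_of_ne ha _ _
      · rw [update_idem, update_self, Units.val_mk0, hek]
        apply ih
        · rw [← hek]
          exact linearIndependent_update_smul_add hv k (Units.mk0 _ hlk) hw
        · refine Nat.le_of_lt_succ (lt_of_lt_of_le (Finset.card_lt_card ?_) hN)
          refine ⟨fun i => ?_, fun h => ?_⟩
          · by_cases hik : i = k
            · subst hik; simp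
            · simp [update_of_ne hik]
          · have := h (show k ∈ _ by simpa using hk)
            simp at this
    have : Module.Finite C V := Module.Finite.of_basis (Module.Basis.mk he hspan)
    have hsv : ⊤ ≤ Submodule.span C (Set.range v) :=
      (hv.span_eq_top_of_card_eq_finrank' (by simpa using hfr)).ge
    obtain ⟨l, hl⟩ := (Submodule.mem_span_range_iff_exists_fun C).1
      (hsv (Submodule.mem_top (x := e k)))
    by_cases hlk : l k = 0
    · obtain ⟨i, hi, hli⟩ : ∃ i, v i ≠ e i ∧ l i ≠ 0 := by
        by_contra! hcon
        rw [linearIndependent_iff_notMem_span] at he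
        apply he k
        rw [← hl]
        refine Submodule.sum_mem _ fun i _ => ?_
        by_cases hie : v i = e i
        · by_cases hik : i = k
          · subst hik; simp [hlk]
          · rw [hie]
            exact Submodule.smul_mem _ _ (Submodule.subset_span ⟨i, by simpa using hik, rfl⟩)
        · rw [hcon i hie, zero_smul]; exact zero_mem _
      have hik : i ≠ k := fun h => hli (h ▸ hlk)
      refine add v hv i k 1 hik (main _ (linearIndependent_update_add hv hik 1) ?_ ?_
        (update l k (-l i)) ?_ (by simpa using hli))
      · rwa [update_of_ne hik.symm]
      · refine le_trans (Finset.card_le_card fun j => ?_) hN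
        by_cases hji : j = i
        · subst hji; simp [hi]
        · simp [update_of_ne hji]
      · rw [← hl, ← Finset.add_sum_erase _ _ (Finset.mem_univ i),
          ← Finset.add_sum_erase Finset.univ (fun i => l i • v i) (Finset.mem_univ i),
          ← Finset.add_sum_erase _ _ (Finset.mem_erase.2 ⟨hik.symm, Finset.mem_univ k⟩),
          ← Finset.add_sum_erase _ (fun i => l i • v i)
            (Finset.mem_erase.2 ⟨hik.symm, Finset.mem_univ k⟩)]
        have : ∑ x ∈ (Finset.univ.erase i).erase k, update l k (-l i) x •
            update v i (v i + (1 : C) • v k) x =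
            ∑ x ∈ (Finset.univ.erase i).erase k, l x • v x := by
          refine Finset.sum_congr rfl fun x hx => ?_
          simp only [Finset.mem_erase] at hx
          rw [update_of_ne hx.1, update_of_ne hx.2.1]
        rw [this]
        simp [update_of_ne hik, update_of_ne hik.symm, hlk]
    · exact main v hv hk hN l hl hlk

namespace IsRowDet

variable {φ : Cˣ →* H} {δ : (Fin n → V) → H}

theorem add_mem (h : IsRowDet φ δ) {v : Fin n → V} (hv : LinearIndependent C v) (i : Fin n)
    {w : V} (hw : w ∈ Submodule.span C (v '' {i}ᶜ)) : δ (update v i (v i + w)) = δ v :=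
  (rowOp_add_induction (P := fun u => δ u = δ (update v i (v i + w)))
    (fun u hu i j c hij hP => by rw [← hP, h.add u hu i j c hij]) hv i hw rfl).symm

theorem smul_add_mem (h : IsRowDet φ δ) {v : Fin n → V} (hv : LinearIndependent C v) (i : Fin n)
    (c : Cˣ) {w : V} (hw : w ∈ Submodule.span C (v '' {i}ᶜ)) :
    δ (update v i ((c : C) • v i + w)) = φ c * δ v := by
  have := h.add_mem (linearIndependent_update_smul hv i c) i (w := w) (by
    convert hw using 2
    exact Set.image_congr fun a ha => update_of_ne ha _ _)
  rw [update_idem, update_self] at this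
  rw [this, h.smul v hv]

theorem comp_perm (h : IsRowDet φ δ) (hφ : φ (-1) = 1) (π : Equiv.Perm (Fin n)) :
    ∀ {v : Fin n → V}, LinearIndependent C v → δ (v ∘ π) = δ v := by
  induction π using Equiv.Perm.swap_induction_on with
  | one => intros; rfl
  | swap_mul π x y hxy ih =>
    intro v hv
    have h1 : δ (v ∘ Equiv.swap x y) = δ v := by
      have e1 := h.add v hv y x 1 hxy.symm
      have l1 := linearIndependent_update_add hv hxy.symm 1
      have e2 := h.add _ l1 x y (-1) hxy
      have l2 := linearIndependent_update_add l1 hxy (-1)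
      have e3 := h.add _ l2 y x 1 hxy.symm
      have l3 := linearIndependent_update_add l2 hxy.symm 1
      have e4 := h.smul _ l3 x (-1)
      rw [hφ, one_mul, e3, e2, e1] at e4
      rw [← e4]
      congr 1
      ext k
      by_cases hkx : k = x
      · subst hkx; simp [hxy, hxy.symm]
      · by_cases hky : k = y
        · subst hky; simp [hxy, hxy.symm]
        · simp [hkx, hky, Equiv.swap_apply_of_ne_of_ne hkx hky]
    rw [Equiv.Perm.coe_mul, ← Function.comp_assoc, ih (hv.comp _ (Equiv.injective _)), h1]

theorem prod_smul (h : IsRowDet φ δ) {v : Fin n → V} (hv : LinearIndependent C v)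
    (d : Fin n → Cˣ) : δ (fun i => (d i : C) • v i) = (∏ i, φ (d i)) * δ v := by
  classical
  suffices hs : ∀ s : Finset (Fin n), LinearIndependent C (s.piecewise (fun i => (d i : C) • v i) v)
      ∧ δ (s.piecewise (fun i => (d i : C) • v i) v) = (∏ i ∈ s, φ (d i)) * δ v by
    simpa using (hs Finset.univ).2
  intro s
  induction s using Finset.induction_on with
  | empty => simpa using hv
  | insert a s ha ih =>
    have e : (insert a s).piecewise (fun i => (d i : C) • v i) v =
        update (s.piecewise (fun i => (d i : C) • v i) v) a
          ((d a : C) • s.piecewise (fun i => (d i : C) • v i) v a) := by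
      rw [Finset.piecewise_insert, Finset.piecewise_eq_of_notMem _ _ _ ha]
    rw [e]
    exact ⟨linearIndependent_update_smul ih.1 a _, by
      rw [h.smul _ ih.1, ih.2, Finset.prod_insert ha, mul_assoc]⟩

end IsRowDet

variable {φ : Cˣ →* H}

/-- The family of vectors obtained by deleting the `i`-th row and the zeroth column. -/
def rowMinor (A : Fin (n + 1) → Fin (n + 1) → C) (i : Fin (n + 1)) (k : Fin n) : Fin n → C :=
  LinearMap.funLeft C C Fin.succ (A (i.succAbove k))

theorem eq_smul_single_of_funLeft_succ_eq_zero {x : Fin (n + 1) → C}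
    (hx : LinearMap.funLeft C C Fin.succ x = 0) : x = x 0 • Pi.single 0 1 := by
  ext k
  refine Fin.cases ?_ (fun k => ?_) k
  · simp
  · simpa using congrFun hx k

variable {A : Fin (n + 1) → Fin (n + 1) → C} {l : Fin (n + 1) → C}

theorem linearIndependent_rowMinor (hA : LinearIndependent C A)
    (hl : ∑ k, l k • A k = Pi.single 0 1) {i : Fin (n + 1)} (hi : l i ≠ 0) :
    LinearIndependent C (rowMinor A i) := by
  rw [Fintype.linearIndependent_iff] at hA ⊢
  intro g hg k
  have h0 : LinearMap.funLeft C C Fin.succ (∑ k, g k • A (i.succAbove k)) = 0 := by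
    rw [← hg, map_sum]; simp [rowMinor]
  obtain ⟨t, ht⟩ : ∃ t : C, ∑ k, g k • A (i.succAbove k) = t • Pi.single 0 1 :=
    ⟨_, eq_smul_single_of_funLeft_succ_eq_zero h0⟩
  have h1 : ∑ k, (i.insertNth 0 g - t • l : Fin (n + 1) → C) k • A k = 0 := by
    simp only [Pi.sub_apply, Pi.smul_apply, sub_smul, Finset.sum_sub_distrib, smul_assoc,
      ← Finset.smul_sum, hl, ← ht]
    rw [Fin.sum_univ_succAbove _ i]
    simp
  have h2 := hA _ h1
  have h3 := h2 i
  simp only [Pi.sub_apply, Fin.insertNth_apply_same, Pi.smul_apply, smul_eq_mul, zero_sub,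
    neg_eq_zero, mul_eq_zero, hi, or_false] at h3
  simpa [h3] using h2 (i.succAbove k)

theorem rowDet_rowMinor_eq {δ : (Fin n → Fin n → C) → H} (hδ : IsRowDet φ δ) (hφ : φ (-1) = 1)
    (hA : LinearIndependent C A) (hl : ∑ k, l k • A k = Pi.single 0 1) {i j : Fin (n + 1)}
    (u w : Cˣ) (hi : l i = u) (hj : l j = w) :
    (φ u)⁻¹ * δ (rowMinor A i) = (φ w)⁻¹ * δ (rowMinor A j) := by
  by_cases hij : i = j
  · subst hij
    rw [show u = w from Units.ext (hi.symm.trans hj)]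
  have hi0 : l i ≠ 0 := hi ▸ u.ne_zero
  have hj0 : l j ≠ 0 := hj ▸ w.ne_zero
  obtain ⟨p, hp⟩ := Fin.exists_succAbove_eq hij
  have hs : ∀ q, ∃ r, i.succAbove r = update j.succAbove p j q := by
    intro q
    apply Fin.exists_succAbove_eq
    by_cases hq : q = p
    · subst hq; simpa using Ne.symm hij
    · rw [update_of_ne hq, ← hp]
      exact fun h => hq (Fin.succAbove_right_injective h)
  choose π hπ using hs
  have hπi : Function.Injective π := by
    intro a b hab
    have : update j.succAbove p j a = update j.succAbove p j b := by rw [← hπ, ← hπ, hab]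
    by_cases ha : a = p <;> by_cases hb : b = p
    · rw [ha, hb]
    · subst ha
      rw [update_self, update_of_ne hb] at this
      exact absurd this.symm (Fin.succAbove_ne _ _)
    · subst hb
      rw [update_self, update_of_ne ha] at this
      exact absurd this (Fin.succAbove_ne _ _)
    · rw [update_of_ne ha, update_of_ne hb] at this
      exact Fin.succAbove_right_injective this
  let σ : Equiv.Perm (Fin n) := Equiv.ofBijective π (Finite.injective_iff_bijective.1 hπi)
  set B : Fin n → Fin n → C := rowMinor A i ∘ σ with hB
  have hBq : ∀ q, B q = LinearMap.funLeft C C Fin.succ (A (update j.succAbove p j q)) := by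
    intro q
    change LinearMap.funLeft C C Fin.succ (A (i.succAbove (π q))) = _
    rw [hπ]
  have hBL : LinearIndependent C B := (linearIndependent_rowMinor hA hl hi0).comp _ σ.injective
  have hsum : ∑ k, l (j.succAbove k) • rowMinor A j k +
      l j • LinearMap.funLeft C C Fin.succ (A j) = 0 := by
    have := congrArg (LinearMap.funLeft C C Fin.succ) hl
    rw [Fin.sum_univ_succAbove _ j, map_add, map_sum, add_comm] at this
    simp only [map_smul] at this
    rw [show LinearMap.funLeft C C Fin.succ (Pi.single (0 : Fin (n + 1)) (1 : C)) = 0 by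
      ext k; simp] at this
    exact this
  have hmem : ∑ k ∈ Finset.univ.erase p, (-(l i)⁻¹ * l (j.succAbove k)) • B k ∈
      Submodule.span C (B '' {p}ᶜ) :=
    Submodule.sum_mem _ fun k hk => Submodule.smul_mem _ _
      (Submodule.subset_span ⟨k, by simpa using hk, rfl⟩)
  have hup : rowMinor A j = update B p (((-u⁻¹ * w : Cˣ) : C) • B p +
      ∑ k ∈ Finset.univ.erase p, (-(l i)⁻¹ * l (j.succAbove k)) • B k) := by
    ext1 q
    by_cases hq : q = p
    · subst hq
      have hBk : ∀ k ∈ Finset.univ.erase q, (-(l i)⁻¹ * l (j.succAbove k)) • B k =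
          -(l i)⁻¹ • (l (j.succAbove k) • rowMinor A j k) := by
        intro k hk
        rw [hBq, update_of_ne (Finset.ne_of_mem_erase hk), mul_smul, rowMinor]
      rw [update_self, Finset.sum_congr rfl hBk, ← Finset.smul_sum, hBq, update_self]
      rw [← Finset.add_sum_erase _ _ (Finset.mem_univ q), hp] at hsum
      have : ∑ k ∈ Finset.univ.erase q, l (j.succAbove k) • rowMinor A j k =
          -(l i • rowMinor A j q) - l j • LinearMap.funLeft C C Fin.succ (A j) := by
        rw [eq_sub_iff_add_eq, eq_neg_iff_add_eq_zero, ← hsum]; abel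
      rw [this, smul_sub, smul_neg, neg_smul, smul_smul, inv_mul_cancel₀ hi0, one_smul, neg_neg,
        neg_smul, sub_neg_eq_add, smul_smul, hi, hj]
      simp
    · rw [update_of_ne hq, hBq, update_of_ne hq, rowMinor]
  rw [hup, hδ.smul_add_mem hBL p _ hmem, hB,
    hδ.comp_perm hφ σ (linearIndependent_rowMinor hA hl hi0)]
  rw [neg_mul, ← neg_one_mul, map_mul, hφ, one_mul, map_mul, map_inv, ← mul_assoc]
  congr 1
  rw [mul_comm (φ u)⁻¹, inv_mul_cancel_left]

theorem exists_sum_smul_eq_single (hA : LinearIndependent C A) :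
    ∃ l : Fin (n + 1) → C, ∑ k, l k • A k = Pi.single 0 1 := by
  have hs : ⊤ ≤ Submodule.span C (Set.range A) :=
    (hA.span_eq_top_of_card_eq_finrank' (by simp)).ge
  exact (Submodule.mem_span_range_iff_exists_fun C).1 (hs Submodule.mem_top)

open Classical in
/-- One step of the recursive construction of the Dieudonné determinant. -/
noncomputable def rowDetSucc (φ : Cˣ →* H) (δ : (Fin n → Fin n → C) → H)
    (A : Fin (n + 1) → Fin (n + 1) → C) : H :=
  if h : ∃ p : (Fin (n + 1) → C) × Fin (n + 1) × Cˣ,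
      ∑ k, p.1 k • A k = Pi.single 0 1 ∧ p.1 p.2.1 = p.2.2 then
    (φ h.choose.2.2)⁻¹ * δ (rowMinor A h.choose.2.1)
  else 1

theorem rowDetSucc_eq {δ : (Fin n → Fin n → C) → H} (hδ : IsRowDet φ δ) (hφ : φ (-1) = 1)
    (hA : LinearIndependent C A) (hl : ∑ k, l k • A k = Pi.single 0 1) {i : Fin (n + 1)}
    (u : Cˣ) (hi : l i = u) : rowDetSucc φ δ A = (φ u)⁻¹ * δ (rowMinor A i) := by
  have h : ∃ p : (Fin (n + 1) → C) × Fin (n + 1) × Cˣ,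
      ∑ k, p.1 k • A k = Pi.single 0 1 ∧ p.1 p.2.1 = p.2.2 := ⟨⟨l, i, u⟩, hl, hi⟩
  rw [rowDetSucc, dif_pos h]
  have hll : h.choose.1 = l := by
    have h0 : ∑ k, (h.choose.1 - l) k • A k = 0 := by
      simp [sub_smul, Finset.sum_sub_distrib, hl, h.choose_spec.1]
    exact sub_eq_zero.1 (funext (Fintype.linearIndependent_iff.1 hA _ h0))
  exact rowDet_rowMinor_eq hδ hφ hA hl _ _ (hll ▸ h.choose_spec.2) hi

theorem isRowDet_rowDetSucc {δ : (Fin n → Fin n → C) → H} (hδ : IsRowDet φ δ)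
    (hφ : φ (-1) = 1) : IsRowDet φ (rowDetSucc φ δ) where
  smul A hA i c := by
    obtain ⟨l, hl⟩ := exists_sum_smul_eq_single hA
    obtain ⟨j, hj⟩ : ∃ j, l j ≠ 0 := by
      by_contra! h
      simpa [h] using congrFun hl 0
    have hl' : ∑ k, update l i (l i * (c⁻¹ : Cˣ)) k • update A i ((c : C) • A i) k =
        Pi.single 0 1 := by
      rw [← hl]
      refine Finset.sum_congr rfl fun k _ => ?_
      by_cases hk : k = i
      · subst hk; simp [smul_smul]
      · simp [update_of_ne hk]
    rw [rowDetSucc_eq hδ hφ hA hl (Units.mk0 _ hj) rfl]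
    have hA' := linearIndependent_update_smul hA i c
    by_cases hji : j = i
    · subst hji
      rw [rowDetSucc_eq hδ hφ hA' hl' (i := j) (Units.mk0 _ hj * c⁻¹) (by simp)]
      rw [show rowMinor (update A j ((c : C) • A j)) j = rowMinor A j by
        ext1 k; simp [rowMinor]]
      rw [map_mul, map_inv, mul_inv_rev, inv_inv, mul_assoc]
    · rw [rowDetSucc_eq hδ hφ hA' hl' (i := j) (Units.mk0 _ hj) (by simp [update_of_ne hji])]
      obtain ⟨q, hq⟩ := Fin.exists_succAbove_eq (Ne.symm hji)
      rw [show rowMinor (update A i ((c : C) • A i)) j =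
          update (rowMinor A j) q ((c : C) • rowMinor A j q) by
        ext1 k
        by_cases hk : k = q
        · subst hk; simp [rowMinor, hq]
        · rw [update_of_ne hk, rowMinor, update_of_ne, rowMinor]
          rw [← hq]
          exact fun h => hk (Fin.succAbove_right_injective h)]
      rw [hδ.smul _ (linearIndependent_rowMinor hA hl hj), mul_left_comm]
  add A hA i j c hij := by
    obtain ⟨l, hl⟩ := exists_sum_smul_eq_single hA
    have hA' := linearIndependent_update_add hA hij c
    have hl' : ∑ k, update l j (l j - l i * c) k • update A i (A i + c • A j) k =
        Pi.single 0 1 := by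
      rw [← hl, ← Finset.add_sum_erase _ _ (Finset.mem_univ i),
        ← Finset.add_sum_erase _ (fun k => l k • A k) (Finset.mem_univ i),
        ← Finset.add_sum_erase _ _ (Finset.mem_erase.2 ⟨hij.symm, Finset.mem_univ j⟩),
        ← Finset.add_sum_erase _ (fun k => l k • A k)
          (Finset.mem_erase.2 ⟨hij.symm, Finset.mem_univ j⟩)]
      have : ∑ x ∈ (Finset.univ.erase i).erase j, update l j (l j - l i * c) x •
          update A i (A i + c • A j) x = ∑ x ∈ (Finset.univ.erase i).erase j, l x • A x := by
        refine Finset.sum_congr rfl fun x hx => ?_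
        simp only [Finset.mem_erase] at hx
        rw [update_of_ne hx.1, update_of_ne hx.2.1]
      rw [this]
      simp only [update_self, update_of_ne hij, update_of_ne hij.symm, smul_add, sub_smul,
        smul_smul]
      abel
    by_cases hk : ∃ k, k ≠ j ∧ l k ≠ 0
    · obtain ⟨k, hkj, hk⟩ := hk
      rw [rowDetSucc_eq hδ hφ hA hl (Units.mk0 _ hk) rfl,
        rowDetSucc_eq hδ hφ hA' hl' (i := k) (Units.mk0 _ hk) (by simp [update_of_ne hkj])]
      congr 1
      by_cases hki : k = i
      · subst hki
        congr 1
        ext1 q; simp [rowMinor]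
      · obtain ⟨q, hq⟩ := Fin.exists_succAbove_eq (Ne.symm hki)
        obtain ⟨r, hr⟩ := Fin.exists_succAbove_eq (Ne.symm hkj)
        rw [← hδ.add _ (linearIndependent_rowMinor hA hl hk) q r c
          (fun h => hij (by rw [← hq, ← hr, h]))]
        congr 1
        ext1 x
        by_cases hx : x = q
        · subst hx; simp [rowMinor, hq, hr]
        · rw [update_of_ne hx, rowMinor, update_of_ne, rowMinor]
          rw [← hq]
          exact fun h => hx (Fin.succAbove_right_injective h)
    · push Not at hk
      have hj : l j ≠ 0 := by
        intro hj
        have : ∀ k, l k = 0 := fun k => by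
          by_cases h : k = j
          · rwa [h]
          · exact hk k h
        simpa [this] using congrFun hl 0
      have hlj : l j • A j = Pi.single 0 1 := by
        rw [← hl, Finset.sum_eq_single j (fun b _ hb => by rw [hk b hb, zero_smul]) (by simp)]
      have hAj : LinearMap.funLeft C C Fin.succ (A j) = 0 := by
        have : A j = (l j)⁻¹ • Pi.single 0 1 := by
          rw [← hlj, smul_smul, inv_mul_cancel₀ hj, one_smul]
        rw [this, map_smul]
        ext k; simp
      rw [rowDetSucc_eq hδ hφ hA hl (Units.mk0 _ hj) rfl,
        rowDetSucc_eq hδ hφ hA' hl' (i := j) (Units.mk0 _ hj) (by simp [hk i hij])]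
      congr 2
      ext1 q
      by_cases hq : j.succAbove q = i
      · simp [rowMinor, hq, hAj]
      · simp [rowMinor, update_of_ne hq]

theorem exists_isRowDet (hφ : φ (-1) = 1) (n : ℕ) : ∃ δ : (Fin n → Fin n → C) → H,
    IsRowDet φ δ ∧ δ (fun i => Pi.single i 1) = 1 := by
  induction n with
  | zero => exact ⟨fun _ => 1, ⟨fun _ _ i => i.elim0, fun _ _ i => i.elim0⟩, rfl⟩
  | succ n ih =>
    obtain ⟨δ, hδ, h1⟩ := ih
    refine ⟨rowDetSucc φ δ, isRowDet_rowDetSucc hδ hφ, ?_⟩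
    have hLI : LinearIndependent C (fun i : Fin (n + 1) => (Pi.single i 1 : Fin (n + 1) → C)) :=
      Pi.linearIndependent_single_one _ _
    rw [rowDetSucc_eq hδ hφ hLI (l := Pi.single 0 1) (i := 0) ?_ 1 (by simp)]
    · rw [map_one, inv_one, one_mul, ← h1]
      congr 1
      ext i j
      simp [rowMinor, Pi.single_apply]
    · rw [Finset.sum_eq_single 0] <;> simp +contextual

/-- **Dieudonné determinant** over a division ring, up to sign. -/
theorem exists_dieudonne_det (hφ : φ (-1) = 1) (n : ℕ) :
    ∃ δ : (Matrix (Fin n) (Fin n) C)ˣ →* H,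
      (∀ (d : Fin n → Cˣ) (U : (Matrix (Fin n) (Fin n) C)ˣ),
        U.val = Matrix.diagonal (fun i => (d i : C)) → δ U = ∏ i, φ (d i)) ∧
      (∀ (i j : Fin n) (c : C) (U : (Matrix (Fin n) (Fin n) C)ˣ), i ≠ j →
        U.val = 1 + Matrix.single i j c → δ U = 1) := by
  obtain ⟨δ, hδ, h1⟩ := exists_isRowDet hφ n
  let e : Fin n → Fin n → C := fun i => Pi.single i 1
  have he : LinearIndependent C e := Pi.linearIndependent_single_one _ _
  have hes : ⊤ ≤ Submodule.span C (Set.range e) :=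
    (he.span_eq_top_of_card_eq_finrank' (by simp)).ge
  have hLI : ∀ (v : Fin n → Fin n → C), LinearIndependent C v →
      ∀ U : (Matrix (Fin n) (Fin n) C)ˣ,
      LinearIndependent C (fun i => Matrix.vecMul (v i) U.val) := by
    intro v hv U
    refine hv.map' (Matrix.toLinearMapRight' U.val) (LinearMap.ker_eq_bot.2 ?_)
    refine Function.LeftInverse.injective (g := Matrix.toLinearMapRight' U⁻¹.val) fun x => ?_
    rw [Matrix.toLinearMapRight'_apply, Matrix.toLinearMapRight'_apply, Matrix.vecMul_vecMul]
    simp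
  have hev : ∀ U : (Matrix (Fin n) (Fin n) C)ˣ, (fun i => Matrix.vecMul (e i) U.val) = U.val :=
    fun U => by ext i j; simp [e]
  have hU : ∀ U : (Matrix (Fin n) (Fin n) C)ˣ, LinearIndependent C (U.val : Fin n → Fin n → C) :=
    fun U => hev U ▸ hLI e he U
  have hmul : ∀ (U : (Matrix (Fin n) (Fin n) C)ˣ) (v : Fin n → Fin n → C), LinearIndependent C v →
      δ (fun i => Matrix.vecMul (v i) U.val) = δ v * δ U.val := by
    intro U
    refine rowOp_induction he hes ?_ ?_ ?_
    · rw [hev, h1, one_mul]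
    · intro v hv i c h
      have := hδ.smul _ (hLI v hv U) i c
      rw [hδ.smul v hv, mul_assoc] at h
      apply mul_left_cancel (a := φ c)
      rw [← h, ← this]
      congr 1
      ext1 k
      by_cases hk : k = i
      · subst hk; simp [Matrix.smul_vecMul]
      · simp [update_of_ne hk]
    · intro v hv i j c hij h
      have := hδ.add _ (hLI v hv U) i j c hij
      rw [hδ.add v hv i j c hij] at h
      rw [← h, ← this]
      congr 1
      ext1 k
      by_cases hk : k = i
      · subst hk; simp [Matrix.smul_vecMul, Matrix.add_vecMul]
      · simp [update_of_ne hk]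
  refine ⟨⟨⟨fun U => δ U.val, ?_⟩, ?_⟩, ?_, ?_⟩
  · rw [← h1]; congr 1; ext i j; simp [Matrix.one_apply, Pi.single_apply, eq_comm]
  · intro U W
    exact hmul W U.val (hU U)
  · intro d U hd
    have := hδ.prod_smul he d
    rw [h1, mul_one] at this
    refine (congrArg δ ?_).trans this
    change U.val = _
    rw [hd]
    ext i j
    simp [e, Matrix.diagonal_apply, Pi.single_apply, eq_comm]
  · intro i j c U hij hd
    have := hδ.add e he i j c hij
    rw [h1] at this
    refine (congrArg δ ?_).trans this
    change U.val = _
    rw [hd]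
    ext a b
    by_cases ha : a = i
    · subst ha
      simp [e, Matrix.one_apply, Matrix.single_apply, Pi.single_apply, eq_comm]
    · simp [e, Matrix.one_apply, Pi.single_apply, eq_comm, Ne.symm ha]

end Dieudonne

section SkolemNoether

theorem isSimpleRing_tensorProduct {K C N : Type*} [Field K] [DivisionRing C] [Algebra K C]
    [Field N] [Algebra K N]
    (hC : ∀ c : C, (∀ d, d * c = c * d) → ∃ y, algebraMap K C y = c) :
    IsSimpleRing (C ⊗[K] N) := by
  classical
  let b := Module.Basis.ofVectorSpace K N
  let B := Algebra.TensorProduct.basis C b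
  have hBmul : ∀ (x : C ⊗[K] N) (d : C) j, B.repr (x * (d ⊗ₜ 1)) j = B.repr x j * d := by
    intro x d j
    induction x with
    | zero => simp
    | add x y hx hy => simp [add_mul, hx, hy]
    | tmul c n =>
      simp only [Algebra.TensorProduct.tmul_mul_tmul, mul_one, B,
        Algebra.TensorProduct.basis_repr_tmul]
      simp only [Finsupp.smul_apply, Finsupp.mapRange_apply, smul_eq_mul, mul_assoc,
        Algebra.commutes]
  have hBmul' : ∀ (x : C ⊗[K] N) (d : C) j, B.repr ((d ⊗ₜ 1) * x) j = d * B.repr x j := by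
    intro x d j
    have : (d ⊗ₜ[K] (1 : N)) * x = d • x := by
      rw [← one_mul x, ← smul_mul_assoc, one_mul, Algebra.TensorProduct.one_def,
        TensorProduct.smul_tmul', smul_eq_mul, mul_one]
    rw [this, map_smul]; rfl
  rw [isSimpleRing_iff_isTwoSided_imp]
  refine ⟨inferInstance, fun I hI => or_iff_not_imp_left.2 fun hne => ?_⟩
  obtain ⟨x₀, hx₀I, hx₀⟩ := I.ne_bot_iff.1 hne
  have hex : ∃ s, ∃ x ∈ I, x ≠ 0 ∧ (B.repr x).support.card = s := ⟨_, x₀, hx₀I, hx₀, rfl⟩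
  obtain ⟨x, hxI, hx, hcard⟩ := Nat.find_spec hex
  obtain ⟨i, hi⟩ : ∃ i, B.repr x i ≠ 0 := by
    by_contra! hcon
    exact hx (B.repr.map_eq_zero_iff.1 (Finsupp.ext hcon))
  let w := ((B.repr x i)⁻¹ ⊗ₜ[K] (1 : N)) * x
  have hwI : w ∈ I := I.mul_mem_left _ hxI
  have hwi : B.repr w i = 1 := by rw [hBmul', inv_mul_cancel₀ hi]
  have hws : ∀ j, B.repr x j = 0 → B.repr w j = 0 := fun j hj => by rw [hBmul', hj, mul_zero]
  have hcomm : ∀ j d, d * B.repr w j = B.repr w j * d := by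
    intro j d
    let v := (d ⊗ₜ[K] (1 : N)) * w - w * (d ⊗ₜ[K] (1 : N))
    have hv : ∀ j, B.repr v j = d * B.repr w j - B.repr w j * d := fun j => by
      rw [map_sub, Finsupp.sub_apply, hBmul', hBmul]
    have hv0 : v = 0 := by
      by_contra hv0
      refine Nat.find_min hex (m := (B.repr v).support.card) ?_
        ⟨v, I.sub_mem (I.mul_mem_left _ hwI) (I.mul_mem_right _ hwI), hv0, rfl⟩
      rw [← hcard]
      refine Finset.card_lt_card ⟨fun j hj => ?_, fun h => ?_⟩
      · rw [Finsupp.mem_support_iff, hv] at hj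
        rw [Finsupp.mem_support_iff]
        intro h0
        rw [hws j h0] at hj
        simp at hj
      · have := h (Finsupp.mem_support_iff.2 hi)
        rw [Finsupp.mem_support_iff, hv, hwi] at this
        simp at this
    rw [← sub_eq_zero, ← hv, hv0]; simp
  choose y hy using fun j => hC _ (hcomm j)
  let n : N := (B.repr w).support.sum fun j => y j • b j
  have hwn : w = 1 ⊗ₜ n := by
    rw [← B.linearCombination_repr w, Finsupp.linearCombination_apply, Finsupp.sum,
      TensorProduct.tmul_sum]
    refine Finset.sum_congr rfl fun j _ => ?_
    rw [← hy j, Algebra.TensorProduct.basis_apply, TensorProduct.smul_tmul', smul_eq_mul, mul_one,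
      TensorProduct.tmul_smul, TensorProduct.smul_tmul', Algebra.smul_def, mul_one]
  have hn : n ≠ 0 := by
    rintro h0
    rw [hwn, h0, TensorProduct.tmul_zero] at hwi
    simp at hwi
  refine (Ideal.eq_top_iff_one _).2 ?_
  have : (1 : C ⊗[K] N) = (1 ⊗ₜ n⁻¹) * w := by
    rw [hwn, Algebra.TensorProduct.tmul_mul_tmul, inv_mul_cancel₀ hn, mul_one,
      Algebra.TensorProduct.one_def]
  rw [this]
  exact I.mul_mem_left _ hwI

/-- Finite-dimensional modules over a simple algebra are classified by their dimension. -/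
theorem exists_linearEquiv_of_isSimpleRing {K R V W : Type*} [Field K] [Ring R] [Algebra K R]
    [IsSimpleRing R] [FiniteDimensional K R] [AddCommGroup V] [Module K V] [FiniteDimensional K V]
    [AddCommGroup W] [Module K W] [FiniteDimensional K W]
    (ρ : R →ₐ[K] Module.End K V) (τ : R →ₐ[K] Module.End K W)
    (h : Module.finrank K V = Module.finrank K W) :
    ∃ e : V ≃ₗ[K] W, ∀ r v, e (ρ r v) = τ r (e v) := by
  have : IsArtinianRing R := IsArtinianRing.of_finite K R
  let _ : Module R V := Module.compHom V ρ.toRingHom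
  let _ : Module R W := Module.compHom W τ.toRingHom
  have hV : ∀ (r : R) (v : V), r • v = ρ r v := fun _ _ => rfl
  have hW : ∀ (r : R) (v : W), r • v = τ r v := fun _ _ => rfl
  have : IsScalarTower K R V := ⟨fun k r v => by simp [hV]⟩
  have : IsScalarTower K R W := ⟨fun k r v => by simp [hW]⟩
  have : Module.Finite R V := Module.Finite.of_restrictScalars_finite K R V
  have : Module.Finite R W := Module.Finite.of_restrictScalars_finite K R W
  suffices hs : Nonempty (V ≃ₗ[R] W) by
    obtain ⟨e⟩ := hs
    exact ⟨e.restrictScalars K, fun r v => e.map_smul r v⟩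
  rcases subsingleton_or_nontrivial V with hs | hs
  · have : Subsingleton W := by
      rw [← Module.finrank_zero_iff (R := K)] at hs ⊢
      exact h ▸ hs
    exact ⟨0, 0, fun _ => Subsingleton.elim _ _, fun _ => Subsingleton.elim _ _⟩
  · obtain ⟨S, hS⟩ := IsSemisimpleModule.exists_simple_submodule R (V × W)
    have hVW := IsSimpleRing.isIsotypic R (V × W) S
    obtain ⟨m, ⟨e⟩⟩ := (hVW.of_injective (LinearMap.inl R V W)
      LinearMap.inl_injective).linearEquiv_fun
    obtain ⟨n, ⟨f⟩⟩ := (hVW.of_injective (LinearMap.inr R V W)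
      LinearMap.inr_injective).linearEquiv_fun
    have he := (e.restrictScalars K).finrank_eq
    have hf := (f.restrictScalars K).finrank_eq
    have hfin : Module.Finite K S := Module.Finite.of_injective
      (S.subtype.restrictScalars K) Subtype.val_injective
    rw [Module.finrank_pi_fintype] at he hf
    simp only [Finset.sum_const, Finset.card_univ, Fintype.card_fin, smul_eq_mul] at he hf
    have hpos : 0 < Module.finrank K V := Module.finrank_pos
    have hmn : m = n := by
      rw [h, hf] at he
      refine (Nat.eq_of_mul_eq_mul_right (Nat.pos_of_ne_zero fun h0 => ?_) he).symm
      rw [h, hf, h0] at hpos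
      simp at hpos
    subst hmn
    exact ⟨e.trans f.symm⟩

/-- The action of `C ⊗[K] N` on row vectors, `N` acting on the right through `f`. -/
theorem exists_tensorProduct_rep {K C N : Type*} [Field K] [DivisionRing C] [Algebra K C]
    [Field N] [Algebra K N] {m : ℕ} (f : N →ₐ[K] Matrix (Fin m) (Fin m) C) :
    ∃ ρ : C ⊗[K] N →ₐ[K] Module.End K (Fin m → C),
      ∀ c n v, ρ (c ⊗ₜ n) v = c • Matrix.vecMul v (f n) := by
  obtain ⟨r, hr⟩ : ∃ r : N →ₐ[K] Module.End K (Fin m → C),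
      ∀ n v, r n v = Matrix.vecMul v (f n) :=
    ⟨AlgHom.ofLinearMap
      { toFun n := (Matrix.toLinearMapRight' (f n)).restrictScalars K
        map_add' a b := by ext; simp
        map_smul' a b := by ext; simp }
      (by ext; simp)
      (fun a b => by
        rw [mul_comm]
        ext; simp), fun _ _ => rfl⟩
  obtain ⟨l, hl⟩ : ∃ l : C →ₐ[K] Module.End K (Fin m → C), ∀ c v, l c v = c • v :=
    ⟨Algebra.lsmul K K (Fin m → C), fun _ _ => rfl⟩
  refine ⟨Algebra.TensorProduct.lift l r fun a b => ?_, fun c n v => ?_⟩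
  · refine LinearMap.ext fun v => ?_
    simp [hl, hr, Matrix.smul_vecMul]
  · rw [← hr n v, ← hl]
    exact congrArg (fun φ : Module.End K (Fin m → C) => φ v)
      (Algebra.TensorProduct.lift_tmul (S := K) l r _ c n)

/-- **Skolem–Noether** for homomorphisms from a field to a matrix ring. -/
theorem exists_conj_of_algHom {K C N : Type*} [Field K] [DivisionRing C] [Algebra K C]
    [FiniteDimensional K C] [Field N] [Algebra K N] [FiniteDimensional K N]
    (hC : ∀ c : C, (∀ d, d * c = c * d) → ∃ y, algebraMap K C y = c)
    {m : ℕ} (f g : N →ₐ[K] Matrix (Fin m) (Fin m) C) :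
    ∃ u : (Matrix (Fin m) (Fin m) C)ˣ, ∀ x, u.val * f x = g x * u.val := by
  have := isSimpleRing_tensorProduct (N := N) hC
  obtain ⟨ρ, hρ⟩ := exists_tensorProduct_rep f
  obtain ⟨τ, hτ⟩ := exists_tensorProduct_rep g
  obtain ⟨e, he⟩ := exists_linearEquiv_of_isSimpleRing τ ρ rfl
  have hsmul : ∀ (c : C) v, e (c • v) = c • e v := fun c v => by
    simpa [hρ, hτ] using he (c ⊗ₜ 1) v
  have h2 : ∀ n v, e (Matrix.vecMul v (g n)) = Matrix.vecMul (e v) (f n) := fun n v => by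
    simpa [hρ, hτ] using he (1 ⊗ₜ n) v
  let e' : (Fin m → C) →ₗ[C] (Fin m → C) := { e.toLinearMap with map_smul' := hsmul }
  let e'' : (Fin m → C) →ₗ[C] (Fin m → C) :=
    { e.symm.toLinearMap with
      map_smul' := fun c v => by
        apply e.injective
        simp [hsmul] }
  refine ⟨⟨LinearMap.toMatrixRight' e', LinearMap.toMatrixRight' e'', ?_, ?_⟩, fun x => ?_⟩
  · rw [← LinearMap.toMatrixRight'_comp, ← LinearMap.toMatrixRight'_id]
    congr 1
    exact LinearMap.ext fun v => e.symm_apply_apply v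
  · rw [← LinearMap.toMatrixRight'_comp, ← LinearMap.toMatrixRight'_id]
    congr 1
    exact LinearMap.ext fun v => e.apply_symm_apply v
  · apply Matrix.toLinearMapRight'.injective
    refine LinearMap.ext fun v => ?_
    rw [Matrix.toLinearMapRight'_mul_apply, Matrix.toLinearMapRight'_mul_apply]
    simp only [LinearEquiv.symm_apply_apply]
    exact (h2 x v).symm

end SkolemNoether

section Centralizer

/-- `D` as a `D`-`E`-bimodule. -/
theorem exists_tensorProduct_rep_self {F E D : Type*} [Field F] [Field E] [Algebra F E]
    [DivisionRing D] [Algebra F D] (f : E →ₐ[F] D) :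
    ∃ ρ : D ⊗[F] E →ₐ[F] Module.End F D, ∀ c x v, ρ (c ⊗ₜ x) v = c * v * f x := by
  obtain ⟨r, hr⟩ : ∃ r : E →ₐ[F] Module.End F D, ∀ x v, r x v = v * f x :=
    ⟨AlgHom.ofLinearMap
      { toFun x := LinearMap.mulRight F (f x)
        map_add' a b := by ext; simp [mul_add]
        map_smul' a b := by ext; simp }
      (by ext; simp)
      (fun a b => by
        rw [mul_comm]
        ext; simp [mul_assoc]), fun _ _ => rfl⟩
  refine ⟨Algebra.TensorProduct.lift (Algebra.lmul F D) r fun a b => ?_, fun c x v => ?_⟩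
  · refine LinearMap.ext fun v => ?_
    simp [hr, mul_assoc]
  · rw [← hr x (c * v)]
    refine (congrArg (fun φ : Module.End F D => φ v)
      (Algebra.TensorProduct.lift_tmul (S := F) _ r _ c x)).trans ?_
    simp [hr, mul_assoc]

/-- The dimension formula for the centralizer of a subfield of a central division algebra. -/
theorem finrank_centralizer_mul_finrank {F E D : Type*} [Field F] [Field E] [Algebra F E]
    [DivisionRing D] [Algebra F D] [FiniteDimensional F D] [FiniteDimensional F E]
    (hD : ∀ c : D, (∀ d, d * c = c * d) → ∃ y, algebraMap F D y = c) (f : E →ₐ[F] D)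
    (Z : Submodule F D) (hZ : ∀ d, d ∈ Z ↔ ∀ x, f x * d = d * f x) :
    Module.finrank F Z * Module.finrank F E = Module.finrank F D := by
  have := isSimpleRing_tensorProduct (N := E) hD
  obtain ⟨ρ, hρ⟩ := exists_tensorProduct_rep_self f
  let k := Module.finrank F E
  obtain ⟨τ, hτ⟩ : ∃ τ : D ⊗[F] E →ₐ[F] Module.End F (Fin k → D),
      ∀ t v i, τ t v i = ρ t (v i) := by
    refine ⟨AlgHom.ofLinearMap
      { toFun t := LinearMap.pi fun i => ρ t ∘ₗ LinearMap.proj i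
        map_add' a b := by ext; simp
        map_smul' a b := by ext; simp }
      (by ext; simp)
      (fun a b => by ext; simp), fun _ _ _ => rfl⟩
  obtain ⟨e, he⟩ := exists_linearEquiv_of_isSimpleRing (Algebra.lmul F (D ⊗[F] E)) τ (by
    rw [Module.finrank_tensorProduct, Module.finrank_pi_fintype]
    simp [k, mul_comm])
  have he' : ∀ r v, e (r * v) = τ r (e v) := he
  have hes : ∀ r v, e.symm (τ r v) = r * e.symm v := fun r v => by
    apply e.injective
    rw [he', e.apply_symm_apply, e.apply_symm_apply]
  let s : Fin k → Fin k → D := fun i => Pi.single i 1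
  have hs : ∀ c i, τ (c ⊗ₜ 1) (s i) = Pi.single i c := by
    intro c i
    ext j
    rw [hτ, hρ]
    by_cases h : j = i
    · subst h; simp [s]
    · simp [s, h]
  have hs' : ∀ x i, τ (1 ⊗ₜ x) (s i) = Pi.single i (f x) := by
    intro x i
    ext j
    rw [hτ, hρ]
    by_cases h : j = i
    · subst h; simp [s]
    · simp [s, h]
  let T : D →ₗ[F] (Fin k → Z) :=
    LinearMap.pi fun i => LinearMap.codRestrict Z (ρ (e.symm (s i))) fun d => by
      rw [hZ]
      intro x
      have h1 : ρ ((f x) ⊗ₜ 1) (ρ (e.symm (s i)) d) = f x * ρ (e.symm (s i)) d := by simp [hρ]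
      have h2 : ρ (1 ⊗ₜ x) (ρ (e.symm (s i)) d) = ρ (e.symm (s i)) d * f x := by simp [hρ]
      rw [← h1, ← h2, ← Module.End.mul_apply, ← Module.End.mul_apply, ← map_mul, ← map_mul,
        ← hes, ← hes, hs, hs']
  have hT : ∀ d i, (T d i : D) = ρ (e.symm (s i)) d := fun _ _ => rfl
  have hinj : Function.Injective T := by
    rw [injective_iff_map_eq_zero]
    intro d hd
    have key : ∀ v, ρ (e.symm v) d = 0 := by
      intro v
      have hv : v = ∑ i, τ (v i ⊗ₜ 1) (s i) := by
        simp_rw [hs]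
        exact (Finset.univ_sum_single v).symm
      rw [hv, map_sum, map_sum, LinearMap.sum_apply]
      refine Finset.sum_eq_zero fun i _ => ?_
      rw [hes, map_mul, Module.End.mul_apply, ← hT, hd]
      simp
    simpa using key (e 1)
  have hsurj : Function.Surjective T := by
    intro z
    let h : (Fin k → D) →ₗ[F] D := ∑ i, LinearMap.mulRight F (z i : D) ∘ₗ LinearMap.proj i
    have hh : ∀ v, h v = ∑ i, v i * z i := fun v => by simp [h]
    have hlin : ∀ t v, h (τ t v) = ρ t (h v) := by
      intro t v
      induction t with
      | zero => simp
      | add a b ha hb => simp [ha, hb]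
      | tmul c x =>
        rw [hh, hh, map_sum]
        refine Finset.sum_congr rfl fun i _ => ?_
        rw [hτ, hρ, hρ, mul_assoc, (hZ _).1 (z i).2 x]
        simp only [mul_assoc]
    refine ⟨h (e 1), funext fun i => Subtype.ext ?_⟩
    rw [hT, ← hlin, ← he', mul_one, e.apply_symm_apply, hh, Finset.sum_eq_single i]
    · simp [s]
    · intro j _ hj; simp [s, hj]
    · simp
  have := (LinearEquiv.ofBijective T ⟨hinj, hsurj⟩).finrank_eq
  rw [this, Module.finrank_pi_fintype]
  simp [k, mul_comm]

/-- The field generated by an element of a division algebra. -/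
theorem exists_algHom_adjoinRoot {K C : Type*} [Field K] [DivisionRing C] [Algebra K C] (c : C) :
    ∃ f : AdjoinRoot (minpoly K c) →ₐ[K] C, f (AdjoinRoot.root _) = c := by
  refine ⟨Ideal.Quotient.liftₐ _ (Polynomial.aeval c) fun p hp => ?_, ?_⟩
  · obtain ⟨q, rfl⟩ := Ideal.mem_span_singleton.1 hp
    rw [map_mul, minpoly.aeval, zero_mul]
  · exact Polynomial.aeval_X c

/-- The centralizer of a subfield `Y` of a central division algebra is a central division algebra
over `Y`. -/
theorem exists_centralizer {F Y : Type*} {D : Type u} [Field F] [Field Y] [Algebra F Y]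
    [DivisionRing D] [Algebra F D] [FiniteDimensional F D] [FiniteDimensional F Y]
    (hD : ∀ c : D, (∀ d, d * c = c * d) → ∃ y, algebraMap F D y = c) (f : Y →ₐ[F] D) :
    ∃ (C : Type u) (_ : DivisionRing C) (_ : Algebra Y C) (i : C →+* D),
      (∀ d, d ∈ i.range ↔ ∀ y, f y * d = d * f y) ∧ (∀ y, i (algebraMap Y C y) = f y) ∧
      Module.finrank Y C * Module.finrank F Y * Module.finrank F Y = Module.finrank F D ∧
      (∀ c : C, (∀ d, d * c = c * d) → ∃ y, algebraMap Y C y = c) := by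
  let Z : Subring D := Subring.centralizer (Set.range f)
  have hZ : ∀ d, d ∈ Z ↔ ∀ y, f y * d = d * f y := fun d => by
    simp [Z, Subring.mem_centralizer_iff]
  have hinv : ∀ d ∈ Z, d⁻¹ ∈ Z := fun d hd => by
    rw [hZ] at hd ⊢
    intro y
    exact (Commute.inv_right₀ (hd y : Commute _ _)).eq
  let _ : DivisionRing Z := DivisionRing.ofIsUnitOrEqZero fun a => by
    by_cases h : a = 0
    · exact Or.inr h
    · have h' : (a : D) ≠ 0 := fun h0 => h (Subtype.ext h0)
      exact Or.inl ⟨⟨a, ⟨_, hinv a a.2⟩, Subtype.ext (mul_inv_cancel₀ h'),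
        Subtype.ext (inv_mul_cancel₀ h')⟩, rfl⟩
  have hfZ : ∀ y, f y ∈ Z := fun y => (hZ _).2 fun x => by rw [← map_mul, ← map_mul, mul_comm]
  let g : Y →+* Z := f.toRingHom.codRestrict Z hfZ
  let _ : Algebra Y Z := g.toAlgebra' fun y z => Subtype.ext ((hZ _).1 z.2 y)
  have hg : ∀ y, (algebraMap Y Z y : D) = f y := fun _ => rfl
  let _ : Algebra F Z := ((algebraMap Y Z).comp (algebraMap F Y)).toAlgebra' fun x z =>
    Algebra.commutes (algebraMap F Y x) z
  have : IsScalarTower F Y Z := IsScalarTower.of_algebraMap_eq fun _ => rfl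
  let i : Z →ₐ[F] D :=
    { Z.subtype with commutes' := fun x => (hg _).trans (f.commutes x) }
  have hi : Function.Injective i := Subtype.val_injective
  have hir : ∀ d, d ∈ i.range ↔ d ∈ Z := fun d =>
    ⟨by rintro ⟨z, rfl⟩; exact z.2, fun h => ⟨⟨d, h⟩, rfl⟩⟩
  have : FiniteDimensional F Z := Module.Finite.of_injective i.toLinearMap hi
  have : FiniteDimensional Y Z := Module.Finite.of_restrictScalars_finite F Y Z
  have formula : ∀ (E : Type _) [Field E] [Algebra F E] [FiniteDimensional F E] (h : E →ₐ[F] D),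
      (∀ d, d ∈ Z ↔ ∀ x, h x * d = d * h x) →
      Module.finrank F Z * Module.finrank F E = Module.finrank F D := by
    intro E _ _ _ h hE
    rw [← finrank_centralizer_mul_finrank hD h (LinearMap.range i.toLinearMap) fun d => by
      rw [← hE, ← hir]; rfl]
    rw [LinearMap.finrank_range_of_inj hi]
  have hY := formula Y f hZ
  refine ⟨Z, inferInstance, inferInstance, i, ?_, hg, ?_, fun c hc => ?_⟩
  · exact fun d => (hir d).trans (hZ d)
  · rw [← hY, ← Module.finrank_mul_finrank F Y Z]; ring
  · obtain ⟨h, hr⟩ := exists_algHom_adjoinRoot (K := Y) c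
    have hint : IsIntegral Y c := Algebra.IsIntegral.isIntegral c
    have := Fact.mk (minpoly.irreducible hint)
    have := (AdjoinRoot.powerBasis (minpoly.ne_zero hint)).finite
    have : FiniteDimensional F (AdjoinRoot (minpoly Y c)) := Module.Finite.trans Y _
    have hcen : h.range ≤ Subalgebra.center Y Z := by
      rw [← Algebra.map_top, ← AdjoinRoot.adjoinRoot_eq_top, AlgHom.map_adjoin, Set.image_singleton,
        hr, Algebra.adjoin_le_iff, Set.singleton_subset_iff]
      exact Subalgebra.mem_center_iff.2 hc
    have hfr := formula (AdjoinRoot (minpoly Y c)) (i.comp (h.restrictScalars F)) fun d => by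
      constructor
      · intro hd x
        have := Subalgebra.mem_center_iff.1 (hcen ⟨x, rfl⟩) ⟨d, hd⟩
        exact (congrArg i this).symm
      · intro hd
        rw [hZ]
        intro y
        have := hd (algebraMap Y _ y)
        rwa [AlgHom.comp_apply, AlgHom.restrictScalars_apply, h.commutes] at this
    rw [← hY] at hfr
    have hpos : 0 < Module.finrank F Z := Module.finrank_pos
    have h1 := Nat.eq_of_mul_eq_mul_left hpos hfr
    rw [← Module.finrank_mul_finrank F Y (AdjoinRoot (minpoly Y c)),
      (AdjoinRoot.powerBasis (minpoly.ne_zero hint)).finrank, AdjoinRoot.powerBasis_dim] at h1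
    have h2 : (minpoly Y c).natDegree = 1 :=
      Nat.eq_of_mul_eq_mul_left (Module.finrank_pos (R := F) (M := Y)) (h1.trans (mul_one _).symm)
    exact minpoly.natDegree_eq_one_iff.1 h2

end Centralizer

section ReducedNorm

variable {Y C M : Type*} [Field Y] [DivisionRing C] [Algebra Y C] [Field M] [Algebra Y M]

theorem eq_zero_of_forall_sum_mul_mul_eq_zero [FiniteDimensional Y C]
    (hC : ∀ c : C, (∀ d, d * c = c * d) → ∃ y, algebraMap Y C y = c) (g : M →ₐ[Y] C)
    {ι : Type*} [Fintype ι] {a : ι → C} (ha : LinearIndependent Y a) {m : ι → M}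
    (h : ∀ c, ∑ i, a i * c * g (m i) = 0) : m = 0 := by
  have := isSimpleRing_tensorProduct (N := M) hC
  obtain ⟨ρ, hρ⟩ := exists_tensorProduct_rep_self g
  have h0 : ∑ i, a i ⊗ₜ[Y] m i = 0 := by
    apply ρ.toRingHom.injective
    refine LinearMap.ext fun c => ?_
    simpa [hρ] using h c
  let b := Module.Basis.ofVectorSpace Y M
  funext i
  apply b.repr.injective
  ext j
  have h1 := congrArg (fun t => (Algebra.TensorProduct.basis C b).repr t j) h0
  simp only [map_sum, Algebra.TensorProduct.basis_repr_tmul, Finsupp.finsetSum_apply,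
    Finsupp.smul_apply, Finsupp.mapRange_apply, smul_eq_mul, map_zero, Finsupp.zero_apply] at h1
  have h2 := Fintype.linearIndependent_iff.1 ha (fun i => b.repr (m i) j) (by
    simpa [Algebra.smul_def, Algebra.commutes] using h1) i
  simpa using h2

/-- `C` as a vector space over a subfield acting by right multiplication. -/
abbrev rightModule (g : M →ₐ[Y] C) : Module M C where
  smul m c := c * g m
  one_smul c := by change c * g 1 = c; simp
  mul_smul a b c := by change c * g (a * b) = c * g b * g a; rw [mul_comm, map_mul, mul_assoc]
  smul_zero m := zero_mul _
  smul_add m a b := add_mul _ _ _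
  add_smul a b c := by change c * g (a + b) = c * g a + c * g b; simp [mul_add]
  zero_smul c := by change c * g 0 = 0; simp

theorem isScalarTower_rightModule (g : M →ₐ[Y] C) :
    letI := rightModule g
    IsScalarTower Y M C :=
  letI := rightModule g
  ⟨fun y m c => by
    change c * g (y • m) = y • (c * g m)
    simp⟩

/-- Left multiplications as `M`-linear endomorphisms. -/
def mulLeftHom (g : M →ₐ[Y] C) :
    letI := rightModule g
    C →+* Module.End M C :=
  letI := rightModule g
  { toFun c :=
      { toFun d := c * d
        map_add' := mul_add c
        map_smul' m d := (mul_assoc c d (g m)).symm }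
    map_one' := LinearMap.ext one_mul
    map_mul' a b := LinearMap.ext fun d => mul_assoc a b d
    map_zero' := LinearMap.ext zero_mul
    map_add' a b := LinearMap.ext fun d => add_mul a b d }

/-- The reduced norm, computed over a maximal subfield. -/
noncomputable def reducedNorm (g : M →ₐ[Y] C) : C →* M :=
  letI := rightModule g
  LinearMap.det.comp (mulLeftHom g : C →* Module.End M C)

theorem reducedNorm_apply [FiniteDimensional Y C] {ℓ : ℕ} (hℓ : ℓ.Prime)
    (hC : ∀ c : C, (∀ d, d * c = c * d) → ∃ y, algebraMap Y C y = c)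
    (hdim : Module.finrank Y C = ℓ ^ 2) (g : M →ₐ[Y] C) (hM : Module.finrank Y M = ℓ)
    {L : Type*} [Field L] [Algebra Y L] (f : L →ₐ[Y] C) (hL : Module.finrank Y L = ℓ) (x : L) :
    reducedNorm g (f x) = algebraMap Y M (Algebra.norm Y x) := by
  let _ := rightModule g
  have : IsScalarTower Y M C := isScalarTower_rightModule g
  have hsm : ∀ (m : M) (c : C), m • c = c * g m := fun _ _ => rfl
  have : FiniteDimensional Y M := Module.finite_of_finrank_pos (hM ▸ hℓ.pos)
  have : FiniteDimensional Y L := Module.finite_of_finrank_pos (hL ▸ hℓ.pos)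
  have : FiniteDimensional M C := Module.Finite.of_restrictScalars_finite Y M C
  have hMC : Module.finrank M C = ℓ := by
    have := Module.finrank_mul_finrank Y M C
    rw [hM, hdim, sq] at this
    exact Nat.eq_of_mul_eq_mul_left hℓ.pos this
  let T : Module.End M C := mulLeftHom g (f x)
  have hT : ∀ c, T c = f x * c := fun _ => rfl
  change LinearMap.det T = _
  by_cases hx : x ∈ (algebraMap Y L).range
  · obtain ⟨y, rfl⟩ := hx
    have : T = algebraMap Y M y • LinearMap.id := by
      ext c
      rw [hT, f.commutes, LinearMap.smul_apply, LinearMap.id_apply, hsm, g.commutes,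
        Algebra.commutes]
    rw [this, LinearMap.det_smul, LinearMap.det_id, hMC, Algebra.norm_algebraMap, hL]
    simp
  · have hint : IsIntegral Y x := Algebra.IsIntegral.isIntegral x
    have hdeg : (minpoly Y x).natDegree = ℓ := by
      refine ((Nat.dvd_prime hℓ).1 (hL ▸ minpoly.degree_dvd hint)).resolve_left fun h => ?_
      exact hx (minpoly.natDegree_eq_one_iff.1 h)
    have hli : LinearIndependent Y fun i : Fin ℓ => f x ^ (i : ℕ) := by
      have : LinearIndependent Y (f.toLinearMap ∘ fun i : Fin ℓ => x ^ (i : ℕ)) :=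
        (hdeg ▸ linearIndependent_pow (K := Y) x).map' f.toLinearMap
          (LinearMap.ker_eq_bot.2 f.injective)
      simpa [Function.comp_def] using this
    let p := (Algebra.lmul Y L x).charpoly
    let q := p.map (algebraMap Y M)
    have hpm : p.Monic := LinearMap.charpoly_monic _
    have hpd : p.natDegree = ℓ := by rw [LinearMap.charpoly_natDegree, hL]
    have hqd : q.natDegree = ℓ := by rw [Polynomial.natDegree_map, hpd]
    have hTd : T.charpoly.natDegree = ℓ := by rw [LinearMap.charpoly_natDegree, hMC]
    have hpx : Polynomial.aeval x p = 0 := by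
      have h := LinearMap.aeval_self_charpoly (Algebra.lmul Y L x)
      rw [Polynomial.aeval_algHom_apply] at h
      exact (mul_one _).symm.trans (congrArg (fun φ : Module.End Y L => φ 1) h)
    have hTpow : ∀ n c, (T ^ n) c = f x ^ n * c := fun n c => by
      rw [← map_pow]; rfl
    have hTq : Polynomial.aeval T q = 0 := by
      have : ∀ (P : Polynomial Y) c,
          Polynomial.aeval T (P.map (algebraMap Y M)) c = f (Polynomial.aeval x P) * c := by
        intro P c
        induction P using Polynomial.induction_on' with
        | add P Q hP hQ =>
          rw [Polynomial.map_add, map_add, map_add, map_add, add_mul, LinearMap.add_apply, hP, hQ]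
        | monomial n a =>
          rw [Polynomial.map_monomial, Polynomial.aeval_monomial, Polynomial.aeval_monomial,
            map_mul, map_pow, f.commutes, Module.End.mul_apply, hTpow, Module.algebraMap_end_apply,
            hsm, g.commutes, ← Algebra.commutes, mul_assoc]
      refine LinearMap.ext fun c => ?_
      rw [this, hpx, map_zero, zero_mul, LinearMap.zero_apply]
    have hqT : q = T.charpoly := by
      rw [← sub_eq_zero]
      have hd : (q - T.charpoly).natDegree < ℓ := by
        by_cases h0 : q - T.charpoly = 0
        · rw [h0, Polynomial.natDegree_zero]; exact hℓ.pos
        · rw [Polynomial.natDegree_lt_iff_degree_lt h0]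
          have hq0 : q ≠ 0 := (hpm.map _).ne_zero
          rw [← hqd, ← Polynomial.degree_eq_natDegree hq0]
          refine Polynomial.degree_sub_lt_left ?_ hq0 ?_
          · rw [Polynomial.degree_eq_natDegree hq0, hqd,
              Polynomial.degree_eq_natDegree (LinearMap.charpoly_monic T).ne_zero, hTd]
          · rw [(hpm.map _).leadingCoeff, (LinearMap.charpoly_monic T).leadingCoeff]
      have h0 : Polynomial.aeval T (q - T.charpoly) = 0 := by
        rw [map_sub, hTq, LinearMap.aeval_self_charpoly, sub_zero]
      rw [Polynomial.aeval_eq_sum_range' hd, Finset.sum_range] at h0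
      have h1 := eq_zero_of_forall_sum_mul_mul_eq_zero hC g hli
        (m := fun i => (q - T.charpoly).coeff i) fun c => by
          simpa [hsm, hTpow] using congrArg (fun φ : Module.End M C => φ c) h0
      refine Polynomial.ext fun i => ?_
      rw [Polynomial.coeff_zero]
      by_cases hi : i < ℓ
      · exact congrFun h1 ⟨i, hi⟩
      · exact Polynomial.coeff_eq_zero_of_natDegree_lt (hd.trans_le (not_lt.1 hi))
    rw [LinearMap.det_eq_sign_charpoly_coeff, ← hqT, hMC, Algebra.norm_apply,
      LinearMap.det_eq_sign_charpoly_coeff, hL, Polynomial.coeff_map]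
    simp [p]

end ReducedNorm

section PrimeDegree

/-- An element of norm one in an inseparable extension of prime degree is trivial. -/
theorem isSeparable_or_eq_one_of_norm_eq_one {Y K : Type*} [Field Y] [Field K] [Algebra Y K]
    {ℓ : ℕ} (hℓ : ℓ.Prime) (hK : Module.finrank Y K = ℓ) {k : K} (hk : Algebra.norm Y k = 1) :
    Algebra.IsSeparable Y K ∨ k = 1 := by
  have : FiniteDimensional Y K := Module.finite_of_finrank_pos (hK ▸ hℓ.pos)
  rcases (Nat.dvd_prime hℓ).1 (hK ▸ Field.finSepDegree_dvd_finrank Y K) with h | h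
  · right
    have := (isPurelyInseparable_iff_finSepDegree_eq_one Y K).2 h
    obtain ⟨q, hq⟩ := ExpChar.exists Y
    have := expChar_of_injective_algebraMap (algebraMap Y K).injective q
    obtain ⟨n, y, hy⟩ := IsPurelyInseparable.pow_mem Y q k
    obtain ⟨j, hj⟩ := IsPurelyInseparable.finrank_eq_pow Y K q
    have h1 : y ^ ℓ = 1 := by
      rw [← hK, ← Algebra.norm_algebraMap (S := K), hy, map_pow, hk, one_pow]
    apply iterateFrobenius_inj K q (n + j)
    rw [iterateFrobenius_def, pow_add, pow_mul, ← hy, ← hj, hK, ← map_pow, h1]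
    simp
  · left
    exact (Field.finSepDegree_eq_finrank_iff Y K).1 (h.trans hK.symm)

/-- A version of **Hilbert 90** for a cyclic group of automorphisms. -/
theorem exists_mul_eq_of_prod_eq_one {N : Type*} [Field N] {G : Type*} [Group G]
    [MulSemiringAction G N] [FaithfulSMul G N] {σ : G} {n : ℕ} (hn : 0 < n)
    (hσ : orderOf σ = n) {κ : N} (hκ : ∏ i ∈ Finset.range n, (σ ^ i) • κ = 1) :
    ∃ b : N, b ≠ 0 ∧ κ * σ • b = b := by
  let c : ℕ → N := fun i => ∏ t ∈ Finset.range i, (σ ^ t) • κ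
  have hc : ∀ i, c (i + 1) = κ * σ • c i := by
    intro i
    simp only [c]
    rw [Finset.prod_range_succ', Finset.smul_prod', pow_zero, one_smul, mul_comm]
    congr 1
    refine Finset.prod_congr rfl fun t _ => ?_
    rw [pow_succ', mul_smul]
  have h0 : c 0 = 1 := by simp [c]
  let B : N → N := fun x => ∑ i ∈ Finset.range n, c i * (σ ^ i) • x
  have hB : ∀ x, κ * σ • B x = B x := by
    intro x
    have h1 : κ * σ • B x = ∑ i ∈ Finset.range n, c (i + 1) * (σ ^ (i + 1)) • x := by
      simp only [B, Finset.smul_sum, Finset.mul_sum, smul_mul', hc, pow_succ', mul_smul, mul_assoc]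
    have h2 := Finset.sum_range_succ (fun i => c i * (σ ^ i) • x) n
    rw [Finset.sum_range_succ'] at h2
    rw [h1]
    have h3 : c n = 1 := hκ
    have h4 : σ ^ n = 1 := hσ ▸ pow_orderOf_eq_one σ
    rw [h3, h4, h0, pow_zero] at h2
    exact add_right_cancel h2
  by_contra! hcon
  have hz : ∀ x, B x = 0 := fun x => by
    by_contra h
    exact hcon _ h (hB x)
  have hinj : Function.Injective fun i : Fin n =>
      (MulSemiringAction.toRingHom G N (σ ^ (i : ℕ)) : N →* N) := by
    intro i j hij
    have : σ ^ (i : ℕ) = σ ^ (j : ℕ) := by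
      refine FaithfulSMul.eq_of_smul_eq_smul fun x : N => ?_
      exact DFunLike.congr_fun hij x
    exact Fin.ext (pow_injOn_Iio_orderOf (by simp [hσ]) (by simp [hσ]) this)
  have hli := (linearIndependent_monoidHom N N).comp _ hinj
  have := Fintype.linearIndependent_iff.1 hli (fun i => c i) (by
    funext x
    have h := hz x
    simp only [B, Finset.sum_range] at h
    simpa using h) ⟨0, hn⟩
  simp [h0] at this

theorem exists_hilbert90_extension {Y : Type u} {K : Type*} [Field Y] [Field K] [Algebra Y K]
    [Algebra.IsSeparable Y K]
    {ℓ : ℕ} (hℓ : ℓ.Prime) (hK : Module.finrank Y K = ℓ) {k : K} (hk : Algebra.norm Y k = 1) :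
    ∃ (N : Type u) (_ : Field N) (_ : Algebra Y N) (_ : Algebra K N) (_ : IsScalarTower Y K N)
      (σ : N ≃ₐ[Y] N) (b : N), FiniteDimensional K N ∧ b ≠ 0 ∧
      (Module.finrank K N).Coprime ℓ ∧ (ℓ = 2 → Module.finrank K N = 1) ∧
      algebraMap K N k * σ b = b := by
  have : FiniteDimensional Y K := Module.finite_of_finrank_pos (hK ▸ hℓ.pos)
  have := Fact.mk hℓ
  let pb := Field.powerBasisOfFiniteOfSeparable Y K
  let P := minpoly Y pb.gen
  have hPd : P.natDegree = ℓ := by rw [← hK, pb.finrank, pb.natDegree_minpoly]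
  have hPs : P.Separable := Algebra.IsSeparable.isSeparable Y pb.gen
  let N := P.SplittingField
  have hsplit := Polynomial.SplittingField.splits P
  have hgal : IsGalois Y N := IsGalois.of_separable_splitting_field hPs
  obtain ⟨y, hy⟩ := hsplit.exists_eval_eq_zero (by
    rw [Polynomial.degree_map]
    exact (minpoly.degree_pos (Algebra.IsIntegral.isIntegral _)).ne')
  let j : K →ₐ[Y] N := pb.lift y (by rwa [← Polynomial.eval_map_algebraMap])
  let _ : Algebra K N := j.toRingHom.toAlgebra
  have hj : ∀ x, algebraMap K N x = j x := fun _ => rfl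
  have : IsScalarTower Y K N := IsScalarTower.of_algebraMap_eq fun x => (j.commutes x).symm
  have : FiniteDimensional K N := Module.Finite.of_restrictScalars_finite Y K N
  have : IsGalois K N := IsGalois.tower_top_of_isGalois Y K N
  have hmul := Module.finrank_mul_finrank Y K N
  have hcard := IsGalois.card_aut_eq_finrank Y N
  rw [← hmul, hK] at hcard
  have hdvd : Module.finrank K N ∣ (ℓ - 1).factorial := by
    have : Fact (Polynomial.map (algebraMap Y N) P).Splits := ⟨hsplit⟩
    have h1 := Subgroup.card_dvd_of_injective _ (Polynomial.Gal.galActionHom_injective P N)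
    rw [Nat.card_perm, Nat.card_eq_fintype_card (α := P.rootSet N),
      Polynomial.card_rootSet_eq_natDegree hPs hsplit, hPd] at h1
    have h2 : ℓ * Module.finrank K N ∣ ℓ * (ℓ - 1).factorial := by
      rw [Nat.mul_factorial_pred hℓ.ne_zero, ← hcard]
      exact h1
    exact Nat.dvd_of_mul_dvd_mul_left hℓ.pos h2
  have hcop : (Module.finrank K N).Coprime ℓ := by
    rw [Nat.coprime_comm, hℓ.coprime_iff_not_dvd]
    intro h
    have := (hℓ.dvd_factorial).1 (h.trans hdvd)
    have := hℓ.pos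
    omega
  obtain ⟨σ, hσ⟩ := exists_prime_orderOf_dvd_card' (G := N ≃ₐ[Y] N) ℓ (hcard ▸ Dvd.intro _ rfl)
  have hfix : ∀ d, (∀ x, (σ ^ d) (j x) = j x) → ℓ ∣ d := by
    intro d hd
    let τ : N ≃ₐ[K] N := AlgEquiv.ofRingEquiv (f := (σ ^ d : N ≃ₐ[Y] N).toRingEquiv) hd
    have h1 : ∀ n x, (τ ^ n) x = ((σ ^ d) ^ n) x := by
      intro n
      induction n with
      | zero => intro x; simp
      | succ n ih => intro x; rw [pow_succ, pow_succ, AlgEquiv.mul_apply, ih]; rfl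
    have h2 : τ ^ ℓ = 1 := by
      ext x
      rw [h1, ← pow_mul, mul_comm, pow_mul, ← hσ, pow_orderOf_eq_one, one_pow]
      rfl
    have h3 : τ ^ Module.finrank K N = 1 := by
      rw [← IsGalois.card_aut_eq_finrank]
      exact pow_card_eq_one'
    have h4 : τ = 1 := by
      rw [← orderOf_eq_one_iff, ← Nat.dvd_one, ← hcop]
      exact Nat.dvd_gcd (orderOf_dvd_of_pow_eq_one h3) (orderOf_dvd_of_pow_eq_one h2)
    rw [← hσ, orderOf_dvd_iff_pow_eq_one]
    ext x
    have := h1 1 x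
    rw [h4] at this
    simpa using this.symm
  have hprod : ∏ i ∈ Finset.range ℓ, (σ ^ i) • j k = 1 := by
    let E := AlgebraicClosure N
    let ε : Fin ℓ → (K →ₐ[Y] E) := fun i =>
      ((IsScalarTower.toAlgHom Y N E).comp (σ ^ (i : ℕ) : N ≃ₐ[Y] N).toAlgHom).comp j
    have hε : Function.Injective ε := by
      have key : ∀ a b : Fin ℓ, (a : ℕ) ≤ b → ε a = ε b → a = b := by
        intro a b hab h
        have : ℓ ∣ (b : ℕ) - a := by
          refine hfix _ fun x => ?_
          have h1 : (σ ^ (a : ℕ)) (j x) = (σ ^ (b : ℕ)) (j x) :=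
            (algebraMap N E).injective (DFunLike.congr_fun h x)
          apply (σ ^ (a : ℕ)).injective
          rw [← AlgEquiv.mul_apply, ← pow_add, Nat.add_sub_cancel' hab, h1]
        have h2 := Nat.eq_zero_of_dvd_of_lt this (by omega)
        exact Fin.ext (by omega)
      intro a b h
      rcases le_total (a : ℕ) b with hab | hab
      · exact key a b hab h
      · exact (key b a hab h.symm).symm
    have hbij : Function.Bijective ε := (Fintype.bijective_iff_injective_and_card ε).2
      ⟨hε, by rw [AlgHom.card, hK, Fintype.card_fin]⟩
    apply (algebraMap N E).injective
    have h := Algebra.norm_eq_prod_embeddings Y E k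
    rw [hk, map_one, ← hbij.prod_comp (fun f => f k)] at h
    rw [map_one, h, Finset.prod_range, map_prod]
    rfl
  obtain ⟨b, hb, hbσ⟩ := exists_mul_eq_of_prod_eq_one hℓ.pos hσ hprod
  refine ⟨N, inferInstance, inferInstance, inferInstance, inferInstance, σ, b, inferInstance, hb,
    hcop, ?_, hbσ⟩
  rintro rfl
  simpa using hdvd

end PrimeDegree

section Wang

/-- Diagonal matrices coming from a twisted coboundary are killed by every homomorphism to a
commutative group. -/
theorem map_diagonal_eq_one {Y C K N H : Type*} [Field Y] [DivisionRing C] [Algebra Y C]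
    [FiniteDimensional Y C] (hC : ∀ c : C, (∀ d, d * c = c * d) → ∃ y, algebraMap Y C y = c)
    [Field K] [Algebra Y K] [FiniteDimensional Y K] [Field N] [Algebra Y N] [Algebra K N]
    [IsScalarTower Y K N] [FiniteDimensional K N] [CommGroup H] (f : K →ₐ[Y] C) (σ : N ≃ₐ[Y] N)
    {k : K} {b : N} (hb : b ≠ 0) (h : algebraMap K N k * σ b = b) {m : ℕ}
    (hm : Module.finrank K N = m) (δ : (Matrix (Fin m) (Fin m) C)ˣ →* H)
    (U : (Matrix (Fin m) (Fin m) C)ˣ) (hU : U.val = Matrix.diagonal fun _ => f k) : δ U = 1 := by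
  have : FiniteDimensional Y N := Module.Finite.trans K N
  let bN := Module.finBasisOfFinrankEq K N hm
  let j : N →ₐ[Y] Matrix (Fin m) (Fin m) C :=
    (AlgHom.mapMatrix f).comp ((Algebra.leftMulMatrix bN).restrictScalars Y)
  have hjk : j (algebraMap K N k) = U.val := by
    rw [hU, AlgHom.comp_apply, AlgHom.restrictScalars_apply, AlgHom.commutes,
      Matrix.algebraMap_eq_diagonal, AlgHom.mapMatrix_apply, Matrix.diagonal_map (map_zero f)]
    rfl
  obtain ⟨u, hu⟩ := exists_conj_of_algHom hC j (j.comp σ.toAlgHom)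
  let V := Units.map j.toRingHom.toMonoidHom (Units.mk0 b hb)
  let V' := Units.map j.toRingHom.toMonoidHom (Units.mk0 (σ b) (by simpa using hb))
  have h1 : u * V = V' * u := Units.ext (hu b)
  have h2 : U * V' = V := Units.ext <| by
    change U.val * j (σ b) = j b
    rw [← hjk, ← map_mul, h]
  have h3 := congrArg δ h1
  rw [map_mul, map_mul, mul_comm] at h3
  have h4 := congrArg δ h2
  rwa [map_mul, ← mul_right_cancel h3, mul_eq_right] at h4

/-- A Dieudonné determinant restricts to the usual determinant on matrices over a central
subfield. -/
theorem map_eq_map_det {Y C H : Type*} [Field Y] [DivisionRing C] [Algebra Y C] [CommGroup H]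
    {φ : Cˣ →* H} {n : ℕ} {δ : (Matrix (Fin n) (Fin n) C)ˣ →* H}
    (h1 : ∀ (d : Fin n → Cˣ) (U : (Matrix (Fin n) (Fin n) C)ˣ),
        U.val = Matrix.diagonal (fun i => (d i : C)) → δ U = ∏ i, φ (d i))
    (h2 : ∀ (i j : Fin n) (c : C) (U : (Matrix (Fin n) (Fin n) C)ˣ), i ≠ j →
        U.val = 1 + Matrix.single i j c → δ U = 1)
    (A : (Matrix (Fin n) (Fin n) Y)ˣ) :
    δ (Units.map (AlgHom.mapMatrix (Algebra.ofId Y C)).toRingHom.toMonoidHom A) =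
      φ (Units.map (algebraMap Y C : Y →* C) (Matrix.GeneralLinearGroup.det A)) := by
  suffices ∀ B : Matrix (Fin n) (Fin n) Y, B.det ≠ 0 →
      ∀ A : (Matrix (Fin n) (Fin n) Y)ˣ, A.val = B →
      δ (Units.map (AlgHom.mapMatrix (Algebra.ofId Y C)).toRingHom.toMonoidHom A) =
      φ (Units.map (algebraMap Y C : Y →* C) (Matrix.GeneralLinearGroup.det A)) from
    this A (Matrix.GeneralLinearGroup.det A).ne_zero A rfl
  intro B hB
  refine Matrix.diagonal_transvection_induction_of_det_ne_zero
    (P := fun B => ∀ A : (Matrix (Fin n) (Fin n) Y)ˣ, A.val = B →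
      δ (Units.map (AlgHom.mapMatrix (Algebra.ofId Y C)).toRingHom.toMonoidHom A) =
      φ (Units.map (algebraMap Y C : Y →* C) (Matrix.GeneralLinearGroup.det A))) B hB ?_ ?_ ?_
  · intro d hd A hA
    rw [Matrix.det_diagonal, Finset.prod_ne_zero_iff] at hd
    let d' : Fin n → Yˣ := fun i => Units.mk0 (d i) (hd i (Finset.mem_univ i))
    rw [h1 fun i => Units.map (algebraMap Y C : Y →* C) (d' i)]
    · refine (map_prod (φ.comp (Units.map (algebraMap Y C : Y →* C))) d' _).symm.trans ?_
      refine congrArg (φ.comp (Units.map (algebraMap Y C : Y →* C))) (Units.ext ?_)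
      rw [Matrix.GeneralLinearGroup.val_det_apply, hA, Matrix.det_diagonal, Units.coe_prod]
      rfl
    · change AlgHom.mapMatrix (Algebra.ofId Y C) A.val = Matrix.diagonal _
      rw [hA, AlgHom.mapMatrix_apply, Matrix.diagonal_map (map_zero _)]
      rfl
  · intro t A hA
    have hdet : Matrix.GeneralLinearGroup.det A = 1 := by
      ext
      rw [Matrix.GeneralLinearGroup.val_det_apply, hA, Matrix.TransvectionStruct.det]
      rfl
    rw [hdet, map_one, map_one]
    refine h2 t.i t.j (algebraMap Y C t.c) _ t.hij ?_
    change (AlgHom.mapMatrix (Algebra.ofId Y C)) A.val = _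
    rw [hA, Matrix.TransvectionStruct.toMatrix, Matrix.transvection, map_add, map_one,
      AlgHom.mapMatrix_apply, Matrix.map_single]
    rfl
  · intro B₁ B₂ hB₁ hB₂ ih₁ ih₂ A hA
    have : A = Matrix.GeneralLinearGroup.mkOfDetNeZero B₁ hB₁ *
        Matrix.GeneralLinearGroup.mkOfDetNeZero B₂ hB₂ := Units.ext hA
    rw [this, map_mul, map_mul, map_mul, map_mul, map_mul, ih₁ _ rfl, ih₂ _ rfl]

/-- Elements of norm one in a subfield of degree `n` become `n`-torsion in every commutative
quotient in which `-1` is trivial. -/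
theorem map_pow_eq_one {Y C K H : Type*} [Field Y] [DivisionRing C] [Algebra Y C]
    [FiniteDimensional Y C] (hC : ∀ c : C, (∀ d, d * c = c * d) → ∃ y, algebraMap Y C y = c)
    [Field K] [Algebra Y K] [FiniteDimensional Y K] [CommGroup H] (f : K →ₐ[Y] C)
    {φ : Cˣ →* H} (hφ : φ (-1) = 1) {k : K} (hk : Algebra.norm Y k = 1) {c : Cˣ} (hc : f k = c) :
    φ c ^ Module.finrank Y K = 1 := by
  obtain ⟨δ, h1, h2⟩ := exists_dieudonne_det hφ (Module.finrank Y K)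
  let b := Module.finBasis Y K
  let p : K →ₐ[Y] Matrix (Fin (Module.finrank Y K)) (Fin (Module.finrank Y K)) C :=
    (AlgHom.mapMatrix f).comp ((Algebra.ofId K _).restrictScalars Y)
  let q : K →ₐ[Y] Matrix (Fin (Module.finrank Y K)) (Fin (Module.finrank Y K)) C :=
    (AlgHom.mapMatrix (Algebra.ofId Y C)).comp (Algebra.leftMulMatrix b)
  have hp : p k = Matrix.diagonal fun _ => (c : C) := by
    rw [AlgHom.comp_apply, AlgHom.restrictScalars_apply, Algebra.ofId_apply,
      Matrix.algebraMap_eq_diagonal, AlgHom.mapMatrix_apply, Matrix.diagonal_map (map_zero f), ← hc]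
    rfl
  obtain ⟨u, hu⟩ := exists_conj_of_algHom hC p q
  have hk0 : k ≠ 0 := by
    rintro rfl
    exact c.ne_zero (hc ▸ map_zero f)
  let k' := Units.mk0 k hk0
  let A := Units.map (Algebra.leftMulMatrix b).toRingHom.toMonoidHom k'
  have hconj : u * Units.map p.toRingHom.toMonoidHom k' =
      Units.map (AlgHom.mapMatrix (Algebra.ofId Y C)).toRingHom.toMonoidHom A * u :=
    Units.ext (hu k)
  have h3 := congrArg δ hconj
  rw [map_mul, map_mul, mul_comm] at h3
  have h4 := mul_right_cancel h3
  have hdet : Matrix.GeneralLinearGroup.det A = 1 := by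
    ext
    rw [Matrix.GeneralLinearGroup.val_det_apply, Units.val_one, ← hk, Algebra.norm_eq_matrix_det b]
    rfl
  rw [h1 (fun _ => c) _ hp, map_eq_map_det h1 h2, hdet, map_one, map_one] at h4
  simpa using h4

variable {Y C M : Type*} [Field Y] [DivisionRing C] [Algebra Y C] [Field M] [Algebra Y M]

/-- An element of a maximal subfield of a division algebra of prime degree is a product of
commutators if it has norm one. -/
theorem mem_commutator_of_norm_eq_one [FiniteDimensional Y C] {ℓ : ℕ} (hℓ : ℓ.Prime)
    (hC : ∀ c : C, (∀ d, d * c = c * d) → ∃ y, algebraMap Y C y = c)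
    (hdim : Module.finrank Y C = ℓ ^ 2)
    (f : M →ₐ[Y] C) (hM : Module.finrank Y M = ℓ) {k : M} (hk : Algebra.norm Y k = 1)
    {c : Cˣ} (hc : f k = c) : c ∈ commutator Cˣ := by
  rcases isSeparable_or_eq_one_of_norm_eq_one hℓ hM hk with hsep | rfl
  swap
  · have : c = 1 := Units.ext (by rw [← hc, map_one]; rfl)
    exact this ▸ one_mem _
  have : FiniteDimensional Y M := Module.finite_of_finrank_pos (hM ▸ hℓ.pos)
  obtain ⟨N, _, _, _, _, σ, b, hfin, hb, hcop, h2, hσ⟩ := exists_hilbert90_extension hℓ hM hk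
  by_cases hℓ2 : ℓ = 2
  · let e : Matrix (Fin 1) (Fin 1) C ≃+* C := Matrix.uniqueRingEquiv
    have := map_diagonal_eq_one hC f σ hb hσ (h2 hℓ2)
      (Abelianization.of.comp (Units.map (e : _ →* C)))
      (Units.map (e.symm : C →* _) c) (by
        ext i j
        rw [Subsingleton.elim j i, Matrix.diagonal_apply_eq, hc]
        rfl)
    rw [← Abelianization.ker_of, MonoidHom.mem_ker, ← this]
    exact congrArg Abelianization.of (Units.ext (e.apply_symm_apply (c : C)).symm)
  · let H := Abelianization Cˣ ⧸ Subgroup.zpowers (Abelianization.of (-1 : Cˣ))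
    let φ : Cˣ →* H := (QuotientGroup.mk' _).comp Abelianization.of
    have hφ : φ (-1) = 1 := (QuotientGroup.eq_one_iff _).2 (Subgroup.mem_zpowers _)
    obtain ⟨δ, h3, -⟩ := exists_dieudonne_det hφ (Module.finrank M N)
    have hdiag : ∃ U : (Matrix (Fin (Module.finrank M N)) (Fin (Module.finrank M N)) C)ˣ,
        U.val = Matrix.diagonal fun _ => (c : C) :=
      ⟨Units.map (Matrix.scalar (Fin (Module.finrank M N))).toMonoidHom c, rfl⟩
    obtain ⟨U, hU⟩ := hdiag
    have h4 := map_diagonal_eq_one hC f σ hb hσ rfl δ U (by rw [hU, hc])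
    rw [h3 (fun _ => c) U hU] at h4
    have h5 : φ c ^ Module.finrank M N = 1 := by simpa using h4
    have h6 := map_pow_eq_one hC f hφ hk hc
    rw [hM] at h6
    have h7 : φ c = 1 := by
      rw [← pow_one (φ c), ← hcop]
      exact pow_gcd_eq_one.2 ⟨h5, h6⟩
    obtain ⟨j, hj⟩ := Subgroup.mem_zpowers_iff.1 ((QuotientGroup.eq_one_iff _).1 h7)
    have hj' : Abelianization.of (c * ((-1) ^ j)⁻¹) = 1 := by
      rw [map_mul, map_inv, map_zpow, hj, mul_inv_cancel]
    have hmem : c * ((-1) ^ j)⁻¹ ∈ commutator Cˣ := by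
      rwa [← Abelianization.ker_of, MonoidHom.mem_ker]
    suffices h : (-1 : Cˣ) ^ j = 1 by simpa [h] using hmem
    rcases Int.even_or_odd j with he | ho
    · exact he.neg_one_zpow
    · have hone : ((-1 : Cˣ)) ^ j = -1 := ho.neg_one_zpow
      rw [hone] at hmem ⊢
      have h8 := Abelianization.commutator_subset_ker (Units.map (reducedNorm f)) hmem
      have h9 : reducedNorm f (c * (-1 : C)) = 1 := by
        have := congrArg Units.val (MonoidHom.mem_ker.1 h8)
        simpa using this
      have h10 := reducedNorm_apply hℓ hC hdim f hM f hM (-k)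
      have h11 : Algebra.norm Y (-k) = -1 := by
        have : -k = algebraMap Y M (-1) * k := by simp
        rw [this, map_mul, Algebra.norm_algebraMap, hk, hM, (hℓ.odd_of_ne_two hℓ2).neg_one_pow,
          mul_one]
      rw [map_neg, hc, h11, ← mul_neg_one, h9] at h10
      ext
      have := congrArg f h10
      simpa using this.symm

/-- **Theorem of Wang** in prime degree: elements of reduced norm one are products of
commutators. -/
theorem mem_commutator_of_reducedNorm_eq_one [FiniteDimensional Y C] {ℓ : ℕ} (hℓ : ℓ.Prime)
    (hC : ∀ c : C, (∀ d, d * c = c * d) → ∃ y, algebraMap Y C y = c)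
    (hdim : Module.finrank Y C = ℓ ^ 2)
    (g : M →ₐ[Y] C) (hM : Module.finrank Y M = ℓ) {c : Cˣ} (hc : reducedNorm g c = 1) :
    c ∈ commutator Cˣ := by
  have main : ∀ {K : Type _} [Field K] [Algebra Y K] (f : K →ₐ[Y] C) (k : K),
      Module.finrank Y K = ℓ → f k = c → c ∈ commutator Cˣ := by
    intro K _ _ f k hK hk
    refine mem_commutator_of_norm_eq_one hℓ hC hdim f hK ?_ hk
    apply (algebraMap Y M).injective
    rw [← reducedNorm_apply hℓ hC hdim g hM f hK, hk, hc, map_one]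
  have hint : IsIntegral Y (c : C) := Algebra.IsIntegral.isIntegral _
  by_cases h1 : (c : C) ∈ (algebraMap Y C).range
  · obtain ⟨y, hy⟩ := h1
    refine mem_commutator_of_norm_eq_one hℓ hC hdim g hM (k := algebraMap Y M y) ?_
      ((g.commutes y).trans hy)
    apply (algebraMap Y M).injective
    rw [← reducedNorm_apply hℓ hC hdim g hM g hM, g.commutes, hy, hc, map_one]
  · obtain ⟨f, hf⟩ := exists_algHom_adjoinRoot (K := Y) (c : C)
    have := Fact.mk (minpoly.irreducible hint)
    have := (AdjoinRoot.powerBasis (minpoly.ne_zero hint)).finite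
    have hd : Module.finrank Y (AdjoinRoot (minpoly Y (c : C))) =
        (minpoly Y (c : C)).natDegree := by
      rw [(AdjoinRoot.powerBasis (minpoly.ne_zero hint)).finrank, AdjoinRoot.powerBasis_dim]
    refine main f _ ?_ hf
    have hdvd : Module.finrank Y (AdjoinRoot (minpoly Y (c : C))) ∣ ℓ ^ 2 := by
      let _ := rightModule f
      have := isScalarTower_rightModule f
      exact hdim ▸ Dvd.intro _ (Module.finrank_mul_finrank Y _ C)
    obtain ⟨n, hn, hn'⟩ := (Nat.dvd_prime_pow hℓ).1 hdvd
    interval_cases n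
    · rw [hd, pow_zero] at hn'
      exact absurd (minpoly.natDegree_eq_one_iff.1 hn') h1
    · rw [hn', pow_one]
    · exfalso
      have hsurj : Function.Surjective f.toLinearMap :=
        (LinearMap.injective_iff_surjective_of_finrank_eq_finrank (hn'.trans hdim.symm)).1
          f.injective
      apply h1
      refine hC _ fun d => ?_
      obtain ⟨x, hx⟩ := hsurj d
      have := congrArg f (mul_comm x (AdjoinRoot.root _))
      rwa [map_mul, map_mul, hf, show f x = d from hx] at this

end Wang

section Descent

/-- An embedding of an extension of `Y` factors through the centralizer of `Y`. -/
theorem exists_algHom_centralizer {Y C D K : Type*} [Field Y] [DivisionRing C] [Algebra Y C]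
    [DivisionRing D] [Field K] [Algebra Y K] (i : C →+* D) (f : Y → D)
    (hi : ∀ d, d ∈ i.range ↔ ∀ y, f y * d = d * f y) (hY : ∀ y, i (algebraMap Y C y) = f y)
    (s : K →+* D) (hs : ∀ y, s (algebraMap Y K y) = f y) :
    ∃ g : K →ₐ[Y] C, ∀ x, i (g x) = s x := by
  have hr : ∀ x, ∃ c, i c = s x := fun x => RingHom.mem_range.1 <| (hi _).2 fun y => by
    rw [← hs, ← map_mul, ← map_mul, mul_comm]
  choose g hg using hr
  refine ⟨AlgHom.mk ⟨⟨⟨g, ?_⟩, ?_⟩, ?_, ?_⟩ ?_, hg⟩ <;> intros <;> apply i.injective <;>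
    simp [hg, hs, hY]

/-- In a division algebra of degree `ℓ ^ 2`, an element of an extension `M` of degree `ℓ` of a
subfield `Y` of degree `ℓ` is a product of commutators as soon as its norm to `Y` is a product of
norms of elements with this property. -/
theorem mem_commutator_of_norm_eq_mul {F Y M L₁ L₂ : Type*} {D : Type*} [Field F] [Field Y]
    [Field M] [Field L₁] [Field L₂] [Algebra F Y] [Algebra Y M] [Algebra Y L₁] [Algebra Y L₂]
    [DivisionRing D] [Algebra F D] {ℓ : ℕ} (hℓ : ℓ.Prime)
    (hcentral : Subalgebra.center F D = ⊥) (hdim : Module.finrank F D = ℓ ^ 4)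
    (hYdeg : Module.finrank F Y = ℓ) (hM : Module.finrank Y M = ℓ)
    (hL₁ : Module.finrank Y L₁ = ℓ) (hL₂ : Module.finrank Y L₂ = ℓ) (f : Y →ₐ[F] D)
    (ι : M →+* D) (κ₁ : L₁ →+* D) (κ₂ : L₂ →+* D) (hι : ∀ y, ι (algebraMap Y M y) = f y)
    (hκ₁ : ∀ y, κ₁ (algebraMap Y L₁ y) = f y) (hκ₂ : ∀ y, κ₂ (algebraMap Y L₂ y) = f y)
    {z : M} (hz : z ≠ 0) {θ₁ : L₁} {θ₂ : L₂}
    (hnorm : Algebra.norm Y θ₁ * Algebra.norm Y θ₂ = Algebra.norm Y z)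
    (hθ₁ : ∃ u : Dˣ, (u : D) = κ₁ θ₁ ∧ u ∈ commutator Dˣ)
    (hθ₂ : ∃ u : Dˣ, (u : D) = κ₂ θ₂ ∧ u ∈ commutator Dˣ) :
    ∃ u : Dˣ, (u : D) = ι z ∧ u ∈ commutator Dˣ := by
  have : FiniteDimensional F D := Module.finite_of_finrank_pos (hdim ▸ pow_pos hℓ.pos 4)
  have : FiniteDimensional F Y := Module.finite_of_finrank_pos (hYdeg ▸ hℓ.pos)
  have hD : ∀ c : D, (∀ d, d * c = c * d) → ∃ y, algebraMap F D y = c := fun c hc =>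
    Algebra.mem_bot.1 (hcentral ▸ Subalgebra.mem_center_iff.2 hc)
  obtain ⟨C, _, _, i, hir, hiY, hfin, hC⟩ := exists_centralizer hD f
  have hfin' : Module.finrank Y C = ℓ ^ 2 := by
    rw [hYdeg, hdim] at hfin
    refine Nat.eq_of_mul_eq_mul_right (pow_pos hℓ.pos 2) ?_
    linarith
  have : FiniteDimensional Y C := Module.finite_of_finrank_pos (hfin' ▸ pow_pos hℓ.pos 2)
  obtain ⟨g, hg⟩ := exists_algHom_centralizer i f hir hiY ι hι
  obtain ⟨g₁, hg₁⟩ := exists_algHom_centralizer i f hir hiY κ₁ hκ₁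
  obtain ⟨g₂, hg₂⟩ := exists_algHom_centralizer i f hir hiY κ₂ hκ₂
  obtain ⟨u₁, hu₁, hu₁c⟩ := hθ₁
  obtain ⟨u₂, hu₂, hu₂c⟩ := hθ₂
  have hθ₁0 : θ₁ ≠ 0 := by rintro rfl; exact u₁.ne_zero (hu₁.trans (map_zero κ₁))
  have hθ₂0 : θ₂ ≠ 0 := by rintro rfl; exact u₂.ne_zero (hu₂.trans (map_zero κ₂))
  let c : Cˣ := Units.mk0 (g z) (by simpa using hz)
  let c₁ : Cˣ := Units.mk0 (g₁ θ₁) (by simpa using hθ₁0)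
  let c₂ : Cˣ := Units.mk0 (g₂ θ₂) (by simpa using hθ₂0)
  let j : Cˣ →* Dˣ := Units.map i.toMonoidHom
  have hj₁ : j c₁ = u₁ := Units.ext ((hg₁ θ₁).trans hu₁.symm)
  have hj₂ : j c₂ = u₂ := Units.ext ((hg₂ θ₂).trans hu₂.symm)
  have hν : reducedNorm g (c₁ * c₂ : Cˣ) = reducedNorm g c := by
    change reducedNorm g (g₁ θ₁ * g₂ θ₂) = reducedNorm g (g z)
    rw [map_mul, reducedNorm_apply hℓ hC hfin' g hM g₁ hL₁,
      reducedNorm_apply hℓ hC hfin' g hM g₂ hL₂, reducedNorm_apply hℓ hC hfin' g hM g hM, ← map_mul, hnorm]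
  have hmem : c * (c₁ * c₂)⁻¹ ∈ commutator Cˣ := by
    refine mem_commutator_of_reducedNorm_eq_one hℓ hC hfin' g hM ?_
    rw [Units.val_mul, map_mul, ← hν, ← map_mul, Units.mul_inv, map_one]
  have hmap : j (c * (c₁ * c₂)⁻¹) ∈ commutator Dˣ := by
    have h := Subgroup.mem_map_of_mem j hmem
    rw [commutator_def, Subgroup.map_commutator] at h
    exact Subgroup.commutator_mono le_top le_top h
  refine ⟨j c, hg z, ?_⟩
  rw [map_mul, map_inv, map_mul, hj₁, hj₂] at hmap
  exact (Subgroup.mul_mem_cancel_right _ (inv_mem (mul_mem hu₁c hu₂c))).1 hmap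

end Descent

/-- Let `D` be a central division algebra of degree `ℓ²` over `F`, `M`
a maximal subfield (embedded via `ι`, equal to its own centralizer), `Y ⊆ M` a cyclic
degree-`ℓ` subextension, `z ∈ M` of norm `1` to `F`, and `a = N_{M/Y}(z)`.  Suppose
`a = a₁·a₂` with, for each `i`, a degree-`ℓ` subfield `Eᵢ` of `D` (embedded via `jᵢ`)
commuting with `Y` such that `D ⊗_F Eᵢ ⊗_F Y` is split, and an element `θᵢ` of the
field `Lᵢ = Y·Eᵢ` (the `F`-subalgebra of `D` generated by `Y` and `Eᵢ`, embedded via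
`κᵢ` compatibly with `Y`, of degree `ℓ` over `Y`) with `N_{Lᵢ/Y}(θᵢ) = aᵢ` and
`θᵢ ∈ [Dˣ, Dˣ]`.  Then `z ∈ [Dˣ, Dˣ]`. -/
theorem statement1
    (ℓ : ℕ) (hℓ : ℓ.Prime)
    (F Y M : Type*) [Field F] [Field Y] [Field M]
    [Algebra F Y] [Algebra Y M] [Algebra F M] [IsScalarTower F Y M]
    (D : Type*) [DivisionRing D] [Algebra F D]
    (hcentral : Subalgebra.center F D = ⊥)
    (hdim : Module.finrank F D = ℓ ^ 4)
    (ι : M →ₐ[F] D)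
    (hMmax : Subalgebra.centralizer F (ι.range : Set D) = ι.range)
    (hMdeg : Module.finrank F M = ℓ ^ 2)
    (hYdeg : Module.finrank F Y = ℓ)
    [IsGalois F Y] (hYcyc : IsCyclic (Y ≃ₐ[F] Y))
    (z : M) (hz : Algebra.norm F z = 1)
    (a : Y) (ha : a = Algebra.norm Y z)
    (a₁ a₂ : Y) (hprod : a₁ * a₂ = a)
    -- the subfields `E₁, E₂` of `D`
    (E₁ E₂ : Type*) [Field E₁] [Field E₂] [Algebra F E₁] [Algebra F E₂]
    (j₁ : E₁ →ₐ[F] D) (j₂ : E₂ →ₐ[F] D)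
    (hE₁deg : Module.finrank F E₁ = ℓ) (hE₂deg : Module.finrank F E₂ = ℓ)
    -- `Eᵢ` commutes with `Y` inside `D`
    (hcomm₁ : ∀ (x : E₁) (y : Y), Commute (j₁ x) (ι (algebraMap Y M y)))
    (hcomm₂ : ∀ (x : E₂) (y : Y), Commute (j₂ x) (ι (algebraMap Y M y)))
    -- `D ⊗_F Eᵢ ⊗_F Y` is split
    (hsplit₁ : ∃ n : ℕ, 0 < n ∧ Nonempty
      (((E₁ ⊗[F] Y) ⊗[F] D) ≃ₐ[E₁ ⊗[F] Y] Matrix (Fin n) (Fin n) (E₁ ⊗[F] Y)))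
    (hsplit₂ : ∃ n : ℕ, 0 < n ∧ Nonempty
      (((E₂ ⊗[F] Y) ⊗[F] D) ≃ₐ[E₂ ⊗[F] Y] Matrix (Fin n) (Fin n) (E₂ ⊗[F] Y)))
    -- the composita `Lᵢ = Y·Eᵢ` inside `D`
    (L₁ L₂ : Type*) [Field L₁] [Field L₂]
    [Algebra F L₁] [Algebra F L₂] [Algebra Y L₁] [Algebra Y L₂]
    [IsScalarTower F Y L₁] [IsScalarTower F Y L₂]
    (κ₁ : L₁ →ₐ[F] D) (κ₂ : L₂ →ₐ[F] D)
    (hκ₁Y : ∀ y : Y, κ₁ (algebraMap Y L₁ y) = ι (algebraMap Y M y))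
    (hκ₂Y : ∀ y : Y, κ₂ (algebraMap Y L₂ y) = ι (algebraMap Y M y))
    (hκ₁range : κ₁.range = Algebra.adjoin F
      (Set.range (fun y : Y => ι (algebraMap Y M y)) ∪ Set.range j₁))
    (hκ₂range : κ₂.range = Algebra.adjoin F
      (Set.range (fun y : Y => ι (algebraMap Y M y)) ∪ Set.range j₂))
    (hL₁deg : Module.finrank Y L₁ = ℓ) (hL₂deg : Module.finrank Y L₂ = ℓ)
    -- the elements `θᵢ` with `N_{Lᵢ/Y}(θᵢ) = aᵢ`, lying in `[Dˣ, Dˣ]`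
    (θ₁ : L₁) (θ₂ : L₂)
    (hθ₁ : Algebra.norm Y θ₁ = a₁) (hθ₂ : Algebra.norm Y θ₂ = a₂)
    (hθ₁comm : ∃ u : Dˣ, (u : D) = κ₁ θ₁ ∧ u ∈ commutator Dˣ)
    (hθ₂comm : ∃ u : Dˣ, (u : D) = κ₂ θ₂ ∧ u ∈ commutator Dˣ) :
    ∃ u : Dˣ, (u : D) = ι z ∧ u ∈ commutator Dˣ := by
  subst ha hθ₁ hθ₂
  have hM : Module.finrank Y M = ℓ := by
    have h := Module.finrank_mul_finrank F Y M
    rw [hYdeg, hMdeg, sq] at h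
    exact Nat.eq_of_mul_eq_mul_left hℓ.pos h
  have hz0 : z ≠ 0 := by
    rintro rfl
    have : FiniteDimensional F M := Module.finite_of_finrank_pos (hMdeg ▸ pow_pos hℓ.pos 2)
    rw [Algebra.norm_zero] at hz
    exact zero_ne_one hz
  exact mem_commutator_of_norm_eq_mul hℓ hcentral hdim hYdeg hM hL₁deg hL₂deg
    (ι.comp (IsScalarTower.toAlgHom F Y M)) (ι : M →+* D) (κ₁ : L₁ →+* D) (κ₂ : L₂ →+* D)
    (fun _ => rfl) hκ₁Y hκ₂Y hz0 hprod hθ₁comm hθ₂comm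
end

section
/- Let ℓ be a prime, N a field, and D a central division algebra over N of degree ℓ² (so dim_N D = ℓ⁴). Let E be a subfield of D containing N with [E:N] = ℓ such that E/N is a cyclic Galois extension with Galois group generated by σ. Let b ∈ Eˣ and set c := b⁻¹·σ(b). Let D₁ := C_D(E) be the centralizer of E in D (a division algebra with center E and dimension ℓ² over E). Suppose θ ∈ D₁ lies in a subfield M₀ of D₁ with E ⊆ M₀ and [M₀ : E] = ℓ such that N_{M₀/E}(θ) = c. If there exist f ∈ Nˣ, a subfield L of D₁ with E ⊆ L and [L : E] = ℓ, and g ∈ L with N_{L/E}(g) = b·f (i.e., b·f is a reduced norm from D₁ over E), then θ belongs to the commutator subgroup [Dˣ, Dˣ]. -/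
section RowDet

open Function Equiv

variable {D Γ : Type*} [DivisionRing D] [CommGroupWithZero Γ]

/-- `d` is invariant under adding a multiple of a row to another one, and scaling a row by `c`
multiplies it by `χ c`. -/
structure IsRowDet_s2 (χ : D →*₀ Γ) {ι V : Type*} [DecidableEq ι] [AddCommGroup V] [Module D V]
    (d : (ι → V) → Γ) : Prop where
  add : ∀ v i j, i ≠ j → ∀ c : D, d (update v i (v i + c • v j)) = d v
  smul : ∀ v i (c : D), d (update v i (c • v i)) = χ c * d v

namespace IsRowDet_s2

variable {χ : D →*₀ Γ} {ι V : Type*} [DecidableEq ι] [AddCommGroup V] [Module D V]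
  {d : (ι → V) → Γ}

theorem update_add_sum (hd : IsRowDet_s2 χ d) (v : ι → V) (i : ι) (x : V) (c : ι → D)
    (s : Finset ι) (hs : i ∉ s) :
    d (update v i (x + ∑ k ∈ s, c k • v k)) = d (update v i x) := by
  induction s using Finset.induction_on with
  | empty => simp
  | insert k s hk ih =>
    have hki : k ≠ i := fun h => hs (h ▸ Finset.mem_insert_self _ _)
    rw [← ih fun h => hs (Finset.mem_insert_of_mem h),
      ← hd.add (update v i (x + ∑ k ∈ s, c k • v k)) i k hki.symm (c k)]
    rw [update_self, update_of_ne hki, update_idem, Finset.sum_insert hk]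
    congr 2
    abel

theorem update_sum [Fintype ι] (hd : IsRowDet_s2 χ d) (v : ι → V) (i : ι) (c : ι → D) :
    d (update v i (∑ k, c k • v k)) = χ (c i) * d v := by
  rw [← Finset.add_sum_erase _ _ (Finset.mem_univ i),
    hd.update_add_sum v i _ c _ (Finset.notMem_erase _ _), hd.smul]

theorem comp_swap (hd : IsRowDet_s2 χ d) (v : ι → V) {i j : ι} (hij : i ≠ j) :
    d (v ∘ swap i j) = χ (-1) * d v := by
  set v₁ := update v i (v i + (1 : D) • v j) with hv₁
  set v₂ := update v₁ j (v₁ j + (-1 : D) • v₁ i) with hv₂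
  set v₃ := update v₂ i (v₂ i + (1 : D) • v₂ j) with hv₃
  have h : v ∘ swap i j = update v₃ j ((-1 : D) • v₃ j) := by
    ext k
    rcases eq_or_ne k j with rfl | hkj
    · simp [hv₁, hv₂, hv₃, hij, hij.symm]
    rcases eq_or_ne k i with rfl | hki
    · simp [hv₁, hv₂, hv₃, hij, hij.symm]
    · simp [hv₁, hv₂, hv₃, hkj, hki, swap_apply_of_ne_of_ne]
  rw [h, hd.smul, hv₃, hd.add _ _ _ hij, hv₂, hd.add _ _ _ hij.symm, hv₁, hd.add _ _ _ hij]

section Succ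

variable {n : ℕ} {d : (Fin n → V) → Γ}

/-- The contribution of `d` at the tuple `w` with `w i` removed, normalised by the `i`-th
coefficient `l i` of a linear relation. -/
def minor (χ : D →*₀ Γ) (d : (Fin n → V) → Γ) (w : Fin (n + 1) → V) (l : Fin (n + 1) → D)
    (i : Fin (n + 1)) : Γ :=
  (if i = 0 then 1 else χ (-1)) * (χ (l i))⁻¹ * d (fun p => w (swap 0 i p.succ))

theorem comp_swap_zero (hd : IsRowDet_s2 χ d) (w : Fin (n + 1) → V) (l : Fin (n + 1) → D)
    (hw : ∑ k, l k • w k = 0) (h0 : l 0 ≠ 0) (q : Fin n) :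
    d (fun p => w (swap 0 q.succ p.succ)) =
      χ (-(l 0)⁻¹ * l q.succ) * d (fun p => w p.succ) := by
  rw [← hd.update_sum (fun p => w p.succ) q (fun p => -(l 0)⁻¹ * l p.succ)]
  congr 1
  ext p
  rcases eq_or_ne p q with rfl | hpq
  · rw [update_self, swap_apply_right]
    rw [Fin.sum_univ_succ] at hw
    simp_rw [mul_smul, ← Finset.smul_sum]
    rw [← neg_eq_of_add_eq_zero_right hw, smul_neg, neg_smul, neg_neg, smul_smul,
      inv_mul_cancel₀ h0, one_smul]
  · rw [update_of_ne hpq, swap_apply_of_ne_of_ne (Fin.succ_ne_zero _)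
      (fun h => hpq (Fin.succ_injective _ h))]

theorem minor_eq (hd : IsRowDet_s2 χ d) (w : Fin (n + 1) → V) (l : Fin (n + 1) → D)
    (hw : ∑ k, l k • w k = 0) {i j : Fin (n + 1)} (hi : l i ≠ 0) (hj : l j ≠ 0) :
    minor χ d w l i = minor χ d w l j := by
  have hneg : χ (-1) * χ (-1) = 1 := by rw [← map_mul]; simp
  have hneg_mul : ∀ x y : D, χ (-x * y) = χ (-1) * (χ x * χ y) := fun x y => by
    rw [← map_mul, ← map_mul, neg_mul, neg_one_mul]
  have key : ∀ j, l 0 ≠ 0 → l j ≠ 0 → minor χ d w l 0 = minor χ d w l j := by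
    intro j hi hj
    rcases Fin.eq_zero_or_eq_succ j with rfl | ⟨q, rfl⟩
    · rfl
    have hi' : χ (l 0) ≠ 0 := by simpa using hi
    have hj' : χ (l q.succ) ≠ 0 := by simpa using hj
    rw [minor, minor, hd.comp_swap_zero w l hw hi q, if_pos rfl, if_neg (Fin.succ_ne_zero _),
      hneg_mul, map_inv₀]
    simp only [swap_self, refl_apply]
    field_simp
    rw [sq, hneg, mul_one]
  rcases Fin.eq_zero_or_eq_succ i with rfl | ⟨a, rfl⟩
  · exact key j hi hj
  rcases Fin.eq_zero_or_eq_succ j with rfl | ⟨b, rfl⟩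
  · exact (key _ hj hi).symm
  rcases eq_or_ne a b with rfl | hab
  · rfl
  have hi' : χ (l a.succ) ≠ 0 := by simpa using hi
  have hj' : χ (l b.succ) ≠ 0 := by simpa using hj
  have hab' : a.succ ≠ b.succ := fun h => hab (Fin.succ_injective _ h)
  have h1 := hd.comp_swap_zero (w ∘ swap 0 a.succ) (l ∘ swap 0 a.succ)
    ((Equiv.sum_comp (swap 0 a.succ) fun k => l k • w k).trans hw) (by simpa using hi) b
  have h2 := hd.comp_swap (fun p : Fin n => (w ∘ swap 0 a.succ) (swap 0 b.succ p.succ)) hab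
  have h3 : (fun p : Fin n => (w ∘ swap 0 a.succ) (swap 0 b.succ p.succ)) ∘ swap a b =
      fun p => w (swap 0 b.succ p.succ) := by
    ext p
    simp only [comp_apply]
    congr 1
    rcases eq_or_ne p a with rfl | hpa
    · rw [swap_apply_left, swap_apply_right, swap_apply_left,
        swap_apply_of_ne_of_ne (Fin.succ_ne_zero _) hab']
    rcases eq_or_ne p b with rfl | hpb
    · rw [swap_apply_right, swap_apply_right, swap_apply_of_ne_of_ne (Fin.succ_ne_zero _) hab',
        swap_apply_right]
    · have hpa' : p.succ ≠ a.succ := fun h => hpa (Fin.succ_injective _ h)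
      have hpb' : p.succ ≠ b.succ := fun h => hpb (Fin.succ_injective _ h)
      rw [swap_apply_of_ne_of_ne hpa hpb, swap_apply_of_ne_of_ne (Fin.succ_ne_zero _) hpb',
        swap_apply_of_ne_of_ne (Fin.succ_ne_zero _) hpa']
  rw [h3] at h2
  rw [minor, minor, h2, h1, if_neg (Fin.succ_ne_zero _), if_neg (Fin.succ_ne_zero _)]
  simp only [comp_apply, swap_apply_left]
  rw [swap_apply_of_ne_of_ne (Fin.succ_ne_zero _) hab'.symm, hneg_mul, map_inv₀]
  field_simp
  rw [sq, hneg, one_mul]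

/-- The common value of the nonzero-coefficient minors of a linear relation. -/
noncomputable def relDet (χ : D →*₀ Γ) (d : (Fin n → V) → Γ) (w : Fin (n + 1) → V)
    (l : Fin (n + 1) → D) : Γ :=
  open Classical in if h : ∃ i, l i ≠ 0 then minor χ d w l h.choose else 0

theorem relDet_eq (hd : IsRowDet_s2 χ d) (w : Fin (n + 1) → V) (l : Fin (n + 1) → D)
    (hw : ∑ k, l k • w k = 0) {i : Fin (n + 1)} (hi : l i ≠ 0) :
    relDet χ d w l = minor χ d w l i := by
  have h : ∃ i, l i ≠ 0 := ⟨i, hi⟩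
  rw [relDet, dif_pos h]
  exact hd.minor_eq w l hw h.choose_spec hi

theorem succ_preimage_swap {i k : Fin (n + 1)} (hik : i ≠ k) :
    ∃ q : Fin n, swap 0 k q.succ = i := by
  have : swap 0 k i ≠ 0 := fun h => hik (by
    have := congrArg (swap 0 k) h
    rwa [swap_apply_self, swap_apply_left] at this)
  obtain ⟨q, hq⟩ := Fin.exists_succ_eq.2 this
  exact ⟨q, by rw [hq, swap_apply_self]⟩

omit [AddCommGroup V] in
theorem comp_update_of_eq {w : Fin (n + 1) → V} {i k : Fin (n + 1)} {q : Fin n}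
    (hq : swap 0 k q.succ = i) (x : V) :
    (fun p : Fin n => update w i x (swap 0 k p.succ)) =
      update (fun p : Fin n => w (swap 0 k p.succ)) q x := by
  ext p
  rcases eq_or_ne p q with rfl | hpq
  · rw [update_self, hq, update_self]
  · rw [update_of_ne hpq, update_of_ne]
    rw [← hq]
    exact fun h => hpq (Fin.succ_injective _ ((swap 0 k).injective h))

omit [AddCommGroup V] [Module D V] in
theorem minor_update_self (w : Fin (n + 1) → V) (l : Fin (n + 1) → D) (i : Fin (n + 1)) (x : V) :
    minor χ d (update w i x) l i = minor χ d w l i := by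
  rw [minor, minor]
  congr 2
  ext p
  rw [update_of_ne]
  intro h
  have := congrArg (swap 0 i) h
  rw [swap_apply_self, swap_apply_right] at this
  exact Fin.succ_ne_zero _ this

theorem relDet_add (hd : IsRowDet_s2 χ d) (w : Fin (n + 1) → V) (l : Fin (n + 1) → D)
    (hl : ∃ i, l i ≠ 0) {i j : Fin (n + 1)} (hij : i ≠ j) (c : D)
    (hw : ∑ k, update l j (l j + l i * c) k • w k = 0)
    (hw' : ∑ k, l k • update w i (w i + c • w j) k = 0) :
    relDet χ d (update w i (w i + c • w j)) l = relDet χ d w (update l j (l j + l i * c)) := by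
  by_cases hi : l i = 0
  · have hlj : update l j (l j + l i * c) = l := by simp [hi]
    rw [hlj] at hw ⊢
    obtain ⟨k, hk⟩ := hl
    have hik : i ≠ k := by rintro rfl; exact hk hi
    rw [hd.relDet_eq _ _ hw hk, hd.relDet_eq _ _ hw' hk]
    obtain ⟨q, hq⟩ := succ_preimage_swap hik
    rw [minor, minor, comp_update_of_eq hq]
    congr 1
    rcases eq_or_ne j k with rfl | hjk
    · set u : Fin n → V := fun p => w (swap 0 j p.succ) with hu
      have hsum : l j • w j + ∑ p : Fin n, l (swap 0 j p.succ) • u p = 0 := by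
        rw [← hw, ← Equiv.sum_comp (swap 0 j), Fin.sum_univ_succ]
        simp [hu]
      have hwj : w j = ∑ p : Fin n, (-(l j)⁻¹ * l (swap 0 j p.succ)) • u p := by
        simp_rw [mul_smul, ← Finset.smul_sum]
        rw [← neg_eq_of_add_eq_zero_right hsum, smul_neg, neg_smul, neg_neg, smul_smul,
          inv_mul_cancel₀ hk, one_smul]
      have hwi : w i = u q := by rw [hu]; simp only [hq]
      have hcoef : w i + c • w j =
          ∑ p, ((Pi.single q 1 : Fin n → D) p + c * (-(l j)⁻¹ * l (swap 0 j p.succ))) • u p := by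
        simp_rw [add_smul, Finset.sum_add_distrib, mul_smul c, ← Finset.smul_sum, ← hwj]
        congr 1
        rw [Finset.sum_eq_single q]
        · simp [hwi]
        · intro b _ hb; simp [hb]
        · simp
      rw [hcoef, hd.update_sum]
      simp [hq, hi]
    · obtain ⟨r, hr⟩ := succ_preimage_swap hjk
      have hqr : q ≠ r := by rintro rfl; exact hij (hq.symm.trans hr)
      have := hd.add (fun p => w (swap 0 k p.succ)) q r hqr c
      simpa only [hq, hr] using this
  · have hi' : update l j (l j + l i * c) i ≠ 0 := by rwa [update_of_ne hij]
    rw [hd.relDet_eq _ _ hw hi', hd.relDet_eq _ _ hw' hi, minor_update_self, minor, minor,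
      update_of_ne hij]

theorem relDet_smul (hd : IsRowDet_s2 χ d) (w : Fin (n + 1) → V) (l : Fin (n + 1) → D)
    (hl : ∃ i, l i ≠ 0) {i : Fin (n + 1)} {c : D} (hc : c ≠ 0)
    (hw : ∑ k, update l i (l i * c) k • w k = 0)
    (hw' : ∑ k, l k • update w i (c • w i) k = 0) :
    relDet χ d (update w i (c • w i)) l = χ c * relDet χ d w (update l i (l i * c)) := by
  obtain ⟨k, hk⟩ := hl
  have hχ : χ c ≠ 0 := by simpa using hc
  have hk' : update l i (l i * c) k ≠ 0 := by
    rcases eq_or_ne k i with rfl | h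
    · simpa [hc] using hk
    · rwa [update_of_ne h]
  rw [hd.relDet_eq _ _ hw hk', hd.relDet_eq _ _ hw' hk]
  rcases eq_or_ne i k with rfl | hik
  · have : χ (l i) ≠ 0 := by simpa using hk
    rw [minor_update_self, minor, minor, update_self, map_mul]
    field_simp
  · obtain ⟨q, hq⟩ := succ_preimage_swap hik
    rw [minor, minor, comp_update_of_eq hq, update_of_ne hik.symm]
    have := hd.smul (fun p => w (swap 0 k p.succ)) q c
    simp only [hq] at this
    rw [this, mul_left_comm]

end Succ

section Existence

variable {n : ℕ}

theorem rel_update_add_iff (v : ι → V) [Fintype ι] (l : ι → D) {i j : ι} (hij : i ≠ j) (c : D) :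
    ∑ k, l k • update v i (v i + c • v j) k = ∑ k, update l j (l j + l i * c) k • v k := by
  rw [← Finset.add_sum_erase _ _ (Finset.mem_univ i), ← Finset.add_sum_erase _ _ (Finset.mem_univ j),
    ← Finset.add_sum_erase (a := j) _ _ (Finset.mem_erase.2 ⟨hij.symm, Finset.mem_univ j⟩),
    ← Finset.add_sum_erase (a := i) _ _ (Finset.mem_erase.2 ⟨hij, Finset.mem_univ i⟩),
    Finset.erase_right_comm]
  have : ∀ k ∈ (Finset.univ.erase j).erase i, l k • update v i (v i + c • v j) k =
      update l j (l j + l i * c) k • v k := by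
    intro k hk
    simp only [Finset.mem_erase] at hk
    rw [update_of_ne hk.1, update_of_ne hk.2.1]
  rw [Finset.sum_congr rfl this, update_self, update_self, update_of_ne hij, update_of_ne hij.symm,
    smul_add, add_smul, mul_smul]
  abel

theorem rel_update_smul (v : ι → V) [Fintype ι] (l : ι → D) (i : ι) (c : D) :
    ∑ k, l k • update v i (c • v i) k = ∑ k, update l i (l i * c) k • v k := by
  refine Finset.sum_congr rfl fun k _ => ?_
  rcases eq_or_ne k i with rfl | h
  · simp [mul_smul]
  · simp [h]

open Classical in
/-- Expansion along the first column: the relation satisfied by the rows with their first entry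
removed is the one given by the first row of the inverse matrix. -/
noncomputable def expand (χ : D →*₀ Γ) (d : (Fin n → Fin n → D) → Γ)
    (v : Fin (n + 1) → Fin (n + 1) → D) : Γ :=
  if h : ∃! l : Fin (n + 1) → D, ∑ k, l k • v k = Pi.single 0 1
  then relDet χ d (fun k => Fin.tail (v k)) h.choose else 0

theorem expand_eq (χ : D →*₀ Γ) (d : (Fin n → Fin n → D) → Γ)
    (v : Fin (n + 1) → Fin (n + 1) → D) (h : ∃! l : Fin (n + 1) → D, ∑ k, l k • v k = Pi.single 0 1)
    (l : Fin (n + 1) → D) (hl : ∑ k, l k • v k = Pi.single 0 1) :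
    expand χ d v = relDet χ d (fun k => Fin.tail (v k)) l := by
  rw [expand, dif_pos h, h.unique hl h.choose_spec.1]

theorem sum_smul_tail {l : Fin (n + 1) → D} {v : Fin (n + 1) → Fin (n + 1) → D}
    (hl : ∑ k, l k • v k = Pi.single 0 1) : ∑ k, l k • Fin.tail (v k) = 0 := by
  ext p
  have := congrFun hl p.succ
  simpa [Fin.tail, Finset.sum_apply] using this

theorem exists_ne_zero_of_rel {l : Fin (n + 1) → D} {v : Fin (n + 1) → Fin (n + 1) → D}
    (hl : ∑ k, l k • v k = Pi.single 0 1) : ∃ i, l i ≠ 0 := by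
  by_contra! h
  have := congrFun hl 0
  simp [h] at this

omit [DivisionRing D] in
theorem tail_update (v : Fin (n + 1) → Fin (n + 1) → D) (i : Fin (n + 1))
    (x : Fin (n + 1) → D) :
    (fun k => Fin.tail (update v i x k)) = update (fun k => Fin.tail (v k)) i (Fin.tail x) := by
  ext k
  rcases eq_or_ne k i with rfl | h
  · simp
  · simp [h]

theorem expand_isRowDet {d : (Fin n → Fin n → D) → Γ} (hd : IsRowDet_s2 χ d) :
    IsRowDet_s2 χ (expand χ d) where
  add v i j hij c := by
    have hinv : ∀ l : Fin (n + 1) → D, ∀ c : D,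
        update (update l j (l j + l i * c)) j
          (update l j (l j + l i * c) j + update l j (l j + l i * c) i * -c) = l := by
      intro l c
      simp [update_of_ne hij]
    have hiff : (∃! l : Fin (n + 1) → D, ∑ k, l k • update v i (v i + c • v j) k = Pi.single 0 1) ↔
        ∃! l : Fin (n + 1) → D, ∑ k, l k • v k = Pi.single 0 1 := by
      simp_rw [rel_update_add_iff v _ hij]
      refine (Equiv.existsUnique_congr ⟨fun l => update l j (l j + l i * c),
        fun l => update l j (l j + l i * -c), fun l => hinv l c, fun l => ?_⟩ fun _ => Iff.rfl)
      simpa using hinv l (-c)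
    by_cases h : ∃! l : Fin (n + 1) → D, ∑ k, l k • update v i (v i + c • v j) k = Pi.single 0 1
    · obtain ⟨l, hl, -⟩ := id h
      have hl' := hl
      rw [rel_update_add_iff v _ hij] at hl'
      rw [expand_eq χ d _ h l hl, expand_eq χ d _ (hiff.1 h) _ hl', tail_update]
      refine hd.relDet_add (fun k => Fin.tail (v k)) l (exists_ne_zero_of_rel hl) hij c
        (sum_smul_tail hl') ?_
      have := sum_smul_tail hl
      rw [← this]
      exact Finset.sum_congr rfl fun k _ => by
        rw [congrFun (tail_update v i (v i + c • v j)) k]; rfl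
    · rw [expand, expand, dif_neg h, dif_neg (hiff.not.1 h)]
  smul v i c := by
    rcases eq_or_ne c 0 with rfl | hc
    · rw [map_zero, zero_mul, expand, dif_neg]
      rintro ⟨l, hl, hu⟩
      have key : ∀ a : D, update l i a = l := fun a => hu _ (by
        simp only at hl ⊢
        rw [← hl]
        refine Finset.sum_congr rfl fun k _ => ?_
        rcases eq_or_ne k i with rfl | h
        · simp
        · simp [h])
      have h0 := congrFun (key 0) i
      have h1 := congrFun (key 1) i
      rw [update_self] at h0 h1
      exact zero_ne_one (h0.trans h1.symm)
    have hiff : (∃! l : Fin (n + 1) → D, ∑ k, l k • update v i (c • v i) k = Pi.single 0 1) ↔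
        ∃! l : Fin (n + 1) → D, ∑ k, l k • v k = Pi.single 0 1 := by
      simp_rw [rel_update_smul v]
      refine (Equiv.existsUnique_congr ⟨fun l => update l i (l i * c),
        fun l => update l i (l i * c⁻¹), fun l => ?_, fun l => ?_⟩ fun _ => Iff.rfl)
      · simp [hc]
      · simp [hc]
    by_cases h : ∃! l : Fin (n + 1) → D, ∑ k, l k • update v i (c • v i) k = Pi.single 0 1
    · obtain ⟨l, hl, -⟩ := id h
      have hl' := hl
      rw [rel_update_smul v] at hl'
      rw [expand_eq χ d _ h l hl, expand_eq χ d _ (hiff.1 h) _ hl', tail_update]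
      refine hd.relDet_smul (fun k => Fin.tail (v k)) l (exists_ne_zero_of_rel hl) hc
        (sum_smul_tail hl') ?_
      have := sum_smul_tail hl
      rw [← this]
      exact Finset.sum_congr rfl fun k _ => by
        rw [congrFun (tail_update v i (c • v i)) k]; rfl
    · rw [expand, expand, dif_neg h, dif_neg (hiff.not.1 h), mul_zero]

theorem expand_one {d : (Fin n → Fin n → D) → Γ} (hd : IsRowDet_s2 χ d)
    (h1 : d (fun i => Pi.single i 1) = 1) : expand χ d (fun i => Pi.single i 1) = 1 := by
  have hl : ∀ l : Fin (n + 1) → D, ∑ k, l k • (Pi.single k 1 : Fin (n + 1) → D) = l := by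
    intro l
    ext p
    simp [Finset.sum_apply, Pi.single_apply]
  have h0 : (Pi.single 0 1 : Fin (n + 1) → D) 0 ≠ 0 := by simp
  rw [expand_eq χ d _ ⟨Pi.single 0 1, hl _, fun l h => (hl l).symm.trans h⟩ (Pi.single 0 1) (hl _),
    hd.relDet_eq _ _ (sum_smul_tail (hl _)) h0, minor, if_pos rfl]
  simp only [swap_self, refl_apply, Pi.single_eq_same, map_one, inv_one, one_mul]
  rw [← h1]
  congr 1
  ext i j
  simp [Fin.tail, Pi.single_apply]

theorem exists_isRowDet (χ : D →*₀ Γ) (n : ℕ) :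
    ∃ d : (Fin n → Fin n → D) → Γ, IsRowDet_s2 χ d ∧ d (fun i => Pi.single i 1) = 1 := by
  induction n with
  | zero => exact ⟨fun _ => 1, ⟨fun _ i => i.elim0, fun _ i => i.elim0⟩, rfl⟩
  | succ n ih =>
    obtain ⟨d, hd, h1⟩ := ih
    exact ⟨expand χ d, expand_isRowDet hd, expand_one hd h1⟩

end Existence

section Uniqueness

variable {n : ℕ}

theorem update_sum_induction {P : (Fin n → V) → Prop}
    (hadd : ∀ v i j, i ≠ j → ∀ c : D, P (update v i (v i + c • v j)) → P v)
    (hsmul : ∀ v i (c : D), c ≠ 0 → P (update v i (c • v i)) → P v)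
    (v : Fin n → V) (i : Fin n) (c : Fin n → D) (hc : c i ≠ 0)
    (h : P (update v i (∑ k, c k • v k))) : P v := by
  have key : ∀ s : Finset (Fin n), i ∉ s →
      P (update v i (c i • v i + ∑ k ∈ s, c k • v k)) → P v := by
    intro s
    induction s using Finset.induction_on with
    | empty => intro _ h; exact hsmul v i _ hc (by simpa using h)
    | insert k s hk ih =>
      intro hs h
      have hki : k ≠ i := fun h => hs (h ▸ Finset.mem_insert_self _ _)
      refine ih (fun h => hs (Finset.mem_insert_of_mem h)) (hadd _ i k hki.symm (c k) ?_)
      rw [update_self, update_of_ne hki, update_idem]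
      rw [Finset.sum_insert hk, add_comm (c k • v k), ← add_assoc] at h
      exact h
  refine key _ (Finset.notMem_erase i Finset.univ) ?_
  rwa [Finset.add_sum_erase _ (fun k => c k • v k) (Finset.mem_univ i)]

/-- Gaussian elimination over a division ring. -/
theorem basis_induction {P : (Fin n → Fin n → D) → Prop}
    (hadd : ∀ v i j, i ≠ j → ∀ c : D, P (update v i (v i + c • v j)) → P v)
    (hsmul : ∀ v i (c : D), c ≠ 0 → P (update v i (c • v i)) → P v)
    (hone : P (fun i => Pi.single i 1)) (v : Fin n → Fin n → D)
    (hv : ⊤ ≤ Submodule.span D (Set.range v)) : P v := by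
  have key : ∀ m k : ℕ, m + k = n → ∀ v : Fin n → Fin n → D,
      (∀ i : Fin n, i.1 < k → v i = Pi.single i 1) →
      ⊤ ≤ Submodule.span D (Set.range v) → P v := by
    intro m
    induction m with
    | zero =>
      intro k hk v hvk _
      rw [show v = fun i => Pi.single i 1 from funext fun i => hvk i (by omega)]
      exact hone
    | succ m ih =>
      intro k hk v hvk hv
      set a : Fin n := ⟨k, by omega⟩ with ha
      have main : ∀ v : Fin n → Fin n → D, (∀ i : Fin n, i.1 < k → v i = Pi.single i 1) →
          ⊤ ≤ Submodule.span D (Set.range v) → ∀ c : Fin n → D, c a ≠ 0 →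
          ∑ i, c i • v i = Pi.single a 1 → P v := by
        intro v hvk hv c hca hc
        refine update_sum_induction hadd hsmul v a c hca (ih (k + 1) (by omega) _ ?_ ?_)
        · intro i hi
          rcases eq_or_ne i a with rfl | hia
          · rw [update_self, hc]
          · rw [update_of_ne hia, hvk]
            have : i.1 ≠ k := fun h => hia (Fin.ext h)
            omega
        · refine hv.trans (Submodule.span_le.2 ?_)
          set v' := update v a (∑ i, c i • v i) with hv'
          have hmem : ∀ i, v' i ∈ Submodule.span D (Set.range v') :=
            fun i => Submodule.subset_span ⟨i, rfl⟩
          rintro _ ⟨i, rfl⟩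
          rcases eq_or_ne i a with rfl | hia
          · have h1 : v a = (c a)⁻¹ • (v' a - ∑ i ∈ Finset.univ.erase a, c i • v' i) := by
              have : ∑ i ∈ Finset.univ.erase a, c i • v' i =
                  ∑ i ∈ Finset.univ.erase a, c i • v i :=
                Finset.sum_congr rfl fun i hi => by
                  rw [hv', update_of_ne (Finset.ne_of_mem_erase hi)]
              rw [this, hv', update_self, ← Finset.add_sum_erase _ _ (Finset.mem_univ a),
                add_sub_cancel_right, smul_smul, inv_mul_cancel₀ hca, one_smul]
            rw [h1]
            exact Submodule.smul_mem _ _ (Submodule.sub_mem _ (hmem a)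
              (Submodule.sum_mem _ fun i _ => Submodule.smul_mem _ _ (hmem i)))
          · have := hmem i
            rwa [hv', update_of_ne hia] at this
      obtain ⟨c, hc⟩ := (Submodule.mem_span_range_iff_exists_fun D).1
        (hv (Submodule.mem_top : (Pi.single a 1 : Fin n → D) ∈ ⊤))
      by_cases hca : c a = 0
      · obtain ⟨i, hik, hci⟩ : ∃ i : Fin n, k < i.1 ∧ c i ≠ 0 := by
          by_contra! h
          have h0 := congrFun hc a
          rw [Finset.sum_apply, Pi.single_eq_same, Finset.sum_eq_zero] at h0
          · exact zero_ne_one h0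
          · intro i _
            rcases lt_trichotomy i.1 k with hi | hi | hi
            · rw [hvk i hi]
              have : a ≠ i := fun h => by rw [← h] at hi; simp [ha] at hi
              simp [this]
            · rw [show i = a from Fin.ext hi, hca, zero_smul]; rfl
            · rw [h i hi, zero_smul]; rfl
        have hia : i ≠ a := fun h => by rw [h] at hik; simp [ha] at hik
        refine hadd v i a hia (-1) (main _ ?_ ?_ (update c a (c a + c i)) ?_ ?_)
        · intro j hj
          rw [update_of_ne, hvk j hj]
          rintro rfl
          omega
        · set v' := update v i (v i + (-1 : D) • v a) with hv'
          refine hv.trans (Submodule.span_le.2 ?_)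
          have hmem : ∀ i, v' i ∈ Submodule.span D (Set.range v') :=
            fun i => Submodule.subset_span ⟨i, rfl⟩
          rintro _ ⟨j, rfl⟩
          rcases eq_or_ne j i with rfl | hji
          · have h1 : v j = v' j + v' a := by
              rw [hv', update_self, update_of_ne hia.symm]; simp
            rw [h1]
            exact Submodule.add_mem _ (hmem _) (hmem _)
          · have := hmem j
            rwa [hv', update_of_ne hji] at this
        · simpa [hca] using hci
        · rw [rel_update_add_iff v _ hia, ← hc]
          refine Finset.sum_congr rfl fun j _ => ?_
          rcases eq_or_ne j a with rfl | h
          · simp [hia, hca]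
          · simp [h, hia, hca]
      · exact main v hvk hv c hca hc
  exact key n 0 (by omega) v (fun i hi => absurd hi (Nat.not_lt_zero _)) hv

theorem eq_mul {d f : (Fin n → Fin n → D) → Γ} (hd : IsRowDet_s2 χ d)
    (h1 : d (fun i => Pi.single i 1) = 1) (hf : IsRowDet_s2 χ f) (v : Fin n → Fin n → D)
    (hv : ⊤ ≤ Submodule.span D (Set.range v)) : f v = f (fun i => Pi.single i 1) * d v := by
  refine basis_induction (P := fun v => f v = f (fun i => Pi.single i 1) * d v) ?_ ?_ ?_ v hv
  · intro v i j hij c h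
    rwa [hf.add _ _ _ hij, hd.add _ _ _ hij] at h
  · intro v i c hc h
    have : χ c ≠ 0 := by simpa using hc
    rw [hf.smul, hd.smul, mul_left_comm] at h
    exact mul_left_cancel₀ this h
  · rw [h1, mul_one]

end Uniqueness

end IsRowDet_s2

end RowDet

namespace IsRowDet_s2

open Function

variable {D Γ : Type*} [DivisionRing D] [CommGroupWithZero Γ] {χ : D →*₀ Γ} {n : ℕ}
  {d : (Fin n → Fin n → D) → Γ}

theorem span_rows_eq_top {A : Matrix (Fin n) (Fin n) D} (hA : IsUnit A) :
    ⊤ ≤ Submodule.span D (Set.range (A : Fin n → Fin n → D)) := by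
  obtain ⟨B, hB⟩ := hA.exists_left_inv
  intro x _
  refine (Submodule.mem_span_range_iff_exists_fun D).2 ⟨Matrix.vecMul x B, ?_⟩
  rw [← Matrix.vecMul_eq_sum, Matrix.vecMul_vecMul, hB, Matrix.vecMul_one]

theorem mulRight (hd : IsRowDet_s2 χ d) (B : Matrix (Fin n) (Fin n) D) :
    IsRowDet_s2 χ (fun A : Fin n → Fin n → D => d (Matrix.of A * B)) := by
  have hB : ∀ v : Fin n → Fin n → D, (Matrix.of v * B : Matrix (Fin n) (Fin n) D) =
      fun k : Fin n => Matrix.vecMul (v k) B := fun v => rfl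
  constructor
  · intro v i j hij c
    simp only [hB]
    rw [← hd.add (fun k => Matrix.vecMul (v k) B) i j hij c]
    congr 1
    ext k : 1
    rcases eq_or_ne k i with rfl | h
    · simp [Matrix.add_vecMul, Matrix.smul_vecMul]
    · simp [h]
  · intro v i c
    simp only [hB]
    rw [← hd.smul (fun k => Matrix.vecMul (v k) B) i c]
    congr 1
    ext k : 1
    rcases eq_or_ne k i with rfl | h
    · simp [Matrix.smul_vecMul]
    · simp [h]

theorem of_single_one : Matrix.of (fun i : Fin n => (Pi.single i 1 : Fin n → D)) = 1 := by
  ext i j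
  simp [Matrix.one_apply, Pi.single_apply, eq_comm]

theorem map_mul (hd : IsRowDet_s2 χ d) (h1 : d (1 : Matrix (Fin n) (Fin n) D) = 1)
    {A : Matrix (Fin n) (Fin n) D} (hA : IsUnit A) (B : Matrix (Fin n) (Fin n) D) :
    d (A * B) = d A * d B := by
  have := eq_mul hd (by rw [← h1, ← of_single_one]; rfl) (hd.mulRight B) A (span_rows_eq_top hA)
  rw [of_single_one, one_mul] at this
  rw [mul_comm]
  exact this

theorem ne_zero_of_isUnit (hd : IsRowDet_s2 χ d) (h1 : d (1 : Matrix (Fin n) (Fin n) D) = 1)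
    {A : Matrix (Fin n) (Fin n) D} (hA : IsUnit A) : d A ≠ 0 := by
  obtain ⟨B, hB⟩ := hA.exists_right_inv
  intro h
  have := hd.map_mul h1 hA B
  rw [hB, h1, h, zero_mul] at this
  exact one_ne_zero this

theorem scalar (hd : IsRowDet_s2 χ d) (h1 : d (1 : Matrix (Fin n) (Fin n) D) = 1) (a : D) :
    d (Matrix.scalar (Fin n) a) = χ a ^ n := by
  have key : ∀ s : Finset (Fin n),
      d (fun i => Pi.single i (if i ∈ s then a else 1)) = χ a ^ s.card := by
    intro s
    induction s using Finset.induction_on with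
    | empty =>
      rw [Finset.card_empty, pow_zero, ← h1, ← of_single_one]
      simp only [Finset.notMem_empty, if_false]
      rfl
    | insert k s hk ih =>
      rw [Finset.card_insert_of_notMem hk, pow_succ', ← ih, ← hd.smul _ k]
      congr 1
      ext i j
      rcases eq_or_ne i k with rfl | h
      · simp [hk, Pi.single_apply]
      · simp [h]
  have := key Finset.univ
  rw [Finset.card_univ, Fintype.card_fin] at this
  rw [← this]
  congr 1
  ext i j
  simp [Matrix.diagonal_apply, Pi.single_apply, eq_comm]

theorem det {K : Type*} [Field K] : IsRowDet_s2 (MonoidWithZeroHom.id K)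
    (fun A : Fin n → Fin n → K => Matrix.det (Matrix.of A)) where
  add v i j hij c := by
    exact Matrix.det_updateRow_add_smul_self (Matrix.of v) hij c
  smul v i c := by
    have := Matrix.det_updateRow_smul (Matrix.of v) i c (v i)
    rwa [show (Matrix.of v).updateRow i (v i) = Matrix.of v from
      Matrix.updateRow_eq_self (Matrix.of v) i] at this

theorem map (hd : IsRowDet_s2 χ d) (h1 : d (1 : Matrix (Fin n) (Fin n) D) = 1)
    {K : Type*} [Field K] (j : K →+* D) {A : Matrix (Fin n) (Fin n) K} (hA : IsUnit A) :
    d (A.map j) = χ (j A.det) := by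
  set χ' : K →*₀ Γ := χ.comp j.toMonoidWithZeroHom with hχ'
  have hf : IsRowDet_s2 χ' (fun A : Fin n → Fin n → K => d (fun p q => j (A p q))) := by
    constructor
    · intro v i k hik c
      rw [← hd.add (fun p q => j (v p q)) i k hik (j c)]
      congr 1
      ext p q
      rcases eq_or_ne p i with rfl | h
      · simp
      · simp [h]
    · intro v i c
      refine Eq.trans ?_ (hd.smul (fun p q => j (v p q)) i (j c))
      congr 1
      ext p q
      rcases eq_or_ne p i with rfl | h
      · simp
      · simp [h]
  have hg : IsRowDet_s2 χ' (fun A : Fin n → Fin n → K => χ' (Matrix.det (Matrix.of A))) := by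
    constructor
    · intro v i k hik c
      exact congrArg χ' (det.add v i k hik c)
    · intro v i c
      rw [← _root_.map_mul]
      exact congrArg χ' (det.smul v i c)
  have h := eq_mul hg (by rw [of_single_one, Matrix.det_one, map_one]) hf A (span_rows_eq_top hA)
  have e : d (fun p q => j ((Pi.single p 1 : Fin n → K) q)) = 1 := by
    rw [← h1, ← of_single_one]
    congr 1
    ext p q
    simp [Pi.single_apply, apply_ite j]
  rw [e, one_mul] at h
  exact h

end IsRowDet_s2

section Consequences

variable {D Γ : Type*} [DivisionRing D] [CommGroupWithZero Γ] (χ : D →*₀ Γ) {n : ℕ}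

theorem exists_isRowDet_matrix (χ : D →*₀ Γ) (n : ℕ) :
    ∃ d : (Fin n → Fin n → D) → Γ, IsRowDet_s2 χ d ∧ d (1 : Matrix (Fin n) (Fin n) D) = 1 := by
  obtain ⟨d, hd, h1⟩ := IsRowDet_s2.exists_isRowDet χ n
  exact ⟨d, hd, by rw [← IsRowDet_s2.of_single_one]; exact h1⟩

/-- If the scalar matrix `a` over `D` is conjugate to a matrix with entries in a subfield, then
`a ^ n` and the determinant of that matrix have the same image in the abelianization. -/
theorem map_pow_eq_map_det_of_conj {K : Type*} [Field K] (j : K →+* D) (a : D)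
    {A : Matrix (Fin n) (Fin n) K} (hA : IsUnit A) {Y : Matrix (Fin n) (Fin n) D} (hY : IsUnit Y)
    (h : Y * Matrix.scalar (Fin n) a = A.map j * Y) : χ a ^ n = χ (j A.det) := by
  obtain ⟨d, hd, h1⟩ := exists_isRowDet_matrix χ n
  have hA' : IsUnit (A.map j) := hA.map (j.mapMatrix (m := Fin n))
  have := congrArg d h
  rw [hd.map_mul h1 hY, hd.map_mul h1 hA', hd.scalar h1, hd.map h1 j hA, mul_comm] at this
  exact mul_right_cancel₀ (hd.ne_zero_of_isUnit h1 hY) this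

theorem map_pow_eq_one_of_conj (a : D) {X X' Y : Matrix (Fin n) (Fin n) D} (hX : IsUnit X)
    (hX' : IsUnit X') (hY : IsUnit Y) (ha : Matrix.scalar (Fin n) a * X' = X)
    (h : Y * X' = X * Y) : χ a ^ n = 1 := by
  obtain ⟨d, hd, h1⟩ := exists_isRowDet_matrix χ n
  have e := congrArg d h
  rw [hd.map_mul h1 hY, hd.map_mul h1 hX, mul_comm] at e
  have e' := mul_right_cancel₀ (hd.ne_zero_of_isUnit h1 hY) e
  rcases eq_or_ne a 0 with rfl | ha0
  · rw [map_zero, zero_mul] at ha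
    subst ha
    rcases n with _ | n
    · simp
    · exact absurd hX not_isUnit_zero
  have hs : IsUnit (Matrix.scalar (Fin n) a) := (IsUnit.mk0 a ha0).map (Matrix.scalar (Fin n))
  rw [← ha, hd.map_mul h1 hs, hd.scalar h1] at e'
  exact mul_right_cancel₀ (hd.ne_zero_of_isUnit h1 hX') (by rw [← e', one_mul])

end Consequences

section SkolemNoether

open scoped TensorProduct

theorem exists_linearEquiv_of_finrank_eq {E R V₁ V₂ : Type*} [Field E] [Ring R] [Algebra E R]
    [IsSimpleRing R] [IsArtinianRing R] [AddCommGroup V₁] [Module E V₁] [Module R V₁]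
    [IsScalarTower E R V₁] [Module.Finite E V₁] [AddCommGroup V₂] [Module E V₂] [Module R V₂]
    [IsScalarTower E R V₂] [Module.Finite E V₂] (h : Module.finrank E V₁ = Module.finrank E V₂) :
    Nonempty (V₁ ≃ₗ[R] V₂) := by
  have : Module.Finite R V₁ := Module.Finite.of_restrictScalars_finite E R V₁
  have : Module.Finite R V₂ := Module.Finite.of_restrictScalars_finite E R V₂
  rcases subsingleton_or_nontrivial V₁ with h₁ | h₁
  · have h₂ : Subsingleton V₂ := by
      rw [← Module.finrank_zero_iff (R := E), ← h, Module.finrank_zero_iff]; exact h₁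
    exact ⟨⟨0, 0, fun _ => Subsingleton.elim _ _, fun _ => Subsingleton.elim _ _⟩⟩
  obtain ⟨n, hn, S, hS, -⟩ := (IsSimpleRing.isIsotypic R (V₁ × V₂)).linearEquiv_fun
  have hi := IsSimpleRing.isIsotypic R (V₁ × V₂) S
  obtain ⟨n₁, ⟨e₁⟩⟩ := (hi.of_injective (LinearMap.inl R V₁ V₂)
    LinearMap.inl_injective).linearEquiv_fun
  obtain ⟨n₂, ⟨e₂⟩⟩ := (hi.of_injective (LinearMap.inr R V₁ V₂)
    LinearMap.inr_injective).linearEquiv_fun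
  have hfin : Module.Finite E S := Module.Finite.of_injective
    (S.subtype.restrictScalars E) S.subtype_injective
  have hpos : 0 < Module.finrank E S := by
    have := hS.nontrivial
    exact Module.finrank_pos
  have d₁ := (e₁.restrictScalars E).finrank_eq
  have d₂ := (e₂.restrictScalars E).finrank_eq
  rw [Module.finrank_pi_fintype, Finset.sum_const, Finset.card_univ, Fintype.card_fin,
    smul_eq_mul] at d₁ d₂
  rw [d₁, d₂] at h
  obtain rfl := Nat.eq_of_mul_eq_mul_right hpos h
  exact ⟨e₁.trans e₂.symm⟩

theorem exists_intertwining_of_finrank_eq {E R V₁ V₂ : Type*} [Field E] [Ring R] [Algebra E R]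
    [IsSimpleRing R] [IsArtinianRing R] [AddCommGroup V₁] [Module E V₁]
    [Module.Finite E V₁] [AddCommGroup V₂] [Module E V₂] [Module.Finite E V₂]
    (φ₁ : R →ₐ[E] Module.End E V₁) (φ₂ : R →ₐ[E] Module.End E V₂)
    (h : Module.finrank E V₁ = Module.finrank E V₂) :
    ∃ y : V₁ ≃+ V₂, ∀ r v, y (φ₁ r v) = φ₂ r (y v) := by
  let _ : Module R V₁ := Module.compHom V₁ φ₁.toRingHom
  let _ : Module R V₂ := Module.compHom V₂ φ₂.toRingHom
  have h₁ : ∀ (r : R) (v : V₁), r • v = φ₁ r v := fun _ _ => rfl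
  have h₂ : ∀ (r : R) (v : V₂), r • v = φ₂ r v := fun _ _ => rfl
  have : IsScalarTower E R V₁ := ⟨fun e r v => by rw [h₁, h₁, map_smul]; rfl⟩
  have : IsScalarTower E R V₂ := ⟨fun e r v => by rw [h₂, h₂, map_smul]; rfl⟩
  obtain ⟨y⟩ := exists_linearEquiv_of_finrank_eq (R := R) h
  exact ⟨y.toAddEquiv, fun r v => y.map_smul r v⟩

variable {E D B : Type*} [Field E] [DivisionRing D] [Algebra E D] [Field B] [Algebra E B]

theorem tmul_one_mul_eq_smul (a : D) (z : D ⊗[E] B) : (a ⊗ₜ 1 : D ⊗[E] B) * z = a • z := by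
  induction z using TensorProduct.induction_on with
  | zero => simp
  | tmul b c => simp [TensorProduct.smul_tmul']
  | add z w hz hw => rw [mul_add, smul_add, hz, hw]

theorem basis_repr_mul_tmul_one {ι : Type*} (β : Module.Basis ι E B) (y : D ⊗[E] B) (x : D)
    (i : ι) : (Algebra.TensorProduct.basis D β).repr (y * x ⊗ₜ 1) i =
      (Algebra.TensorProduct.basis D β).repr y i * x := by
  induction y using TensorProduct.induction_on with
  | zero => simp
  | tmul a b => simp [Algebra.TensorProduct.basis_repr_tmul, mul_assoc, Algebra.commutes]
  | add y z hy hz => simp [add_mul, hy, hz]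

theorem exists_eq_one_tmul_of_central [Algebra.IsCentral E D] {ι : Type*} (β : Module.Basis ι E B)
    (y : D ⊗[E] B)
    (hy : ∀ i (x : D), x * (Algebra.TensorProduct.basis D β).repr y i =
      (Algebra.TensorProduct.basis D β).repr y i * x) : ∃ b : B, y = 1 ⊗ₜ b := by
  have hc : ∀ i, ∃ e : E, algebraMap E D e = (Algebra.TensorProduct.basis D β).repr y i :=
    fun i => Algebra.IsCentral.mem_center_iff E |>.1 (Subalgebra.mem_center_iff.2 (hy i)) |>.imp
      fun e he => he.symm
  choose e he using hc
  refine ⟨∑ i ∈ ((Algebra.TensorProduct.basis D β).repr y).support, e i • β i, ?_⟩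
  conv_lhs => rw [← (Algebra.TensorProduct.basis D β).linearCombination_repr y]
  rw [Finsupp.linearCombination_apply, Finsupp.sum, TensorProduct.tmul_sum]
  refine Finset.sum_congr rfl fun i _ => ?_
  rw [← he, Algebra.TensorProduct.basis_apply, algebraMap_smul, TensorProduct.tmul_smul]

/-- The tensor product of a central division algebra and a field is simple. -/
instance isSimpleRing_tensorProduct_s2 [Algebra.IsCentral E D] : IsSimpleRing (D ⊗[E] B) := by
  classical
  have key : ∀ I : TwoSidedIdeal (D ⊗[E] B), ∀ x ∈ I, x ≠ 0 → (1 : D ⊗[E] B) ∈ I := by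
    intro I
    set β := Module.Free.chooseBasis E B with hβ
    set γ := Algebra.TensorProduct.basis D β with hγ
    suffices ∀ (n : ℕ), ∀ x ∈ I, x ≠ 0 → (γ.repr x).support.card = n → (1 : D ⊗[E] B) ∈ I from
      fun x hx h0 => this _ x hx h0 rfl
    intro n
    induction n using Nat.strong_induction_on with
    | _ n ih =>
    intro x hx h0 hn
    obtain ⟨i, hi⟩ : ∃ i, γ.repr x i ≠ 0 := by
      by_contra! h
      exact h0 (γ.repr.map_eq_zero_iff.1 (Finsupp.ext h))
    set y := ((γ.repr x i)⁻¹ ⊗ₜ 1 : D ⊗[E] B) * x with hy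
    have hyI : y ∈ I := I.mul_mem_left _ _ hx
    have hyr : ∀ j, γ.repr y j = (γ.repr x i)⁻¹ * γ.repr x j := fun j => by
      rw [hy, tmul_one_mul_eq_smul]; simp
    have hyi : γ.repr y i = 1 := by rw [hyr, inv_mul_cancel₀ hi]
    by_cases hcomm : ∀ j (a : D), a * γ.repr y j = γ.repr y j * a
    · obtain ⟨b, hb⟩ := exists_eq_one_tmul_of_central β y hcomm
      have hb0 : b ≠ 0 := by
        rintro rfl
        rw [hb, TensorProduct.tmul_zero] at hyi
        simp at hyi
      have := I.mul_mem_left (1 ⊗ₜ b⁻¹) _ hyI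
      rwa [hb, Algebra.TensorProduct.tmul_mul_tmul, one_mul, inv_mul_cancel₀ hb0,
        ← Algebra.TensorProduct.one_def] at this
    · push Not at hcomm
      obtain ⟨j, a, hja⟩ := hcomm
      set z := (a ⊗ₜ 1 : D ⊗[E] B) * y - y * a ⊗ₜ 1 with hz
      have hzr : ∀ k, γ.repr z k = a * γ.repr y k - γ.repr y k * a := fun k => by
        rw [hz, tmul_one_mul_eq_smul, map_sub, Finsupp.sub_apply, basis_repr_mul_tmul_one]; simp [hγ]
      have hzI : z ∈ I := I.sub_mem (I.mul_mem_left _ _ hyI) (I.mul_mem_right _ _ hyI)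
      have hz0 : z ≠ 0 := by
        intro h
        have := hzr j
        rw [h, map_zero, Finsupp.zero_apply] at this
        exact hja (sub_eq_zero.1 this.symm)
      refine ih _ ?_ z hzI hz0 rfl
      rw [← hn]
      refine Finset.card_lt_card ((Finset.ssubset_iff_of_subset fun k hk => ?_).2
        ⟨i, Finsupp.mem_support_iff.2 hi, ?_⟩)
      · rw [Finsupp.mem_support_iff] at hk ⊢
        intro h
        apply hk
        rw [hzr, hyr, h]
        simp
      · rw [Finsupp.notMem_support_iff, hzr, hyi]
        simp
  refine ⟨⟨fun I => ?_⟩⟩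
  by_cases h : ∃ x ∈ I, x ≠ 0
  · obtain ⟨x, hx, h0⟩ := h
    exact Or.inr ((TwoSidedIdeal.one_mem_iff I).1 (key I x hx h0))
  · push Not at h
    left
    ext x
    rw [TwoSidedIdeal.mem_bot]
    exact ⟨h x, fun hx => hx ▸ I.zero_mem⟩

/-- **Skolem–Noether** for embeddings of a field into a matrix ring over a central division
algebra. -/
theorem exists_isUnit_mul_eq_mul [Algebra.IsCentral E D] [FiniteDimensional E D]
    [FiniteDimensional E B] {n : ℕ} (ρ₁ ρ₂ : B →ₐ[E] Matrix (Fin n) (Fin n) D) :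
    ∃ Y : Matrix (Fin n) (Fin n) D, IsUnit Y ∧ ∀ b, ρ₁ b * Y = Y * ρ₂ b := by
  have : IsArtinianRing (D ⊗[E] B) := IsArtinianRing.of_finite E _
  let act (ρ : B →ₐ[E] Matrix (Fin n) (Fin n) D) : B →ₐ[E] Module.End E (Fin n → D) :=
    AlgHom.ofLinearMap
      { toFun := fun b =>
          { toFun := fun v => Matrix.vecMul v (ρ b)
            map_add' := fun v w => Matrix.add_vecMul _ _ _
            map_smul' := fun e v => Matrix.smul_vecMul _ _ _ }
        map_add' := fun b b' => LinearMap.ext fun v => by simp [Matrix.vecMul_add]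
        map_smul' := fun e b => LinearMap.ext fun v => by simp [Matrix.vecMul_smul] }
      (LinearMap.ext fun v => by simp)
      (fun b b' => LinearMap.ext fun v => by simp [Matrix.vecMul_vecMul, mul_comm b b'])
  let φ (ρ : B →ₐ[E] Matrix (Fin n) (Fin n) D) : D ⊗[E] B →ₐ[E] Module.End E (Fin n → D) :=
    Algebra.TensorProduct.lift (Algebra.lsmul E E (Fin n → D)) (act ρ) (fun x b =>
      LinearMap.ext fun v => (Matrix.smul_vecMul x v (ρ b)).symm)
  have hφ : ∀ ρ x b v, φ ρ (x ⊗ₜ b) v = x • Matrix.vecMul v (ρ b) := fun ρ x b v =>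
    DFunLike.congr_fun (Algebra.TensorProduct.lift_tmul (S := E) (R := E) _ _ _ x b) v
  obtain ⟨y, hy⟩ := exists_intertwining_of_finrank_eq (φ ρ₁) (φ ρ₂) rfl
  have hyD : ∀ (x : D) v, y (x • v) = x • y v := fun x v => by
    simpa [hφ] using hy (x ⊗ₜ 1) v
  have hyB : ∀ b v, y (Matrix.vecMul v (ρ₁ b)) = Matrix.vecMul (y v) (ρ₂ b) := fun b v => by
    simpa [hφ] using hy (1 ⊗ₜ b) v
  let yl : (Fin n → D) ≃ₗ[D] (Fin n → D) := { y with map_smul' := hyD }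
  have hyl : ∀ v, Matrix.vecMul v (LinearMap.toMatrixRight' yl.toLinearMap) = y v := fun v => by
    rw [← Matrix.toLinearMapRight'_apply, LinearEquiv.symm_apply_apply]
    rfl
  have hyl' : ∀ v, Matrix.vecMul v (LinearMap.toMatrixRight' yl.symm.toLinearMap) = y.symm v :=
    fun v => by
      rw [← Matrix.toLinearMapRight'_apply, LinearEquiv.symm_apply_apply]
      rfl
  have hext : ∀ P Q : Matrix (Fin n) (Fin n) D, (∀ v, Matrix.vecMul v P = Matrix.vecMul v Q) →
      P = Q := fun P Q h => by
    ext i j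
    simpa using congrFun (h (Pi.single i 1)) j
  refine ⟨LinearMap.toMatrixRight' yl.toLinearMap, ?_, fun b => hext _ _ fun v => ?_⟩
  · refine ⟨⟨_, LinearMap.toMatrixRight' yl.symm.toLinearMap, hext _ _ fun v => ?_,
      hext _ _ fun v => ?_⟩, rfl⟩
    · rw [← Matrix.vecMul_vecMul, hyl, hyl', Matrix.vecMul_one, y.symm_apply_apply]
    · rw [← Matrix.vecMul_vecMul, hyl', hyl, Matrix.vecMul_one, y.apply_symm_apply]
  · rw [← Matrix.vecMul_vecMul, ← Matrix.vecMul_vecMul, hyl, hyl, hyB]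

end SkolemNoether

section Regular

variable {E D M Γ : Type*} [Field E] [DivisionRing D] [Algebra E D] [Algebra.IsCentral E D]
  [FiniteDimensional E D] [Field M] [Algebra E M] [FiniteDimensional E M] [CommGroupWithZero Γ]

theorem Algebra.leftMulMatrix_algebraMap_eq_scalar {R S ι : Type*} [CommRing R] [CommRing S]
    [Algebra R S] [Fintype ι] [DecidableEq ι] (β : Module.Basis ι R S) (r : R) :
    Algebra.leftMulMatrix β (algebraMap R S r) = Matrix.scalar ι r := by
  rw [AlgHom.commutes]
  rfl

theorem map_pow_finrank_eq_map_norm (χ : D →*₀ Γ) (ν : M →ₐ[E] D) {x : M} (hx : x ≠ 0) :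
    χ (ν x) ^ Module.finrank E M = χ (algebraMap E D (Algebra.norm E x)) := by
  set β := Module.finBasis E M
  obtain ⟨Y, hY, h⟩ := exists_isUnit_mul_eq_mul
    ((Algebra.ofId E D).mapMatrix.comp (Algebra.leftMulMatrix β))
    ((Matrix.scalarAlgHom (Fin (Module.finrank E M)) E).comp ν)
  rw [Algebra.norm_eq_matrix_det β]
  exact map_pow_eq_map_det_of_conj χ (algebraMap E D) (ν x)
    ((IsUnit.mk0 x hx).map (Algebra.leftMulMatrix β)) hY (h x).symm

theorem map_pow_finrank_eq_one_of_hilbert90 (χ : D →*₀ Γ) (ν : M →ₐ[E] D) {Ω : Type*} [Field Ω]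
    [Algebra E Ω] [Algebra M Ω] [IsScalarTower E M Ω] [FiniteDimensional M Ω] (σ : Ω →ₐ[E] Ω)
    {a : M} {x : Ω} (hx : x ≠ 0) (h : algebraMap M Ω a * σ x = x) :
    χ (ν a) ^ Module.finrank M Ω = 1 := by
  have : FiniteDimensional E Ω := FiniteDimensional.trans E M Ω
  set β := Module.finBasis M Ω
  set ρ : Ω →ₐ[E] Matrix (Fin (Module.finrank M Ω)) (Fin (Module.finrank M Ω)) D :=
    ν.mapMatrix.comp ((Algebra.leftMulMatrix β).restrictScalars E) with hρ
  obtain ⟨Y, hY, hconj⟩ := exists_isUnit_mul_eq_mul ρ (ρ.comp σ)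
  have hσx : σ x ≠ 0 := (map_ne_zero σ).2 hx
  refine map_pow_eq_one_of_conj χ (ν a) ((IsUnit.mk0 x hx).map ρ) ((IsUnit.mk0 _ hσx).map ρ) hY ?_
    (hconj x).symm
  conv_rhs => rw [← h, map_mul]
  congr 1
  simp only [hρ, AlgHom.comp_apply, AlgHom.restrictScalars_apply,
    Algebra.leftMulMatrix_algebraMap_eq_scalar, AlgHom.mapMatrix_apply]
  ext i j
  simp [Matrix.diagonal_apply, apply_ite ν]

end Regular

section PrimeDegree

open Polynomial

/-- **Hilbert 90** for an automorphism of finite order. -/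
theorem exists_ne_zero_mul_apply_eq_self {E Ω : Type*} [Field E] [Field Ω] [Algebra E Ω]
    (σ : Ω ≃ₐ[E] Ω) (a : Ω) (hpos : 0 < orderOf σ)
    (ha : ∏ k ∈ Finset.range (orderOf σ), (σ ^ k) a = 1) : ∃ x ≠ 0, a * σ x = x := by
  set c : ℕ → Ω := fun k => ∏ j ∈ Finset.range k, (σ ^ j) a with hc
  have hcs : ∀ k, a * σ (c k) = c (k + 1) := fun k => by
    simp only [hc]
    rw [Finset.prod_range_succ', map_prod, mul_comm]
    simp [pow_succ']
  obtain ⟨y, hy⟩ : ∃ y, ∑ k ∈ Finset.range (orderOf σ), c k * (σ ^ k) y ≠ 0 := by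
    by_contra! h
    have hli := (linearIndependent_monoidHom Ω Ω).comp
      (fun k : Fin (orderOf σ) => ((σ ^ (k : ℕ) : Ω ≃ₐ[E] Ω) : Ω →* Ω)) (fun k l hkl => by
        refine Fin.ext (pow_injOn_Iio_orderOf k.2 l.2 (AlgEquiv.ext fun z => ?_))
        exact DFunLike.congr_fun hkl z)
    have := Fintype.linearIndependent_iff.1 hli (fun k => c k) (by
      ext y
      rw [Finset.sum_apply]
      refine Eq.trans ?_ (h y)
      rw [Finset.sum_range]
      rfl) ⟨0, hpos⟩
    simp [hc] at this
  refine ⟨_, hy, ?_⟩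
  obtain ⟨m, hm⟩ := Nat.exists_eq_add_one.2 hpos
  have hlast : c (m + 1) * (σ ^ (m + 1)) y = c 0 * (σ ^ 0) y := by
    rw [← hm, pow_orderOf_eq_one, pow_zero]
    simp only [hc, ha, Finset.prod_range_zero]
  rw [map_sum, Finset.mul_sum, hm]
  simp_rw [map_mul, ← mul_assoc, hcs, ← AlgEquiv.mul_apply, ← pow_succ']
  rw [Finset.sum_range_succ, Finset.sum_range_succ', hlast]

variable {E M Ω : Type*} [Field E] [Field M] [Algebra E M] [FiniteDimensional E M] [Field Ω]
  [Algebra E Ω]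

theorem prod_pow_apply_eq_norm [Algebra.IsSeparable E M] [FiniteDimensional E Ω] [IsGalois E Ω]
    [Algebra M Ω] [IsScalarTower E M Ω] (hM : (Module.finrank E M).Prime)
    (h : ¬ Module.finrank E M ∣ Module.finrank M Ω) (σ : Ω ≃ₐ[E] Ω)
    (hσ : orderOf σ = Module.finrank E M) (a : M) :
    ∏ k ∈ Finset.range (Module.finrank E M), (σ ^ k) (algebraMap M Ω a) =
      algebraMap E Ω (Algebra.norm E a) := by
  have : FiniteDimensional M Ω := FiniteDimensional.right E M Ω
  have : IsGalois M Ω := IsGalois.tower_top_of_isGalois E M Ω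
  set ℓ := Module.finrank E M with hℓ
  set i : M →ₐ[E] Ω := IsScalarTower.toAlgHom E M Ω
  set j : Ω →ₐ[E] AlgebraicClosure Ω := IsScalarTower.toAlgHom E Ω (AlgebraicClosure Ω) with hj
  let φ : Fin ℓ → (M →ₐ[E] AlgebraicClosure Ω) := fun k =>
    j.comp (((σ ^ (k : ℕ) : Ω ≃ₐ[E] Ω) : Ω →ₐ[E] Ω).comp i)
  have hfix : ∀ n : ℕ, (∀ z, (σ ^ n) (i z) = i z) → σ ^ n = 1 := by
    intro n hn
    by_contra hne
    have hord : orderOf (σ ^ n) = ℓ := by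
      have h1 : orderOf (σ ^ n) ∣ ℓ := hσ ▸ orderOf_pow_dvd n
      exact ((Nat.dvd_prime hM).1 h1).resolve_left fun h => hne (orderOf_eq_one_iff.1 h)
    let τ : Ω ≃ₐ[M] Ω := AlgEquiv.ofRingEquiv (f := (σ ^ n).toRingEquiv) hn
    have hτ : ∀ k z, (τ ^ k) z = ((σ ^ n) ^ k) z := by
      intro k
      induction k with
      | zero => intro z; simp
      | succ k ih => intro z; rw [pow_succ', pow_succ', AlgEquiv.mul_apply, ih]; rfl
    have hτo : orderOf τ = ℓ := by
      rw [← hord]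
      refine orderOf_eq_orderOf_iff.2 fun k => ⟨fun hk => AlgEquiv.ext fun z => ?_,
        fun hk => AlgEquiv.ext fun z => ?_⟩
      · rw [← hτ, hk]; rfl
      · rw [hτ, hk]; rfl
    exact h (by rw [← hτo, ← IsGalois.card_aut_eq_finrank M Ω]; exact orderOf_dvd_natCard τ)
  have hlt : ∀ k l : Fin ℓ, k ≤ l → φ k = φ l → k = l := by
    intro k l hkl h
    have h1 : σ ^ ((l : ℕ) - k) = 1 := hfix _ fun z => by
      have h2 : (σ ^ (k : ℕ)) (i z) = (σ ^ (l : ℕ)) (i z) :=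
        j.injective (DFunLike.congr_fun h z)
      apply (σ ^ (k : ℕ)).injective
      rw [h2, ← AlgEquiv.mul_apply, ← pow_add, Nat.add_sub_cancel' hkl]
    have h2 := orderOf_dvd_of_pow_eq_one h1
    rw [hσ] at h2
    have h3 := Nat.eq_zero_of_dvd_of_lt h2 (by omega)
    exact Fin.ext (by have : (k : ℕ) ≤ l := hkl; omega)
  have hinj : Function.Injective φ := fun k l h => by
    rcases le_total k l with hkl | hkl
    · exact hlt k l hkl h
    · exact (hlt l k hkl h.symm).symm
  have hbij : Function.Bijective φ := (Fintype.bijective_iff_injective_and_card φ).2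
    ⟨hinj, by rw [Fintype.card_fin, AlgHom.card]⟩
  refine j.injective (?_ : j _ = j _)
  rw [map_prod, AlgHom.commutes,
    Algebra.norm_eq_prod_embeddings E (AlgebraicClosure Ω) a, ← hbij.prod_comp,
    Finset.prod_range fun k => j ((σ ^ k) (algebraMap M Ω a))]
  rfl

theorem not_prime_sq_dvd_factorial {ℓ : ℕ} (h : ℓ.Prime) : ¬ ℓ ^ 2 ∣ ℓ.factorial := by
  obtain ⟨m, rfl⟩ := Nat.exists_eq_add_one.2 h.pos
  rw [Nat.factorial_succ, sq, Nat.mul_dvd_mul_iff_left h.pos, h.dvd_factorial]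
  omega

variable {D Γ : Type*} [DivisionRing D] [Algebra E D] [Algebra.IsCentral E D]
  [FiniteDimensional E D] [CommGroupWithZero Γ]

theorem map_eq_one_of_norm_eq_one_of_isSeparable [Algebra.IsSeparable E M]
    (hM : (Module.finrank E M).Prime) (χ : D →*₀ Γ) (ν : M →ₐ[E] D) {a : M}
    (ha : Algebra.norm E a = 1) : χ (ν a) = 1 := by
  set ℓ := Module.finrank E M with hℓ
  have ha0 : a ≠ 0 := by
    rintro rfl
    rw [Algebra.norm_zero] at ha
    exact zero_ne_one ha
  have h1 : χ (ν a) ^ ℓ = 1 := by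
    rw [map_pow_finrank_eq_map_norm χ ν ha0, ha, map_one, map_one]
  let pb := Field.powerBasisOfFiniteOfSeparable E M
  let p := minpoly E pb.gen
  let Ω := p.SplittingField
  have hpi : Irreducible p := minpoly.irreducible pb.isIntegral_gen
  have hps : p.Separable := Algebra.IsSeparable.isSeparable E pb.gen
  have hpd : p.natDegree = ℓ := by rw [hℓ, pb.finrank, pb.natDegree_minpoly]
  have hG : IsGalois E Ω := IsGalois.of_separable_splitting_field hps
  obtain ⟨r, hr⟩ := (SplittingField.splits p).exists_eval_eq_zero (by
    rw [degree_map]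
    exact (degree_pos_of_irreducible hpi).ne')
  rw [eval_map_algebraMap] at hr
  let _ : Algebra M Ω := (pb.lift r hr).toAlgebra
  have : IsScalarTower E M Ω := IsScalarTower.of_algebraMap_eq fun e =>
    ((pb.lift r hr).commutes e).symm
  have : FiniteDimensional M Ω := FiniteDimensional.right E M Ω
  have hmul : ℓ * Module.finrank M Ω = Module.finrank E Ω := Module.finrank_mul_finrank E M Ω
  have hdvd : Module.finrank E Ω ∣ ℓ.factorial := by
    classical
    have : Fact ((p.map (algebraMap E Ω)).Splits) := ⟨SplittingField.splits p⟩
    rw [← Gal.card_of_separable hps, ← hpd,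
      ← card_rootSet_eq_natDegree hps (SplittingField.splits p),
      ← Fintype.card_perm, ← Nat.card_eq_fintype_card]
    exact Subgroup.card_dvd_of_injective _ (Gal.galActionHom_injective p Ω)
  have hndvd : ¬ ℓ ∣ Module.finrank M Ω := fun h => not_prime_sq_dvd_factorial hM
    ((by rw [sq, ← hmul]; exact Nat.mul_dvd_mul_left _ h : ℓ ^ 2 ∣ _).trans hdvd)
  have : Fact ℓ.Prime := ⟨hM⟩
  obtain ⟨σ, hσ⟩ := exists_prime_orderOf_dvd_card' (G := Ω ≃ₐ[E] Ω) ℓ (by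
    rw [IsGalois.card_aut_eq_finrank, ← hmul]
    exact Nat.dvd_mul_right _ _)
  obtain ⟨x, hx, hax⟩ := exists_ne_zero_mul_apply_eq_self σ (algebraMap M Ω a)
    (by rw [hσ]; exact hM.pos)
    (by rw [hσ, prod_pow_apply_eq_norm hM hndvd σ hσ, ha, map_one])
  have h2 := map_pow_finrank_eq_one_of_hilbert90 χ ν (σ : Ω →ₐ[E] Ω) hx hax
  have := Nat.dvd_gcd (orderOf_dvd_of_pow_eq_one h1) (orderOf_dvd_of_pow_eq_one h2)
  rwa [((Nat.Prime.coprime_iff_not_dvd hM).2 hndvd).gcd_eq_one, Nat.dvd_one,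
    orderOf_eq_one_iff] at this

theorem eq_one_of_norm_eq_one_of_isPurelyInseparable [IsPurelyInseparable E M]
    {a : M} (ha : Algebra.norm E a = 1) : a = 1 := by
  obtain ⟨q, hq⟩ := ExpChar.exists E
  have hqM : ExpChar M q := expChar_of_injective_algebraMap (algebraMap E M).injective q
  obtain ⟨k, hk⟩ := IsPurelyInseparable.finrank_eq_pow (F := E) M q
  obtain ⟨n, e, he⟩ := (isPurelyInseparable_iff_pow_mem E q).1 ‹_› a
  have h1 : (1 : M) = (a ^ q ^ n) ^ Module.finrank E M := by
    rw [← he, ← map_pow, ← Algebra.norm_algebraMap (S := M), he, map_pow, ha, one_pow, map_one]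
  rw [hk, ← pow_mul, ← pow_add] at h1
  refine iterateFrobenius_inj M q (n + k) ?_
  rw [iterateFrobenius_def, iterateFrobenius_def, one_pow, ← h1]

/-- **Wang's theorem** in prime degree, for elements of a maximal subfield. -/
theorem map_eq_one_of_norm_eq_one (hM : (Module.finrank E M).Prime) (χ : D →*₀ Γ) (ν : M →ₐ[E] D)
    {a : M} (ha : Algebra.norm E a = 1) : χ (ν a) = 1 := by
  rcases (Nat.dvd_prime hM).1 (Field.finSepDegree_dvd_finrank E M) with h | h
  · have : IsPurelyInseparable E M := isPurelyInseparable_of_finSepDegree_eq_one h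
    rw [eq_one_of_norm_eq_one_of_isPurelyInseparable ha, map_one, map_one]
  · have := (Field.finSepDegree_eq_finrank_iff E M).1 h
    exact map_eq_one_of_norm_eq_one_of_isSeparable hM χ ν ha

end PrimeDegree

section ReducedNorm

open Polynomial
open scoped TensorProduct

variable {E D M : Type*} [Field E] [DivisionRing D] [Algebra E D] [Field M] [Algebra E M]
  {ℓ : ℕ}

theorem exists_algHom_matrix (hℓ : 0 < ℓ) (hD : Module.finrank E D = ℓ ^ 2)
    (hM : Module.finrank E M = ℓ) (ν : M →ₐ[E] D) :
    Nonempty (D →ₐ[E] Matrix (Fin ℓ) (Fin ℓ) M) := by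
  have hfin : FiniteDimensional E D := .of_finrank_pos (by rw [hD]; exact pow_pos hℓ 2)
  let _ : Module M D :=
    { smul m d := d * ν m
      one_smul d := show d * ν 1 = d by rw [map_one, mul_one]
      mul_smul m n d := show d * ν (m * n) = d * ν n * ν m by rw [mul_comm, map_mul, mul_assoc]
      smul_zero m := zero_mul _
      smul_add m d d' := add_mul _ _ _
      add_smul m n d := show d * ν (m + n) = d * ν m + d * ν n by rw [map_add, mul_add]
      zero_smul d := show d * ν 0 = 0 by rw [map_zero, mul_zero] }
  have hsm : ∀ (m : M) (d : D), m • d = d * ν m := fun _ _ => rfl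
  have : IsScalarTower E M D := ⟨fun e m d => by
    rw [hsm, hsm, map_smul, mul_smul_comm]⟩
  have : FiniteDimensional M D := Module.Finite.of_restrictScalars_finite E M D
  have hr : Module.finrank M D = ℓ := by
    have := Module.finrank_mul_finrank E M D
    rw [hM, hD, sq] at this
    exact Nat.eq_of_mul_eq_mul_left hℓ this
  let β : Module.Basis (Fin ℓ) M D := Module.finBasisOfFinrankEq M D hr
  let lm : D →ₐ[E] Module.End M D := AlgHom.ofLinearMap
    { toFun d :=
        { toFun x := d * x
          map_add' := mul_add d
          map_smul' m x := by rw [hsm, hsm, mul_assoc]; rfl }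
      map_add' d d' := LinearMap.ext fun x => add_mul d d' x
      map_smul' e d := LinearMap.ext fun x => smul_mul_assoc e d x }
    (LinearMap.ext fun x => one_mul x) (fun d d' => LinearMap.ext fun x => mul_assoc d d' x)
  exact ⟨((LinearMap.toMatrixAlgEquiv β).toAlgHom.restrictScalars E).comp lm⟩

/-- The embedding of `E[w]` in `D`. -/
noncomputable def adjoinRootMinpolyHom (w : D) : AdjoinRoot (minpoly E w) →ₐ[E] D :=
  Ideal.Quotient.liftₐ _ (aeval w) fun a ha => by
    obtain ⟨q, rfl⟩ := Ideal.mem_span_singleton.1 ha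
    rw [map_mul, minpoly.aeval, zero_mul]

theorem adjoinRootMinpolyHom_root (w : D) :
    adjoinRootMinpolyHom (E := E) w (AdjoinRoot.root _) = w :=
  (Ideal.Quotient.lift_mk _ _ _).trans (aeval_X w)

variable [Algebra.IsCentral E D]

/-- A noncentral element of a central division algebra of prime degree has degree that prime. -/
theorem natDegree_minpoly_eq_of_notMem_range (hℓ : ℓ.Prime) (hD : Module.finrank E D = ℓ ^ 2)
    {w : D} (hw : w ∉ (algebraMap E D).range) : (minpoly E w).natDegree = ℓ := by
  have hfin : FiniteDimensional E D := .of_finrank_pos (by rw [hD]; exact pow_pos hℓ.pos 2)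
  have hint : IsIntegral E w := Algebra.IsIntegral.isIntegral w
  have hirr : Fact (Irreducible (minpoly E w)) := ⟨minpoly.irreducible hint⟩
  have hne : minpoly E w ≠ 0 := minpoly.ne_zero hint
  let φ : AdjoinRoot (minpoly E w) →ₐ[E] D := adjoinRootMinpolyHom w
  have hdeg : Module.finrank E (AdjoinRoot (minpoly E w)) = (minpoly E w).natDegree := by
    rw [(AdjoinRoot.powerBasis hne).finrank, AdjoinRoot.powerBasis_dim]
  have hdvd : (minpoly E w).natDegree ∣ ℓ ^ 2 := by
    let _ : Module (AdjoinRoot (minpoly E w)) D := Module.compHom D φ.toRingHom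
    have : IsScalarTower E (AdjoinRoot (minpoly E w)) D := ⟨fun e x d => by
      change φ (e • x) * d = e • (φ x * d)
      rw [map_smul, smul_mul_assoc]⟩
    rw [← hdeg, ← hD, ← Module.finrank_mul_finrank E (AdjoinRoot (minpoly E w)) D]
    exact Nat.dvd_mul_right _ _
  obtain ⟨k, hk, hkd⟩ := (Nat.dvd_prime_pow hℓ).1 hdvd
  interval_cases k
  · exact absurd (minpoly.natDegree_eq_one_iff.1 hkd) hw
  · rwa [pow_one] at hkd
  · exfalso
    have : FiniteDimensional E (AdjoinRoot (minpoly E w)) :=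
      (AdjoinRoot.powerBasis hne).finite
    have hsurj : Function.Surjective φ :=
      (LinearMap.injective_iff_surjective_of_finrank_eq_finrank (f := φ.toLinearMap)
        (by rw [hdeg, hkd, hD])).1 φ.toRingHom.injective
    refine hw ?_
    obtain ⟨e, he⟩ := Algebra.IsCentral.mem_center_iff E |>.1 (Subalgebra.mem_center_iff.2
      fun d => by
        obtain ⟨x, rfl⟩ := hsurj d
        obtain ⟨y, hy⟩ := hsurj w
        have := congrArg φ (mul_comm x y)
        rwa [map_mul, map_mul, hy] at this : w ∈ Subalgebra.center E D)
    exact ⟨e, he.symm⟩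

theorem linearIndependent_map_of_central {ι κ : Type*} [Fintype κ] [DecidableEq κ] [Nonempty κ]
    (ψ : D →ₐ[E] Matrix κ κ M) {v : ι → D} (hv : LinearIndependent E v) :
    LinearIndependent M fun i => ψ (v i) := by
  have hc : ∀ m d, Commute (Algebra.ofId M (Matrix κ κ M) m) (ψ d) := fun m d =>
    Algebra.commutes m (ψ d)
  let φ : M ⊗[E] D →ₐ[M] Matrix κ κ M :=
    Algebra.TensorProduct.lift (Algebra.ofId M _) ψ hc
  have hφ : Function.Injective φ := by
    have h : Function.Injective
        ((φ : M ⊗[E] D →+* Matrix κ κ M).comp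
          (Algebra.TensorProduct.comm E D M : D ⊗[E] M →+* M ⊗[E] D)) := RingHom.injective _
    exact (Function.Injective.of_comp_iff' φ (Algebra.TensorProduct.comm E D M).bijective).1 h
  have hlift : ∀ d, φ (1 ⊗ₜ[E] d) = ψ d := fun d =>
    (Algebra.TensorProduct.lift_tmul _ _ hc 1 d).trans (by rw [map_one, one_mul])
  clear_value φ
  rw [show (fun i => ψ (v i)) = φ.toLinearMap ∘ fun i => 1 ⊗ₜ[E] v i from
    funext fun i => (hlift (v i)).symm]
  have h := Module.Flat.linearIndependent_one_tmul (S := M) hv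
  exact h.map' φ.toLinearMap (LinearMap.ker_eq_bot.2 hφ)

theorem charpoly_eq_map_of_aeval_eq_zero (hℓ : ℓ.Prime) (hD : Module.finrank E D = ℓ ^ 2)
    (ψ : D →ₐ[E] Matrix (Fin ℓ) (Fin ℓ) M) {w : D} (hw : w ∉ (algebraMap E D).range) {P : E[X]}
    (hP : P.Monic) (hPd : P.natDegree = ℓ) (hPw : aeval w P = 0) :
    (ψ w).charpoly = P.map (algebraMap E M) := by
  have : Nonempty (Fin ℓ) := ⟨0, hℓ.pos⟩
  have hli := linearIndependent_map_of_central ψ (linearIndependent_pow (K := E) w)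
  rw [natDegree_minpoly_eq_of_notMem_range hℓ hD hw] at hli
  have hQd : (ψ w).charpoly.natDegree = ℓ := by simp [Matrix.charpoly_natDegree_eq_dim]
  set R := (ψ w).charpoly - P.map (algebraMap E M) with hR
  have hRd : R.degree < ℓ := by
    have := degree_sub_lt_left (p := (ψ w).charpoly) (q := P.map (algebraMap E M)) (by
      rw [degree_map, degree_eq_natDegree (ψ w).charpoly_monic.ne_zero, hQd,
        degree_eq_natDegree hP.ne_zero, hPd]) (ψ w).charpoly_monic.ne_zero (by
      rw [(ψ w).charpoly_monic.leadingCoeff, (hP.map _).leadingCoeff])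
    rwa [degree_eq_natDegree (ψ w).charpoly_monic.ne_zero, hQd] at this
  have hR0 : aeval (ψ w) R = 0 := by
    rw [hR, map_sub, Matrix.aeval_self_charpoly, aeval_map_algebraMap, aeval_algHom_apply, hPw,
      map_zero, sub_zero]
  rcases eq_or_ne R 0 with h | h
  · exact sub_eq_zero.1 h
  exfalso
  rw [aeval_eq_sum_range' ((natDegree_lt_iff_degree_lt h).2 hRd), Finset.sum_range] at hR0
  simp only [map_pow] at hli
  have := Fintype.linearIndependent_iff.1 hli (fun i => R.coeff i) hR0
  refine h (Polynomial.ext fun i => ?_)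
  rcases lt_or_ge i ℓ with hi | hi
  · exact this ⟨i, hi⟩
  · exact coeff_eq_zero_of_degree_lt (hRd.trans_le (by exact_mod_cast hi))

/-- The reduced norm of an element of a maximal subfield, for an embedding that may twist the
base field. -/
theorem det_map_eq_norm (hℓ : ℓ.Prime) (hD : Module.finrank E D = ℓ ^ 2)
    (ψ : D →ₐ[E] Matrix (Fin ℓ) (Fin ℓ) M) {L : Type*} [Field L] [Algebra E L]
    (hL : Module.finrank E L = ℓ) {σ : E →+* E} (hσ : Function.Surjective σ) (ν : L →+* D)
    (hν : ∀ e, ν (algebraMap E L e) = algebraMap E D (σ e)) (x : L) :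
    (ψ (ν x)).det = algebraMap E M (σ (Algebra.norm E x)) := by
  by_cases hx : ν x ∈ (algebraMap E D).range
  · obtain ⟨e', he'⟩ := hx
    obtain ⟨e, rfl⟩ := hσ e'
    obtain rfl : algebraMap E L e = x := ν.injective ((hν e).trans he')
    rw [hν, AlgHom.commutes, Algebra.norm_algebraMap, hL, map_pow, map_pow,
      Matrix.algebraMap_eq_diagonal, Matrix.det_diagonal]
    simp
  · have hfin : FiniteDimensional E L := .of_finrank_pos (hL ▸ hℓ.pos)
    let β := Module.finBasisOfFinrankEq E L hL
    have h0 : aeval x (Algebra.leftMulMatrix β x).charpoly = 0 := by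
      apply Algebra.leftMulMatrix_injective β
      rw [← aeval_algHom_apply, Matrix.aeval_self_charpoly, map_zero]
    have h := charpoly_eq_map_of_aeval_eq_zero hℓ hD ψ hx
      ((Algebra.leftMulMatrix β x).charpoly_monic.map σ)
      (by rw [natDegree_map, Matrix.charpoly_natDegree_eq_dim, Fintype.card_fin]) (by
        have hc : (algebraMap E D).comp σ = ν.comp (algebraMap E L) :=
          RingHom.ext fun e => (hν e).symm
        rw [aeval_def, eval₂_map, hc, ← hom_eval₂, ← aeval_def, h0, map_zero])
    rw [Matrix.det_eq_sign_charpoly_coeff, h, coeff_map, coeff_map, Algebra.norm_eq_matrix_det β,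
      Matrix.det_eq_sign_charpoly_coeff]
    simp

/-- An element of a maximal subfield of reduced norm one is killed by every character. -/
theorem map_eq_one_of_det_map_eq_one {Γ : Type*} [CommGroupWithZero Γ] (hℓ : ℓ.Prime)
    (hD : Module.finrank E D = ℓ ^ 2) (ψ : D →ₐ[E] Matrix (Fin ℓ) (Fin ℓ) M) (χ : D →*₀ Γ)
    {L : Type*} [Field L] [Algebra E L] (hL : Module.finrank E L = ℓ) (ν : L →ₐ[E] D) {x : L}
    (hx : (ψ (ν x)).det = 1) : χ (ν x) = 1 := by
  have : FiniteDimensional E D := .of_finrank_pos (by rw [hD]; exact pow_pos hℓ.pos 2)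
  have : FiniteDimensional E L := .of_finrank_pos (hL ▸ hℓ.pos)
  refine map_eq_one_of_norm_eq_one (hL.symm ▸ hℓ) χ ν ((algebraMap E M).injective ?_)
  rw [map_one, ← hx]
  exact (det_map_eq_norm hℓ hD ψ hL (σ := RingHom.id E) Function.surjective_id
    (ν : L →+* D) ν.commutes x).symm

/-- **Wang's theorem** in prime degree: an element of reduced norm one is killed by every
character. -/
theorem map_eq_one_of_det_eq_one {Γ : Type*} [CommGroupWithZero Γ] (hℓ : ℓ.Prime)
    (hD : Module.finrank E D = ℓ ^ 2) (hM : Module.finrank E M = ℓ) (ν : M →ₐ[E] D)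
    (ψ : D →ₐ[E] Matrix (Fin ℓ) (Fin ℓ) M) (χ : D →*₀ Γ) {w : D} (hw : (ψ w).det = 1) :
    χ w = 1 := by
  by_cases hwE : w ∈ (algebraMap E D).range
  · obtain ⟨e, rfl⟩ := hwE
    rw [← ν.commutes e] at hw ⊢
    exact map_eq_one_of_det_map_eq_one hℓ hD ψ χ hM ν hw
  · have hfin : FiniteDimensional E D := .of_finrank_pos (by rw [hD]; exact pow_pos hℓ.pos 2)
    have hint : IsIntegral E w := Algebra.IsIntegral.isIntegral w
    have : Fact (Irreducible (minpoly E w)) := ⟨minpoly.irreducible hint⟩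
    have hL : Module.finrank E (AdjoinRoot (minpoly E w)) = ℓ := by
      rw [(AdjoinRoot.powerBasis (minpoly.ne_zero hint)).finrank, AdjoinRoot.powerBasis_dim,
        natDegree_minpoly_eq_of_notMem_range hℓ hD hwE]
    have := map_eq_one_of_det_map_eq_one hℓ hD ψ χ hL (adjoinRootMinpolyHom w)
      (x := AdjoinRoot.root _)
    rw [adjoinRootMinpolyHom_root] at this
    exact this hw

end ReducedNorm

section Centralizer

open scoped TensorProduct

variable {N D E : Type*} [Field N] [DivisionRing D] [Algebra N D] [Field E] [Algebra N E]

/-- The action of `D ⊗ E` on `D`, with `D` acting on the left and `E` on the right via `ι`. -/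
noncomputable def bimoduleAction (ι : E →ₐ[N] D) : D ⊗[N] E →ₐ[N] Module.End N D :=
  Algebra.TensorProduct.lift (Algebra.lmul N D)
    (AlgHom.ofLinearMap ((LinearMap.mul N D).flip.comp ι.toLinearMap)
      (LinearMap.ext fun v => by simp)
      (fun e e' => LinearMap.ext fun v => by simp [mul_comm e e', mul_assoc]))
    (fun x e => LinearMap.ext fun v => (mul_assoc x v (ι e)).symm)

theorem bimoduleAction_tmul (ι : E →ₐ[N] D) (x : D) (e : E) (v : D) :
    bimoduleAction ι (x ⊗ₜ e) v = x * (v * ι e) :=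
  DFunLike.congr_fun (Algebra.TensorProduct.lift_tmul (S := N) (R := N) _ _ _ x e) v

/-- `D` as a module over `D ⊗ E`. -/
noncomputable abbrev bimodule (ι : E →ₐ[N] D) : Module (D ⊗[N] E) D :=
  Module.compHom D (bimoduleAction ι).toRingHom

theorem bimodule_tmul_smul (ι : E →ₐ[N] D) (x : D) (e : E) (v : D) :
    letI := bimodule ι
    (x ⊗ₜ[N] e : D ⊗[N] E) • v = x * (v * ι e) :=
  bimoduleAction_tmul ι x e v

theorem bimodule_isScalarTower (ι : E →ₐ[N] D) :
    letI := bimodule ι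
    IsScalarTower N (D ⊗[N] E) D :=
  letI := bimodule ι
  ⟨fun a r v => by
    change bimoduleAction ι (a • r) v = a • bimoduleAction ι r v
    rw [map_smul]
    rfl⟩

theorem bimodule_smulCommClass (ι : E →ₐ[N] D) :
    letI := bimodule ι
    SMulCommClass (D ⊗[N] E) N D :=
  letI := bimodule ι
  ⟨fun r a v => (bimoduleAction ι r).map_smul a v⟩

theorem exists_bimodule_equiv [Algebra.IsCentral N D] [FiniteDimensional N D]
    [FiniteDimensional N E] (ι : E →ₐ[N] D) :
    letI := bimodule ι
    Nonempty ((D ⊗[N] E) ≃ₗ[D ⊗[N] E] (Fin (Module.finrank N E) → D)) := by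
  let _ := bimodule ι
  have := bimodule_isScalarTower ι
  have : IsArtinianRing (D ⊗[N] E) := IsArtinianRing.of_finite N _
  refine exists_linearEquiv_of_finrank_eq (E := N) ?_
  rw [Module.finrank_tensorProduct, Module.finrank_pi_fintype, Finset.sum_const, Finset.card_univ,
    Fintype.card_fin, smul_eq_mul, mul_comm]

/-- Endomorphisms of the bimodule `D` are right multiplications by the centralizer of `E`. -/
noncomputable def bimoduleEndEquiv (ι : E →ₐ[N] D) :
    letI := bimodule ι
    haveI := bimodule_smulCommClass ι
    (D →ₗ[D ⊗[N] E] D) ≃ₗ[N] Subalgebra.centralizer N (Set.range ι) :=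
  letI := bimodule ι
  haveI := bimodule_smulCommClass ι
  have hr : ∀ (f : D →ₗ[D ⊗[N] E] D) v, f v = v * f 1 := fun f v => by
    have := f.map_smul (v ⊗ₜ 1) 1
    rwa [bimodule_tmul_smul, bimodule_tmul_smul, map_one, mul_one, mul_one, mul_one] at this
  { toFun f := ⟨f 1, by
      rintro _ ⟨e, rfl⟩
      have := f.map_smul (1 ⊗ₜ e) 1
      rwa [bimodule_tmul_smul, bimodule_tmul_smul, one_mul, one_mul, one_mul, hr] at this⟩
    map_add' f g := rfl
    map_smul' a f := rfl
    invFun z :=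
      { toFun v := v * z
        map_add' v w := add_mul v w _
        map_smul' r v := by
          change bimoduleAction ι r v * z = bimoduleAction ι r (v * z)
          induction r using TensorProduct.induction_on with
          | zero => simp
          | add r s hr hs => rw [map_add, LinearMap.add_apply, LinearMap.add_apply, add_mul, hr, hs]
          | tmul x e =>
            rw [bimoduleAction_tmul, bimoduleAction_tmul, mul_assoc, mul_assoc, mul_assoc,
              z.2 (ι e) ⟨e, rfl⟩] }
    left_inv f := LinearMap.ext fun v => (hr f v).symm
    right_inv z := Subtype.ext (one_mul _) }

theorem finrank_centralizer_mul_finrank_s2 [Algebra.IsCentral N D] [FiniteDimensional N D]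
    [FiniteDimensional N E] (ι : E →ₐ[N] D) :
    Module.finrank N E * Module.finrank N (Subalgebra.centralizer N (Set.range ι)) =
      Module.finrank N D := by
  let _ := bimodule ι
  have := bimodule_smulCommClass ι
  obtain ⟨y⟩ := exists_bimodule_equiv ι
  have h₁ := (LinearMap.ringLmapEquivSelf (D ⊗[N] E) N D).finrank_eq
  have h₂ := (LinearMap.lsum (D ⊗[N] E) (fun _ : Fin (Module.finrank N E) => D) N (M := D)).finrank_eq
  have h₃ : Module.finrank N ((Fin (Module.finrank N E) → D) →ₗ[D ⊗[N] E] D) =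
      Module.finrank N ((D ⊗[N] E) →ₗ[D ⊗[N] E] D) :=
    LinearEquiv.finrank_eq (LinearEquiv.congrLeft D N y.symm)
  have h₄ := (bimoduleEndEquiv ι).finrank_eq
  rw [← h₁, ← h₃, ← h₂, ← h₄]
  have : Module.Finite N (D →ₗ[D ⊗[N] E] D) := Module.Finite.equiv (bimoduleEndEquiv ι).symm
  rw [Module.finrank_pi_fintype, Finset.sum_const, Finset.card_univ, Fintype.card_fin, smul_eq_mul]

theorem mem_range_of_mem_centralizer_of_commute [Algebra.IsCentral N D] [FiniteDimensional N D]
    [FiniteDimensional N E] (ι : E →ₐ[N] D) {z : D}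
    (hz : z ∈ Subalgebra.centralizer N (Set.range ι))
    (hc : ∀ w ∈ Subalgebra.centralizer N (Set.range ι), w * z = z * w) : z ∈ Set.range ι := by
  let _ := bimodule ι
  have := bimodule_smulCommClass ι
  obtain ⟨y⟩ := exists_bimodule_equiv ι
  let f : D →ₗ[D ⊗[N] E] D := (bimoduleEndEquiv ι).symm ⟨z, hz⟩
  have hf : ∀ v, f v = v * z := fun _ => rfl
  have hcomm : ∀ (g : D →ₗ[D ⊗[N] E] D) v, g (f v) = f (g v) := fun g v => by
    obtain ⟨w, rfl⟩ := (bimoduleEndEquiv ι).symm.surjective g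
    change v * z * w = v * w * z
    rw [mul_assoc, mul_assoc, hc w w.2]
  let F : (Fin (Module.finrank N E) → D) →ₗ[D ⊗[N] E] (Fin (Module.finrank N E) → D) :=
    LinearMap.pi fun i => f ∘ₗ LinearMap.proj i
  have hF : ∀ v i, F v i = f (v i) := fun _ _ => rfl
  have hFcomm : ∀ (G : (Fin (Module.finrank N E) → D) →ₗ[D ⊗[N] E] (Fin (Module.finrank N E) → D))
      v, G (F v) = F (G v) := fun G v => by
    suffices G ∘ₗ F = F ∘ₗ G from LinearMap.congr_fun this v
    refine LinearMap.pi_ext fun j x => funext fun i => ?_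
    have hsingle : F (Pi.single j x) = Pi.single j (f x) := funext fun k => by
      rw [hF]
      exact Pi.apply_single (fun _ => f) (fun _ => map_zero f) j x k
    rw [LinearMap.comp_apply, LinearMap.comp_apply, hsingle, hF]
    exact hcomm (LinearMap.proj i ∘ₗ G ∘ₗ LinearMap.single _ (fun _ => D) j) x
  let T : (D ⊗[N] E) →ₗ[D ⊗[N] E] (D ⊗[N] E) := y.symm.toLinearMap ∘ₗ F ∘ₗ y.toLinearMap
  have hT : ∀ r, T r = r * T 1 := fun r => by
    rw [← smul_eq_mul, ← map_smul, smul_eq_mul, mul_one]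
  have hTr : ∀ r s, T (s * r) = T s * r := fun r s => by
    have := hFcomm (y.toLinearMap ∘ₗ LinearMap.toSpanSingleton _ _ r ∘ₗ y.symm.toLinearMap) (y s)
    simp only [LinearMap.comp_apply, LinearEquiv.coe_coe, LinearMap.toSpanSingleton_apply,
      smul_eq_mul, LinearEquiv.symm_apply_apply] at this
    apply y.injective
    simp only [T, LinearMap.comp_apply, LinearEquiv.coe_coe, LinearEquiv.apply_symm_apply]
    exact this.symm
  obtain ⟨e, he⟩ := exists_eq_one_tmul_of_central (Module.finBasis N E) (T 1) fun i x => by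
    have h := hT (x ⊗ₜ 1)
    rw [← one_mul (x ⊗ₜ 1 : D ⊗[N] E), hTr, one_mul] at h
    rw [← basis_repr_mul_tmul_one, h, tmul_one_mul_eq_smul, map_smul, Finsupp.smul_apply,
      smul_eq_mul]
  refine ⟨e, ?_⟩
  have hn : 0 < Module.finrank N E := Module.finrank_pos
  have h1 : F (fun _ => 1) = (1 ⊗ₜ e : D ⊗[N] E) • (fun _ => 1) := by
    obtain ⟨r, hr⟩ := y.surjective (fun _ => 1)
    rw [← hr, ← map_smul]
    apply y.symm.injective
    rw [y.symm_apply_apply]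
    change T r = _
    rw [← one_mul r, hTr, he, one_mul, smul_eq_mul]
  have := congrFun h1 ⟨0, hn⟩
  rw [hF, hf, one_mul, Pi.smul_apply, bimodule_tmul_smul, one_mul, one_mul] at this
  exact this.symm

end Centralizer

section Final

theorem map_mul_map_eq_map_of_norm {E D M L Γ : Type*} [Field E] [DivisionRing D] [Algebra E D]
    [Algebra.IsCentral E D] [Field M] [Algebra E M] [Field L] [Algebra E L] [CommGroupWithZero Γ]
    {ℓ : ℕ} (hℓ : ℓ.Prime) (hD : Module.finrank E D = ℓ ^ 2) (hM : Module.finrank E M = ℓ)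
    (hL : Module.finrank E L = ℓ) (χ : D →*₀ Γ) (μ : M →ₐ[E] D) (ν : L →ₐ[E] D) (ν' : L →+* D)
    {σ : E →+* E} (hσ : Function.Surjective σ)
    (hν' : ∀ e, ν' (algebraMap E L e) = algebraMap E D (σ e)) {θ : M} {g : L} (hg : g ≠ 0)
    (h : Algebra.norm E θ * Algebra.norm E g = σ (Algebra.norm E g)) :
    χ (μ θ) * χ (ν g) = χ (ν' g) := by
  have : FiniteDimensional E L := .of_finrank_pos (hL ▸ hℓ.pos)
  obtain ⟨ψ⟩ := exists_algHom_matrix hℓ.pos hD hM μ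
  have hθ := det_map_eq_norm hℓ hD ψ hM (σ := RingHom.id E) Function.surjective_id
    (μ : M →+* D) μ.commutes θ
  have hνg := det_map_eq_norm hℓ hD ψ hL (σ := RingHom.id E) Function.surjective_id
    (ν : L →+* D) ν.commutes g
  have hν'g := det_map_eq_norm hℓ hD ψ hL hσ ν' hν' g
  have hg0 : ν' g ≠ 0 := (map_ne_zero ν').2 hg
  have hw : μ θ * ν g = μ θ * ν g * (ν' g)⁻¹ * ν' g := by rw [inv_mul_cancel_right₀ hg0]
  rw [← map_mul, hw, map_mul, map_eq_one_of_det_eq_one hℓ hD hM μ ψ χ ?_, one_mul]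
  have hne : algebraMap E M (σ (Algebra.norm E g)) ≠ 0 :=
    (map_ne_zero _).2 ((map_ne_zero σ).2 (Algebra.norm_ne_zero_iff.2 hg))
  refine mul_right_cancel₀ hne ?_
  rw [← hν'g, ← Matrix.det_mul, ← map_mul, ← hw, map_mul, Matrix.det_mul, hν'g, one_mul, ← h,
    map_mul]
  exact congrArg₂ _ hθ hνg

open scoped Classical in
/-- The class of an element of a division ring in the abelianized unit group. -/
noncomputable def abelianizationClass (D : Type*) [DivisionRing D] :
    D →*₀ WithZero (Abelianization Dˣ) :=
  (WithZero.map' Abelianization.of).comp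
    (WithZero.withZeroUnitsEquiv.symm : D ≃* WithZero Dˣ).toMonoidWithZeroHom

open scoped Classical in
theorem mem_commutator_of_abelianizationClass_eq_one {D : Type*} [DivisionRing D] {u : Dˣ}
    (h : abelianizationClass D u = 1) : u ∈ commutator Dˣ := by
  have : WithZero.withZeroUnitsEquiv.symm (u : D) = (u : WithZero Dˣ) := by
    rw [MulEquiv.symm_apply_eq]
    rfl
  have h' : WithZero.map' Abelianization.of (WithZero.withZeroUnitsEquiv.symm (u : D)) = 1 := h
  rw [this, WithZero.map'_coe] at h'
  exact (QuotientGroup.eq_one_iff u).1 (WithZero.coe_injective h')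

variable {N D E : Type*} [Field N] [DivisionRing D] [Algebra N D] [Field E] [Algebra N E]

noncomputable instance centralizerDivisionRing (S : Set D) :
    DivisionRing (Subalgebra.centralizer N S) :=
  DivisionRing.ofIsUnitOrEqZero fun a => by
    rcases eq_or_ne a 0 with h | h
    · exact Or.inr h
    have h0 : (a : D) ≠ 0 := fun h0 => h (Subtype.ext h0)
    exact Or.inl ⟨⟨a, ⟨(a : D)⁻¹, Set.inv_mem_centralizer₀ a.2⟩, Subtype.ext (mul_inv_cancel₀ h0),
      Subtype.ext (inv_mul_cancel₀ h0)⟩, rfl⟩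

/-- The centralizer of a subfield is an algebra over that subfield. -/
noncomputable abbrev centralizerAlgebra (ι : E →ₐ[N] D) :
    Algebra E (Subalgebra.centralizer N (Set.range ι)) :=
  RingHom.toAlgebra'
    { toFun e := ⟨ι e, by rintro _ ⟨e', rfl⟩; rw [← map_mul, ← map_mul, mul_comm]⟩
      map_one' := Subtype.ext (map_one ι)
      map_mul' e e' := Subtype.ext (map_mul ι e e')
      map_zero' := Subtype.ext (map_zero ι)
      map_add' e e' := Subtype.ext (map_add ι e e') }
    fun e x => Subtype.ext (x.2 (ι e) ⟨e, rfl⟩)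

theorem centralizerAlgebra_isCentral [Algebra.IsCentral N D] [FiniteDimensional N D]
    [FiniteDimensional N E] (ι : E →ₐ[N] D) :
    letI := centralizerAlgebra ι
    Algebra.IsCentral E (Subalgebra.centralizer N (Set.range ι)) := by
  let _ := centralizerAlgebra ι
  refine ⟨fun z hz => ?_⟩
  obtain ⟨e, he⟩ := mem_range_of_mem_centralizer_of_commute ι z.2 fun w hw =>
    congrArg Subtype.val (Subalgebra.mem_center_iff.1 hz ⟨w, hw⟩)
  exact ⟨e, Subtype.ext he⟩

theorem finrank_centralizer [Algebra.IsCentral N D] [FiniteDimensional N D]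
    [FiniteDimensional N E] (ι : E →ₐ[N] D) :
    letI := centralizerAlgebra ι
    Module.finrank N E * (Module.finrank N E *
      Module.finrank E (Subalgebra.centralizer N (Set.range ι))) = Module.finrank N D := by
  let _ := centralizerAlgebra ι
  have : IsScalarTower N E (Subalgebra.centralizer N (Set.range ι)) :=
    IsScalarTower.of_algebraMap_eq fun a => Subtype.ext (ι.commutes a).symm
  rw [Module.finrank_mul_finrank, finrank_centralizer_mul_finrank_s2]

theorem exists_mul_eq_mul_of_algHom [Algebra.IsCentral N D] [FiniteDimensional N D]
    [FiniteDimensional N E] (ι ι' : E →ₐ[N] D) : ∃ s : D, s ≠ 0 ∧ ∀ e, ι' e * s = s * ι e := by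
  obtain ⟨Y, hY, h⟩ := exists_isUnit_mul_eq_mul ((Matrix.scalarAlgHom (Fin 1) N).comp ι')
    ((Matrix.scalarAlgHom (Fin 1) N).comp ι)
  refine ⟨Y 0 0, fun h0 => hY.ne_zero ?_, fun e => ?_⟩
  · ext i j
    rw [Subsingleton.elim i 0, Subsingleton.elim j 0, h0]
    rfl
  · simpa [Matrix.mul_apply] using congrFun (congrFun (h e) 0) 0

end Final

/-- Let `D` be a central division algebra of degree `ℓ²` over `N`, `E`
a cyclic degree-`ℓ` subfield of `D` (embedded via `ι`) with Galois group generated by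
`σ`, `b ∈ Eˣ` and `c = b⁻¹·σ(b)`.  Let `θ` lie in a subfield `M₀` of the centralizer
`D₁ = C_D(E)` with `E ⊆ M₀`, `[M₀:E] = ℓ` and `N_{M₀/E}(θ) = c`.  If there are
`f ∈ Nˣ`, a subfield `L` of `D₁` containing `E` with `[L:E] = ℓ`, and `g ∈ L` with
`N_{L/E}(g) = b·f` (so `b·f` is a reduced norm from `D₁`), then `θ ∈ [Dˣ, Dˣ]`. -/
theorem statement2
    (ℓ : ℕ) (hℓ : ℓ.Prime)
    (N E : Type*) [Field N] [Field E] [Algebra N E]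
    (D : Type*) [DivisionRing D] [Algebra N D]
    (hcentral : Subalgebra.center N D = ⊥)
    (hdim : Module.finrank N D = ℓ ^ 4)
    (ι : E →ₐ[N] D)
    [IsGalois N E] (hEdeg : Module.finrank N E = ℓ)
    (σ : E ≃ₐ[N] E) (hσ : ∀ τ : E ≃ₐ[N] E, τ ∈ Subgroup.zpowers σ)
    (b : E) (hb : b ≠ 0)
    (c : E) (hc : c = b⁻¹ * σ b)
    -- the subfield `M₀` of the centralizer `D₁ = C_D(E)` containing `E`
    (M₀ : Type*) [Field M₀] [Algebra N M₀] [Algebra E M₀] [IsScalarTower N E M₀]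
    (μ : M₀ →ₐ[N] D)
    (hμE : ∀ e : E, μ (algebraMap E M₀ e) = ι e)
    (hμcent : Set.range μ ⊆ (Subalgebra.centralizer N (Set.range ι) : Set D))
    (hM₀deg : Module.finrank E M₀ = ℓ)
    (θ : M₀) (hθ : Algebra.norm E θ = c)
    -- the hypothesis: `b·f` is a reduced norm from `D₁ = C_D(E)`
    (f : N) (hf : f ≠ 0)
    (L : Type*) [Field L] [Algebra N L] [Algebra E L] [IsScalarTower N E L]
    (ν : L →ₐ[N] D)
    (hνE : ∀ e : E, ν (algebraMap E L e) = ι e)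
    (hνcent : Set.range ν ⊆ (Subalgebra.centralizer N (Set.range ι) : Set D))
    (hLdeg : Module.finrank E L = ℓ)
    (g : L) (hg : Algebra.norm E g = b * algebraMap N E f) :
    ∃ u : Dˣ, (u : D) = μ θ ∧ u ∈ commutator Dˣ := by
  have hcent : Algebra.IsCentral N D := ⟨hcentral.le⟩
  have hfD : FiniteDimensional N D := .of_finrank_pos (by rw [hdim]; exact pow_pos hℓ.pos 4)
  have hfE : FiniteDimensional N E := .of_finrank_pos (hEdeg ▸ hℓ.pos)
  have hfL : FiniteDimensional E L := .of_finrank_pos (hLdeg ▸ hℓ.pos)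
  have hfM : FiniteDimensional E M₀ := .of_finrank_pos (hM₀deg ▸ hℓ.pos)
  obtain ⟨s, hs, hsι⟩ := exists_mul_eq_mul_of_algHom ι (ι.comp (σ : E →ₐ[N] E))
  let _ := centralizerAlgebra ι
  have := centralizerAlgebra_isCentral ι
  have hD : Module.finrank E (Subalgebra.centralizer N (Set.range ι)) = ℓ ^ 2 := by
    have h := finrank_centralizer ι
    rw [hEdeg, hdim, ← mul_assoc] at h
    refine Nat.eq_of_mul_eq_mul_left (Nat.mul_pos hℓ.pos hℓ.pos) (h.trans (by ring))
  have hsmem : ∀ x, s * ν x * s⁻¹ ∈ Subalgebra.centralizer N (Set.range ι) := fun x => by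
    rintro _ ⟨e, rfl⟩
    obtain ⟨e, rfl⟩ := σ.surjective e
    have h1 : ι (σ e) * s = s * ι e := hsι e
    have h2 : s⁻¹ * ι (σ e) = ι e * s⁻¹ := by
      rw [inv_mul_eq_iff_eq_mul₀ hs, ← mul_assoc, ← h1, mul_inv_cancel_right₀ hs]
    have h3 : ι e * ν x = ν x * ι e := hνcent ⟨x, rfl⟩ (ι e) ⟨e, rfl⟩
    rw [← mul_assoc, ← mul_assoc, h1, mul_assoc s, h3, mul_assoc (s * ν x), h2]
    simp only [mul_assoc]
  let μ' : M₀ →ₐ[E] Subalgebra.centralizer N (Set.range ι) :=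
    { (μ.codRestrict _ fun x => hμcent ⟨x, rfl⟩).toRingHom with
      commutes' e := Subtype.ext (hμE e) }
  let ν' : L →ₐ[E] Subalgebra.centralizer N (Set.range ι) :=
    { (ν.codRestrict _ fun x => hνcent ⟨x, rfl⟩).toRingHom with
      commutes' e := Subtype.ext (hνE e) }
  let ν'' : L →+* Subalgebra.centralizer N (Set.range ι) :=
    { toFun x := ⟨s * ν x * s⁻¹, hsmem x⟩
      map_one' := Subtype.ext (by simp [hs])
      map_mul' x y := Subtype.ext (by simp [mul_assoc, hs])
      map_zero' := Subtype.ext (by simp)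
      map_add' x y := Subtype.ext (by simp [mul_add, add_mul]) }
  have hbf : b * algebraMap N E f ≠ 0 := mul_ne_zero hb ((map_ne_zero _).2 hf)
  have hg0 : g ≠ 0 := Algebra.norm_ne_zero_iff.1 (hg ▸ hbf)
  have hθ0 : θ ≠ 0 := Algebra.norm_ne_zero_iff.1 (by
    rw [hθ, hc]
    exact mul_ne_zero (inv_ne_zero hb) ((map_ne_zero σ).2 hb))
  let χ : Subalgebra.centralizer N (Set.range ι) →*₀ WithZero (Abelianization Dˣ) :=
    (abelianizationClass D).comp
      ((Subalgebra.centralizer N (Set.range ι)).val : _ →+* D).toMonoidWithZeroHom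
  have key := map_mul_map_eq_map_of_norm hℓ hD hM₀deg hLdeg χ μ' ν' ν'' (σ := (σ : E →+* E))
    σ.surjective (fun e => Subtype.ext (by
      change s * ν (algebraMap E L e) * s⁻¹ = ι (σ e)
      rw [hνE, ← hsι e, mul_inv_cancel_right₀ hs]
      rfl)) (θ := θ) hg0 (by
      rw [hθ, hc, hg]
      simp only [RingHom.coe_coe, map_mul, AlgEquiv.commutes]
      field_simp)
  change abelianizationClass D (μ θ) * abelianizationClass D (ν g) =
    abelianizationClass D (s * ν g * s⁻¹) at key
  have hχg : abelianizationClass D (ν g) ≠ 0 := (map_ne_zero _).2 ((map_ne_zero ν).2 hg0)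
  have hχs : abelianizationClass D s ≠ 0 := (map_ne_zero _).2 hs
  rw [map_mul, map_mul, map_inv₀, mul_right_comm, mul_inv_cancel₀ hχs] at key
  exact ⟨Units.mk0 (μ θ) ((map_ne_zero μ).2 hθ0), rfl,
    mem_commutator_of_abelianizationClass_eq_one (mul_right_cancel₀ hχg key)⟩
end

section
/- Let F be a field and ℓ a prime different from the characteristic of F. Let Y/F be a cyclic Galois field extension of degree ℓ with Galois group generated by ψ. Suppose there exists an integer m ≥ 1 such that F contains no primitive ℓ^m-th root of unity. Let g ∈ Yˣ and set μ := g^{ℓ^{2m}}, and assume N_{Y/F}(μ) = 1. Then there exists h ∈ Yˣ such that μ = h^{−ℓ}·ψ(h)^{ℓ}. -/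
/-- If a monoid has no primitive `p ^ m`-th root of unity, then every root of unity of `p`-power
order is killed by `p ^ (m - 1)`. -/
theorem pow_prime_pow_pred_eq_one_of_forall_not_isPrimitiveRoot {M : Type*} [CommMonoid M]
    {p m n : ℕ} (hp : p.Prime) (hroot : ¬ ∃ ζ : M, IsPrimitiveRoot ζ (p ^ m)) {x : M}
    (hx : x ^ p ^ n = 1) : x ^ p ^ (m - 1) = 1 := by
  obtain ⟨k, -, hk⟩ := (Nat.dvd_prime_pow hp).1 (orderOf_dvd_of_pow_eq_one hx)
  have hkm : k < m := by
    by_contra! hmk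
    refine hroot ⟨x ^ p ^ (k - m), (IsPrimitiveRoot.orderOf x).pow ?_ ?_⟩
    · exact hk ▸ pow_pos hp.pos k
    · rw [hk, ← pow_add, Nat.sub_add_cancel hmk]
  exact orderOf_dvd_iff_pow_eq_one.1 (hk ▸ pow_dvd_pow p (by lia))

/-- The norm of a cyclic extension is the product of the conjugates under the powers of a generator
of the Galois group. -/
theorem algebraMap_norm_eq_prod_range_pow {K L : Type*} [Field K] [Field L] [Algebra K L]
    [FiniteDimensional K L] [IsGalois K L] {ψ : L ≃ₐ[K] L}
    (hψ : ∀ τ : L ≃ₐ[K] L, τ ∈ Subgroup.zpowers ψ) (x : L) :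
    algebraMap K L (Algebra.norm K x) = ∏ i ∈ Finset.range (orderOf ψ), (ψ ^ i) x := by
  classical
  rw [Algebra.norm_eq_prod_automorphisms, ← IsCyclic.image_range_orderOf hψ, Finset.prod_image]
  intro i hi j hj hij
  exact pow_injOn_Iio_orderOf (by simpa using hi) (by simpa using hj) hij

/-- Hilbert's Theorem 90 for cyclic extensions of fields in arbitrary universes. -/
theorem exists_ne_zero_mul_map_eq_of_norm_eq_one {K L : Type*} [Field K] [Field L] [Algebra K L]
    [FiniteDimensional K L] [IsGalois K L] {ψ : L ≃ₐ[K] L}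
    (hψ : ∀ τ : L ≃ₐ[K] L, τ ∈ Subgroup.zpowers ψ) {x : L} (hx : Algebra.norm K x = 1) :
    ∃ y : L, y ≠ 0 ∧ x * ψ y = y := by
  let c : ℕ → L := fun i ↦ ∏ j ∈ Finset.range i, (ψ ^ j) x
  have hc (i : ℕ) : x * ψ (c i) = c (i + 1) := by
    simp only [c]
    rw [Finset.prod_range_succ', map_prod, mul_comm]
    simp [pow_succ']
  have hcn : c (orderOf ψ) = 1 := by
    simp only [c]
    rw [← algebraMap_norm_eq_prod_range_pow hψ, hx, map_one]
  have hpos : 0 < orderOf ψ := orderOf_pos ψ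
  obtain ⟨θ, hθ⟩ : ∃ θ : L, ∑ i ∈ Finset.range (orderOf ψ), c i * (ψ ^ i) θ ≠ 0 := by
    by_contra! h
    have hinj : Function.Injective
        (fun i : Fin (orderOf ψ) ↦ ((ψ ^ (i : ℕ) : L ≃ₐ[K] L) : L →* L)) := by
      intro i j hij
      refine Fin.ext (pow_injOn_Iio_orderOf i.2 j.2 (AlgEquiv.ext fun a ↦ ?_))
      exact DFunLike.congr_fun hij a
    have hli := (linearIndependent_monoidHom L L).comp _ hinj
    refine one_ne_zero (Fintype.linearIndependent_iff.1 hli (fun i ↦ c i) ?_ ⟨0, hpos⟩)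
    ext θ
    simpa [Finset.sum_range] using h θ
  refine ⟨_, hθ, ?_⟩
  have hstep (i : ℕ) : x * ψ (c i * (ψ ^ i) θ) = c (i + 1) * (ψ ^ (i + 1)) θ := by
    rw [map_mul, ← mul_assoc, hc, pow_succ', AlgEquiv.mul_apply]
  have hsum := (Finset.sum_range_succ (fun i ↦ c i * (ψ ^ i) θ) (orderOf ψ)).symm.trans
    (Finset.sum_range_succ' (fun i ↦ c i * (ψ ^ i) θ) (orderOf ψ))
  have hlast : c (orderOf ψ) * (ψ ^ orderOf ψ) θ = c 0 * (ψ ^ 0) θ := by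
    rw [hcn, pow_orderOf_eq_one, pow_zero]
    simp [c]
  rw [map_sum, Finset.mul_sum, Finset.sum_congr rfl fun i _ ↦ hstep i]
  rw [hlast] at hsum
  exact (add_right_cancel hsum).symm

/-- Norm-one elements of the form `g^(ℓ^(2m))` in a cyclic degree-`ℓ`
extension `Y/F` (where `F` has no primitive `ℓ^m`-th root of unity) are of the form
`h⁻ℓ · ψ(h)^ℓ`. -/
theorem statement3
    (ℓ : ℕ) (hℓ : ℓ.Prime)
    (F Y : Type*) [Field F] [Field Y] [Algebra F Y]
    (hchar : (ℓ : F) ≠ 0)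
    [IsGalois F Y] (hdeg : Module.finrank F Y = ℓ)
    (ψ : Y ≃ₐ[F] Y) (hψ : ∀ τ : Y ≃ₐ[F] Y, τ ∈ Subgroup.zpowers ψ)
    (m : ℕ) (hm : 1 ≤ m)
    (hroot : ¬ ∃ ζ : F, IsPrimitiveRoot ζ (ℓ ^ m))
    (g : Y) (hg : g ≠ 0)
    (hμ : Algebra.norm F (g ^ ℓ ^ (2 * m)) = 1) :
    ∃ h : Y, h ≠ 0 ∧ g ^ ℓ ^ (2 * m) = (h ^ ℓ)⁻¹ * ψ h ^ ℓ := by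
  have : FiniteDimensional F Y := .of_finrank_pos (hdeg ▸ hℓ.pos)
  have hnorm : Algebra.norm F (g ^ ℓ ^ (m - 1)) = 1 := by
    rw [map_pow] at hμ ⊢
    exact pow_prime_pow_pred_eq_one_of_forall_not_isPrimitiveRoot hℓ hroot hμ
  obtain ⟨y, hy0, hy⟩ := exists_ne_zero_mul_map_eq_of_norm_eq_one hψ hnorm
  refine ⟨(y ^ ℓ ^ m)⁻¹, inv_ne_zero (pow_ne_zero _ hy0), ?_⟩
  have hexp : ℓ ^ (2 * m) = ℓ ^ (m - 1) * (ℓ ^ m * ℓ) := by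
    rw [← pow_succ, ← pow_add]
    congr 1
    lia
  rw [← eq_div_iff ((map_ne_zero ψ).2 hy0)] at hy
  rw [hexp, pow_mul, hy, pow_mul, div_pow, div_pow, map_inv₀, map_pow, inv_pow, inv_pow,
    inv_inv, div_eq_mul_inv]
end
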